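/- arXiv:2009.14397 — 2 statements merged into one kernel-verified Lean document; each statement's English description precedes it below -/
import Mathlib

section
/- Fix integers d ≥ 3 and L ≥ 3 and let κ_NTK^L be the L-layer neural tangent kernel function of a fully-connected ReLU network. Then there exist nonzero real constants C_even(d,L) and C_odd(d,L) such that μ_k(κ_NTK^L) ∼ C_even(d,L) · k^{−d} as k → ∞ along even k and μ_k(κ_NTK^L) ∼ C_odd(d,L) · k^{−d} as k → ∞ along odd k. -/
open Filter Asymptotics Real Set Topology

/-- Legendre polynomial of degree `k` in dimension `d` (Rodrigues formula). -/
noncomputable def legendreP (d k : ℕ) (t : ℝ) : ℝ :=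
  (-1 / 2 : ℝ) ^ k * (Real.Gamma (((d : ℝ) - 1) / 2) / Real.Gamma ((k : ℝ) + ((d : ℝ) - 1) / 2)) *
    (1 - t ^ 2) ^ ((3 - (d : ℝ)) / 2) *
    iteratedDeriv k (fun s : ℝ => (1 - s ^ 2) ^ ((k : ℝ) + ((d : ℝ) - 3) / 2)) t

/-- Surface area `ω_{p-1}` of the unit sphere in `ℝ^p`. -/
noncomputable def sphereSurface (p : ℕ) : ℝ :=
  2 * Real.pi ^ ((p : ℝ) / 2) / Real.Gamma ((p : ℝ) / 2)

/-- `μ_k(κ)`, the `k`-th Legendre coefficient of `κ` in dimension `d`. -/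
noncomputable def legendreCoeff (d k : ℕ) (κ : ℝ → ℝ) : ℝ :=
  (sphereSurface (d - 1) / sphereSurface d) *
    ∫ t in (-1 : ℝ)..1, κ t * legendreP d k t * (1 - t ^ 2) ^ (((d : ℝ) - 3) / 2)

/-- The degree-0 arc-cosine function `κ₀(u) = 1 - arccos(u)/π`. -/
noncomputable def kappa0 (u : ℝ) : ℝ := 1 - Real.arccos u / Real.pi

/-- The degree-1 arc-cosine function `κ₁(u) = (√(1-u²) + u(π - arccos u))/π`. -/
noncomputable def kappa1 (u : ℝ) : ℝ :=
  (Real.sqrt (1 - u ^ 2) + u * (Real.pi - Real.arccos u)) / Real.pi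

/-- The `ℓ`-layer neural tangent kernel function of a fully-connected ReLU network
(defined for `ℓ ≥ 2`; values below 2 are set to the 2-layer NTK):
`κ_NTK^2(u) = u κ₀(u) + κ₁(u)` and
`κ_NTK^ℓ(u) = κ_NTK^{ℓ-1}(u) · κ₀(κ₁^{∘(ℓ-2)}(u)) + κ₁^{∘(ℓ-1)}(u)` for `ℓ ≥ 3`. -/
noncomputable def kappaNTK : ℕ → ℝ → ℝ
  | 0, u => u * kappa0 u + kappa1 u
  | 1, u => u * kappa0 u + kappa1 u
  | 2, u => u * kappa0 u + kappa1 u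
  | n + 3, u => kappaNTK (n + 2) u * kappa0 (kappa1^[n + 1] u) + kappa1^[n + 2] u


/-- Unnormalized Gegenbauer polynomials: `(1-t²)^{m/2} gp n m = (d/dt)^n (1-t²)^{n+m/2}`. -/
noncomputable def gp : ℕ → ℕ → Polynomial ℝ
  | 0, _ => 1
  | n + 1, m => (1 - Polynomial.X ^ 2) * Polynomial.derivative (gp n (m + 2))
      - Polynomial.C ((m : ℝ) + 2) * Polynomial.X * gp n (m + 2)

lemma gp_deriv (n : ℕ) : ∀ m : ℕ, Polynomial.derivative (gp (n + 1) m) =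
    - Polynomial.C (((n : ℝ) + 1) * (n + m + 2)) * gp n (m + 2) := by
  induction n with
  | zero =>
    intro m
    simp [gp]
  | succ n ih =>
    intro m
    have h := ih (m + 2)
    rw [gp]
    simp only [Polynomial.derivative_sub, Polynomial.derivative_mul, Polynomial.derivative_C,
      Polynomial.derivative_X, Polynomial.derivative_X_pow, Polynomial.derivative_one]
    rw [h]
    simp only [Polynomial.derivative_mul, Polynomial.derivative_neg, Polynomial.derivative_C]
    have h2 : gp (n + 1) (m + 2) = (1 - Polynomial.X ^ 2) *
      Polynomial.derivative (gp n (m + 2 + 2))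
      - Polynomial.C (((m + 2 : ℕ) : ℝ) + 2) * Polynomial.X * gp n (m + 2 + 2) := rfl
    rw [h2]
    push_cast
    simp only [Polynomial.C_add, Polynomial.C_mul, Polynomial.C_1]
    have e2 : (Polynomial.C (2:ℝ)) = 2 := rfl
    simp only [e2]
    ring

lemma gp_comp_neg (n : ℕ) : ∀ m : ℕ, (gp n m).comp (-Polynomial.X) = (-1) ^ n * gp n m := by
  induction n with
  | zero => intro m; simp [gp]
  | succ n ih =>
    intro m
    have h := ih (m + 2)
    have h2 := congrArg Polynomial.derivative h
    rw [Polynomial.derivative_comp] at h2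
    have h3 : Polynomial.derivative ((-1) ^ n * gp n (m + 2)) =
      (-1) ^ n * Polynomial.derivative (gp n (m + 2)) := by
      have : ((-1 : Polynomial ℝ)) ^ n = Polynomial.C ((-1) ^ n) := by simp
      rw [this, Polynomial.derivative_C_mul]
    rw [h3] at h2
    simp only [Polynomial.derivative_neg, Polynomial.derivative_X] at h2
    simp only [gp, Polynomial.sub_comp, Polynomial.mul_comp, h, Polynomial.one_comp,
      Polynomial.pow_comp, Polynomial.X_comp, Polynomial.C_comp]
    have h4 : (Polynomial.derivative (gp n (m + 2))).comp (-Polynomial.X) =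
      - ((-1) ^ n * Polynomial.derivative (gp n (m + 2))) := by
      linear_combination (-1 : Polynomial ℝ) * h2
    rw [h4]
    ring

/-- `gp` evaluated at `cos θ`. -/
noncomputable def gq (n m : ℕ) (θ : ℝ) : ℝ := (gp n m).eval (cos θ)
/-- derivative of `gp` evaluated at `cos θ`. -/
noncomputable def gq' (n m : ℕ) (θ : ℝ) : ℝ := (Polynomial.derivative (gp n m)).eval (cos θ)

lemma gq_zero (m : ℕ) (θ : ℝ) : gq 0 m θ = 1 := by simp [gq, gp]

lemma gq_hasDerivAt (n m : ℕ) (θ : ℝ) :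
    HasDerivAt (gq n m) (-(sin θ) * gq' n m θ) θ := by
  have := ((gp n m).hasDerivAt (cos θ)).comp θ (hasDerivAt_cos θ)
  refine this.congr_deriv ?_
  simp only [gq']; ring

lemma gq_cont (n m : ℕ) : Continuous (gq n m) :=
  (gp n m).continuous.comp continuous_cos
lemma gq'_cont (n m : ℕ) : Continuous (gq' n m) :=
  (Polynomial.derivative (gp n m)).continuous.comp continuous_cos

lemma gq_rec (n m : ℕ) (θ : ℝ) :
    sin θ ^ 2 * gq' n (m + 2) θ = gq (n + 1) m θ + (m + 2) * cos θ * gq n (m + 2) θ := by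
  have h : gq (n + 1) m θ = (1 - cos θ ^ 2) * gq' n (m + 2) θ
      - ((m : ℝ) + 2) * cos θ * gq n (m + 2) θ := by
    simp [gq, gq', gp]
  rw [h]
  linear_combination (gq' n (m + 2) θ) * (sin_sq_add_cos_sq θ)

lemma gq'_succ (n m : ℕ) (θ : ℝ) :
    gq' (n + 1) m θ = - (((n : ℝ) + 1) * (n + m + 2)) * gq n (m + 2) θ := by
  simp [gq', gp_deriv, gq]

lemma gq_pi_sub (n m : ℕ) (θ : ℝ) : gq n m (π - θ) = (-1) ^ n * gq n m θ := by
  have := congrArg (Polynomial.eval (cos θ)) (gp_comp_neg n m)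
  simp only [gq, cos_pi_sub]
  simpa using this

lemma ftc_zero {W W' : ℝ → ℝ} (h : ∀ θ ∈ Icc (0:ℝ) π, HasDerivAt W (W' θ) θ)
    (hc : ContinuousOn W' (Icc 0 π)) (h0 : W 0 = 0) (h1 : W π = 0) :
    ∫ θ in (0:ℝ)..π, W' θ = 0 := by
  rw [← uIcc_of_le pi_pos.le] at h hc
  rw [intervalIntegral.integral_eq_sub_of_hasDerivAt h hc.intervalIntegrable, h0, h1, sub_zero]

lemma ii {f : ℝ → ℝ} (hc : ContinuousOn f (Icc 0 π)) :
    IntervalIntegrable f MeasureTheory.volume 0 π := by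
  rw [← uIcc_of_le pi_pos.le] at hc
  exact hc.intervalIntegrable

/-- One integration by parts. -/
lemma ibp_step {N N' : ℝ → ℝ} (s n m : ℕ)
    (hN : ∀ θ ∈ Icc (0:ℝ) π, HasDerivAt N (N' θ) θ) (hN' : ContinuousOn N' (Icc 0 π)) :
    ∫ θ in (0:ℝ)..π, N θ * sin θ ^ s * gq (n + 1) m θ =
    ∫ θ in (0:ℝ)..π, (N' θ * sin θ + ((s : ℝ) - m - 1) * N θ * cos θ) * sin θ ^ s
      * gq n (m + 2) θ := by
  have hNc : ContinuousOn N (Icc 0 π) := fun θ hθ => (hN θ hθ).continuousAt.continuousWithinAt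
  have c1 : ∀ n m, ContinuousOn (gq n m) (Icc 0 π) := fun n m => (gq_cont n m).continuousOn
  have hA : ContinuousOn (fun θ => N θ * sin θ ^ s * gq (n + 1) m θ) (Icc 0 π) := by
    have := c1 (n+1) m
    fun_prop
  have hB : ContinuousOn (fun θ => (N' θ * sin θ + ((s : ℝ) - m - 1) * N θ * cos θ) * sin θ ^ s
      * gq n (m + 2) θ) (Icc 0 π) := by
    have := c1 n (m+2)
    fun_prop
  have key := ftc_zero (W := fun θ => N θ * sin θ ^ (s + 1) * gq n (m + 2) θ)
    (W' := fun θ => (N' θ * sin θ + ((s : ℝ) - m - 1) * N θ * cos θ) * sin θ ^ s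
      * gq n (m + 2) θ - N θ * sin θ ^ s * gq (n + 1) m θ) ?_ (hB.sub hA) (by simp) (by simp)
  · rw [intervalIntegral.integral_sub (ii hB) (ii hA)] at key
    linarith
  · intro θ hθ
    have h1 := ((hN θ hθ).mul ((hasDerivAt_sin θ).pow (s + 1))).mul (gq_hasDerivAt n (m + 2) θ)
    refine h1.congr_deriv ?_
    have h2 := gq_rec n m θ
    simp only [Pi.mul_apply, Pi.pow_apply, Nat.add_sub_cancel]
    push_cast
    linear_combination (- N θ * sin θ ^ s) * h2

/-- squared norm -/
noncomputable def gM (n m : ℕ) : ℝ := ∫ θ in (0:ℝ)..π, gq n m θ ^ 2 * sin θ ^ (m + 1)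

lemma gM_succ (n m : ℕ) : gM (n + 1) m = ((n : ℝ) + 1) * (n + m + 2) * gM n (m + 2) := by
  have h := ibp_step (N := gq (n + 1) m) (N' := fun θ => -(sin θ) * gq' (n + 1) m θ)
    (m + 1) n m (fun θ _ => gq_hasDerivAt _ _ θ)
    (((continuous_sin.neg).mul (gq'_cont _ _)).continuousOn)
  unfold gM
  rw [← intervalIntegral.integral_const_mul]
  rw [show (fun θ => gq (n + 1) m θ ^ 2 * sin θ ^ (m + 1)) =
    fun θ => gq (n + 1) m θ * sin θ ^ (m + 1) * gq (n + 1) m θ by ext; ring, h]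
  congr 1
  ext θ
  rw [gq'_succ]
  push_cast
  ring

lemma gM_zero (m : ℕ) : gM 0 m = ∫ θ in (0:ℝ)..π, sin θ ^ (m + 1) := by
  simp [gM, gq_zero]

lemma gM_zero_rec (m : ℕ) : ((m : ℝ) + 3) * gM 0 (m + 2) = (m + 2) * gM 0 m := by
  rw [gM_zero, gM_zero, show m + 2 + 1 = (m + 1) + 2 by ring, integral_sin_pow]
  simp
  have : (m : ℝ) + 1 + 2 ≠ 0 := by positivity
  field_simp
  ring

lemma gM_nonneg (n m : ℕ) : 0 ≤ gM n m := by
  apply intervalIntegral.integral_nonneg pi_pos.le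
  intro θ hθ
  have := sin_nonneg_of_mem_Icc hθ
  positivity


/-- comparator integrals -/
noncomputable def gA (e n m : ℕ) : ℝ :=
  ∫ θ in (0:ℝ)..π, sin (θ / 2) ^ (e + 2) * cos (θ / 2) ^ (m + 1) * gq n m θ

lemma sin_half_deriv (θ : ℝ) : HasDerivAt (fun θ : ℝ => sin (θ / 2)) (cos (θ / 2) / 2) θ := by
  have := (hasDerivAt_sin (θ / 2)).comp θ ((hasDerivAt_id θ).div_const 2)
  refine this.congr_deriv ?_
  ring

lemma cos_half_deriv (θ : ℝ) : HasDerivAt (fun θ : ℝ => cos (θ / 2)) (-sin (θ / 2) / 2) θ := by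
  have := (hasDerivAt_cos (θ / 2)).comp θ ((hasDerivAt_id θ).div_const 2)
  refine this.congr_deriv ?_
  ring

lemma sin_half (θ : ℝ) : sin θ = 2 * sin (θ / 2) * cos (θ / 2) := by
  rw [← sin_two_mul]; congr 1; ring
lemma cos_half (θ : ℝ) : cos θ = cos (θ / 2) ^ 2 - sin (θ / 2) ^ 2 := by
  rw [← cos_two_mul']; congr 1; ring

lemma gA_succ (e n m : ℕ) : gA e (n + 1) m = ((e : ℝ) + 1 - m) * gA e n (m + 2) := by
  have c1 := gq_cont (n+1) m
  have c2 := gq_cont n (m+2)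
  have hA : Continuous (fun θ : ℝ => sin (θ / 2) ^ (e + 2) * cos (θ / 2) ^ (m + 1)
    * gq (n + 1) m θ) := by fun_prop
  have hB : Continuous (fun θ : ℝ => sin (θ / 2) ^ (e + 2) * cos (θ / 2) ^ (m + 2 + 1)
    * gq n (m + 2) θ) := by fun_prop
  have key := ftc_zero (W := fun θ => sin (θ / 2) ^ (e + 3) * cos (θ / 2) ^ (m + 2)
      * gq n (m + 2) θ)
    (W' := fun θ => ((e : ℝ) + 1 - m) / 2 * (sin (θ / 2) ^ (e + 2) * cos (θ / 2) ^ (m + 2 + 1)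
      * gq n (m + 2) θ) - 1 / 2 * (sin (θ / 2) ^ (e + 2) * cos (θ / 2) ^ (m + 1)
      * gq (n + 1) m θ)) ?_ (by fun_prop) (by simp) (by simp)
  · rw [intervalIntegral.integral_sub ((ii hB.continuousOn).const_mul _)
      ((ii hA.continuousOn).const_mul _), intervalIntegral.integral_const_mul,
      intervalIntegral.integral_const_mul] at key
    unfold gA
    linarith
  · intro θ _
    have h1 := (((sin_half_deriv θ).pow (e + 3)).mul ((cos_half_deriv θ).pow (m + 2))).mul
      (gq_hasDerivAt n (m + 2) θ)
    refine h1.congr_deriv ?_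
    have h2 := gq_rec n m θ
    rw [sin_half θ, cos_half θ] at h2
    simp only [Pi.mul_apply, Pi.pow_apply]
    rw [sin_half θ]
    push_cast
    try simp only [Nat.add_one_sub_one, show e + 3 - 1 = e + 2 from rfl, show m + 2 - 1 = m + 1 from rfl]
    linear_combination (-(1/2) * sin (θ / 2) ^ (e + 2) * cos (θ / 2) ^ (m + 1)) * h2

lemma gA_zero_rec (e m : ℕ) : ((e : ℝ) + m + 5) * gA e 0 (m + 2) = (m + 2) * gA e 0 m := by
  have hA : Continuous (fun θ : ℝ => sin (θ / 2) ^ (e + 2) * cos (θ / 2) ^ (m + 1)) := by fun_prop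
  have hB : Continuous (fun θ : ℝ => sin (θ / 2) ^ (e + 2) * cos (θ / 2) ^ (m + 2 + 1)) := by
    fun_prop
  have key := ftc_zero (W := fun θ => sin (θ / 2) ^ (e + 3) * cos (θ / 2) ^ (m + 2))
    (W' := fun θ => ((e : ℝ) + m + 5) / 2 * (sin (θ / 2) ^ (e + 2) * cos (θ / 2) ^ (m + 2 + 1))
      - ((m : ℝ) + 2) / 2 * (sin (θ / 2) ^ (e + 2) * cos (θ / 2) ^ (m + 1))) ?_
      (by fun_prop) (by simp) (by simp)
  · rw [intervalIntegral.integral_sub ((ii hB.continuousOn).const_mul _)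
      ((ii hA.continuousOn).const_mul _), intervalIntegral.integral_const_mul,
      intervalIntegral.integral_const_mul] at key
    simp only [gA, gq_zero, mul_one]
    linarith
  · intro θ _
    have h1 := (((sin_half_deriv θ).pow (e + 3)).mul ((cos_half_deriv θ).pow (m + 2)))
    refine h1.congr_deriv ?_
    have h2 := sin_sq_add_cos_sq (θ / 2)
    simp only [Pi.pow_apply]
    push_cast
    try simp only [Nat.add_one_sub_one, show e + 3 - 1 = e + 2 from rfl, show m + 2 - 1 = m + 1 from rfl]
    linear_combination (-((m : ℝ) + 2)/2 * sin (θ / 2) ^ (e + 2) * cos (θ / 2) ^ (m + 1)) * h2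

lemma gA_pos (e m : ℕ) : 0 < gA e 0 m := by
  simp only [gA, gq_zero, mul_one]
  apply intervalIntegral.intervalIntegral_pos_of_pos_on
  · exact Continuous.intervalIntegrable (by fun_prop) _ _
  · intro θ hθ
    have h1 : 0 < sin (θ / 2) := sin_pos_of_pos_of_lt_pi (by linarith [hθ.1]) (by linarith [hθ.1, hθ.2])
    have h2 : 0 < cos (θ / 2) := cos_pos_of_mem_Ioo ⟨by linarith [hθ.1, pi_pos], by linarith [hθ.2]⟩
    positivity
  · exact pi_pos

lemma gA_full (e k : ℕ) : ∀ m : ℕ, gA e k m =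
    (∏ i ∈ Finset.range k, ((e : ℝ) + 1 - m - 2 * i)) * gA e 0 (m + 2 * k) := by
  induction k with
  | zero => intro m; simp
  | succ k ih =>
    intro m
    rw [gA_succ, ih, Finset.prod_range_succ']
    rw [show m + 2 + 2 * k = m + 2 * (k + 1) by ring]
    have : ∀ i : ℕ, ((e : ℝ) + 1 - (m + 2 : ℕ) - 2 * i) = (e : ℝ) + 1 - m - 2 * (i + 1 : ℕ) := by
      intro i; push_cast; ring
    simp only [this]
    push_cast
    ring

lemma gA_zero_full (e k : ℕ) : (∏ i ∈ Finset.range k, ((2 * (e : ℝ)) + 5 + 2 * i)) *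
    gA e 0 (e + 2 * k) = (∏ i ∈ Finset.range k, ((e : ℝ) + 2 + 2 * i)) * gA e 0 e := by
  induction k with
  | zero => simp
  | succ k ih =>
    rw [Finset.prod_range_succ, Finset.prod_range_succ]
    have h := gA_zero_rec e (e + 2 * k)
    push_cast at h
    rw [show e + 2 * (k + 1) = e + 2 * k + 2 by ring]
    linear_combination (∏ i ∈ Finset.range k, ((2 * (e : ℝ)) + 5 + 2 * i)) * h +
      ((e : ℝ) + 2 + 2 * k) * ih

/-- normalization constant -/
noncomputable def gPi (e k : ℕ) : ℝ := ∏ i ∈ Finset.range k, ((e : ℝ) + 2 + 2 * i)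

lemma gPi_pos (e k : ℕ) : 0 < gPi e k := Finset.prod_pos fun i _ => by positivity

/-- the Legendre functional in the angle variable -/
noncomputable def lam (e k : ℕ) (F : ℝ → ℝ) : ℝ :=
  (-1) ^ k / gPi e k * ∫ θ in (0:ℝ)..π, F θ * sin θ ^ (e + 1) * gq k e θ

lemma lam_sin_half (e k : ℕ) : lam e k (fun θ => sin (θ / 2)) =
    2 ^ (e + 1) * gA e 0 e * ∏ i ∈ Finset.range k, ((2 * (i : ℝ) - 1) / (2 * i + 2 * e + 5)) := by
  have h1 : ∫ θ in (0:ℝ)..π, sin (θ / 2) * sin θ ^ (e + 1) * gq k e θ = 2 ^ (e + 1) * gA e k e := by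
    rw [gA, ← intervalIntegral.integral_const_mul]
    congr 1
    ext θ
    rw [sin_half θ]; ring
  rw [lam, h1, gA_full]
  have h2 := gA_zero_full e k
  have h3 : (∏ i ∈ Finset.range k, ((2 * (e : ℝ)) + 5 + 2 * i)) ≠ 0 :=
    Finset.prod_ne_zero_iff.mpr fun i _ => by positivity
  have h4 : gA e 0 (e + 2 * k) = gPi e k * gA e 0 e /
      (∏ i ∈ Finset.range k, ((2 * (e : ℝ)) + 5 + 2 * i)) := by
    rw [eq_div_iff h3, gPi]; linarith
  rw [h4, Finset.prod_div_distrib]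
  have h5 : (∏ i ∈ Finset.range k, (2 * (i : ℝ) + 2 * e + 5)) =
    (∏ i ∈ Finset.range k, ((2 * (e : ℝ)) + 5 + 2 * i)) := by
    apply Finset.prod_congr rfl; intros; ring
  have h6 : (∏ i ∈ Finset.range k, (2 * (i : ℝ) - 1)) = (-1) ^ k *
    (∏ i ∈ Finset.range k, ((e : ℝ) + 1 - e - 2 * i)) := by
    have h7 : ((-1 : ℝ)) ^ k = ∏ i ∈ Finset.range k, (-1 : ℝ) := by simp
    rw [h7, ← Finset.prod_mul_distrib]
    apply Finset.prod_congr rfl; intros; ring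
  rw [h5, h6]
  have := (gPi_pos e k).ne'
  field_simp

lemma prod_tele (d k : ℕ) : (∏ i ∈ Finset.range k, ((2 * (i : ℝ) - 1) / (2 * i + 2 * d - 1 + 0))) *
    (∏ i ∈ Finset.range d, (2 * ((k : ℝ) + i) - 1)) = ∏ i ∈ Finset.range d, (2 * (i : ℝ) - 1) := by
  induction k with
  | zero => simp
  | succ k ih =>
    rw [← ih, Finset.prod_range_succ, mul_assoc]
    congr 1
    have h1 := Finset.prod_range_succ (fun i : ℕ => (2 * ((k : ℝ) + i) - 1)) d
    rw [Finset.prod_range_succ'] at h1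
    have h2 : ∏ i ∈ Finset.range d, (2 * (((k + 1 : ℕ) : ℝ) + i) - 1) =
      ∏ i ∈ Finset.range d, (2 * ((k : ℝ) + (i + 1 : ℕ)) - 1) := by
      apply Finset.prod_congr rfl; intros; push_cast; ring
    rw [h2]
    by_cases hd : d = 0
    · subst hd
      have : (2 * (k:ℝ) - 1) ≠ 0 := by
        intro h
        have : (2 * k : ℝ) = (1 : ℕ) := by push_cast; linarith
        norm_cast at this; omega
      simp
      exact this
    have hpos : (2 * (k : ℝ) + 2 * d - 1) ≠ 0 := by
      have : (1 : ℝ) ≤ d := by exact_mod_cast Nat.one_le_iff_ne_zero.mpr hd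
      have : (0:ℝ) ≤ k := by positivity
      nlinarith
    rw [add_zero, div_mul_eq_mul_div, div_eq_iff hpos]
    push_cast at h1 ⊢
    linear_combination h1

/-- limit constant for the comparator -/
noncomputable def ell (e : ℕ) : ℝ :=
  2 ^ (e + 1) * gA e 0 e * ((∏ i ∈ Finset.range (e + 3), (2 * (i : ℝ) - 1)) / 2 ^ (e + 3))

lemma ell_ne (e : ℕ) : ell e ≠ 0 := by
  have h := (gA_pos e e).ne'
  have h2 : (∏ i ∈ Finset.range (e + 3), (2 * (i : ℝ) - 1)) ≠ 0 := by
    apply Finset.prod_ne_zero_iff.mpr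
    intro i _ h
    have : (2 * i : ℝ) = (1 : ℕ) := by push_cast; linarith
    norm_cast at this; omega
  unfold ell
  positivity

lemma lam_sin_half_tendsto (e : ℕ) :
    Tendsto (fun k : ℕ => (k : ℝ) ^ (e + 3) * lam e k (fun θ => sin (θ / 2))) atTop (𝓝 (ell e)) := by
  have h1 : Tendsto (fun k : ℕ => ∏ i ∈ Finset.range (e + 3), (2 * ((k : ℝ) + i) - 1) / k) atTop
      (𝓝 (∏ i ∈ Finset.range (e + 3), (2:ℝ))) := by
    apply tendsto_finsetProd
    intro i _
    have h0 : Tendsto (fun k : ℕ => 2 + (2 * (i:ℝ) - 1) * ((k : ℝ))⁻¹) atTop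
        (𝓝 (2 + (2 * (i:ℝ) - 1) * 0)) :=
      (tendsto_inv_atTop_nhds_zero_nat.const_mul _).const_add _
    rw [mul_zero, add_zero] at h0
    refine h0.congr' ?_
    filter_upwards [eventually_gt_atTop 0] with k hk
    have : (k : ℝ) ≠ 0 := by positivity
    field_simp
    ring
  rw [Finset.prod_const, Finset.card_range] at h1
  have h2 := (tendsto_const_nhds (x := 2 ^ (e + 1) * gA e 0 e *
    (∏ i ∈ Finset.range (e + 3), (2 * (i : ℝ) - 1)))).div h1 (by positivity)
  rw [mul_div_assoc] at h2
  refine h2.congr' ?_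
  filter_upwards [eventually_gt_atTop 0] with k hk
  rw [lam_sin_half]
  have h3 := prod_tele (e + 3) k
  have h4 : ∀ i : ℕ, (2 * (i : ℝ) + 2 * ((e + 3 : ℕ) : ℝ) - 1 + 0) = 2 * i + 2 * e + 5 := by
    intro i; push_cast; ring
  simp only [h4] at h3
  have hk0 : (k : ℝ) ≠ 0 := by positivity
  have h5 : (∏ i ∈ Finset.range (e + 3), (2 * ((k : ℝ) + i) - 1)) ≠ 0 := by
    apply ne_of_gt
    apply Finset.prod_pos
    intro i _
    have : (1 : ℝ) ≤ k := by exact_mod_cast hk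
    have : (0 : ℝ) ≤ i := by positivity
    nlinarith
  simp only [Pi.div_apply]
  have h6 : ∏ i ∈ Finset.range (e + 3), (2 * ((k : ℝ) + i) - 1) / k =
      (∏ i ∈ Finset.range (e + 3), (2 * ((k : ℝ) + i) - 1)) / k ^ (e + 3) := by
    rw [Finset.prod_div_distrib, Finset.prod_const, Finset.card_range]
  rw [← h3, h6]
  field_simp

lemma lam_reflect (e k : ℕ) (F : ℝ → ℝ) :
    lam e k (fun θ => F (π - θ)) = (-1) ^ k * lam e k F := by
  unfold lam
  have h := intervalIntegral.integral_comp_sub_left (a := 0) (b := π)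
    (fun θ => F θ * sin θ ^ (e + 1) * gq k e θ) π
  simp only [sub_self, sub_zero, gq_pi_sub, sin_pi_sub] at h
  rw [← h, ← intervalIntegral.integral_const_mul, ← intervalIntegral.integral_const_mul,
    ← intervalIntegral.integral_const_mul]
  congr 1
  ext θ
  have : ((-1 : ℝ) ^ k) * (-1) ^ k = 1 := by rw [← mul_pow]; simp
  linear_combination (-(-1) ^ k / gPi e k * F (π - θ) * sin θ ^ (e + 1) * gq k e θ) * this

lemma lam_cos_half (e k : ℕ) : lam e k (fun θ => cos (θ / 2)) =
    (-1) ^ k * lam e k (fun θ => sin (θ / 2)) := by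
  rw [← lam_reflect]
  congr 1
  ext θ
  rw [sub_div, sin_pi_div_two_sub]

/- norms -/
lemma gM_full (n : ℕ) : ∀ m : ℕ, gM n m * (n + m).factorial =
    n.factorial * (2 * n + m).factorial * gM 0 (m + 2 * n) := by
  induction n with
  | zero => intro m; simp; ring
  | succ n ih =>
    intro m
    have h := ih (m + 2)
    rw [gM_succ]
    rw [show n + (m + 2) = (n + 1 + m) + 1 by ring, Nat.factorial_succ (n + 1 + m)] at h
    rw [show 2 * n + (m + 2) = 2 * (n + 1) + m by ring,
      show m + 2 + 2 * n = m + 2 * (n + 1) by ring] at h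
    rw [Nat.factorial_succ n]
    push_cast at h ⊢
    linear_combination ((n : ℝ) + 1) * h

lemma gM_zero_full (e k : ℕ) : gM 0 (e + 2 * k) * (e + 2 * k + 1).factorial =
    gPi e k ^ 2 * (gM 0 e * (e + 1).factorial) := by
  induction k with
  | zero => simp [gPi]
  | succ k ih =>
    have h := gM_zero_rec (e + 2 * k)
    rw [show e + 2 * (k + 1) = e + 2 * k + 2 by ring, Nat.factorial_succ (e + 2 * k + 2),
      Nat.factorial_succ (e + 2 * k + 1)]
    have h3 : gPi e (k + 1) = gPi e k * ((e : ℝ) + 2 + 2 * k) := by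
      simp [gPi, Finset.prod_range_succ]
    rw [h3]
    push_cast at h ih ⊢
    linear_combination ((e + 2 * k + 1).factorial : ℝ) * (e + 2 * k + 2) * h +
      ((e : ℝ) + 2 * k + 2) ^ 2 * ih

lemma gM_E (e k : ℕ) : gM k e * (k + e).factorial * (2 * k + e + 1) =
    k.factorial * gPi e k ^ 2 * (gM 0 e * (e + 1).factorial) := by
  have h1 := gM_full k e
  have h2 := gM_zero_full e k
  rw [Nat.factorial_succ, show e + 2 * k = 2 * k + e by ring] at h2
  rw [show e + 2 * k = 2 * k + e by ring] at h1
  push_cast at h2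
  rw [h1]
  linear_combination (k.factorial : ℝ) * h2

lemma gM_lower (n j : ℕ) : ∀ m : ℕ, (n : ℝ) ^ (2 * j) * gM n (m + 2 * j) ≤ gM (n + j) m := by
  induction j with
  | zero => intro m; simp
  | succ j ih =>
    intro m
    have h := ih (m + 2)
    rw [← add_assoc, gM_succ, show m + 2 * (j + 1) = m + 2 + 2 * j by ring,
      show 2 * (j + 1) = 2 * j + 2 by ring, pow_add]
    have h2 : (n : ℝ) ^ 2 ≤ (((n + j : ℕ) : ℝ) + 1) * ((n + j : ℕ) + m + 2) := by
      push_cast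
      have : (0:ℝ) ≤ n := by positivity
      have : (0:ℝ) ≤ j := by positivity
      have : (0:ℝ) ≤ m := by positivity
      nlinarith [mul_nonneg ‹(0:ℝ) ≤ n› ‹(0:ℝ) ≤ j›, mul_nonneg ‹(0:ℝ) ≤ n› ‹(0:ℝ) ≤ m›,
        mul_nonneg ‹(0:ℝ) ≤ j› ‹(0:ℝ) ≤ m›, sq_nonneg (j:ℝ)]
    have h3 : 0 ≤ (n : ℝ) ^ (2 * j) * gM n (m + 2 + 2 * j) :=
      mul_nonneg (by positivity) (gM_nonneg _ _)
    calc (n : ℝ) ^ (2 * j) * n ^ 2 * gM n (m + 2 + 2 * j)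
        = n ^ 2 * ((n : ℝ) ^ (2 * j) * gM n (m + 2 + 2 * j)) := by ring
      _ ≤ _ := mul_le_mul h2 h h3 (by positivity)

lemma gM_bound (e n j : ℕ) : gM n (e + 2 * j) * (n : ℝ) ^ (2 * j + e + 1) ≤
    (gM 0 e * (e + 1).factorial) * gPi e (n + j) ^ 2 := by
  set k := n + j with hk
  have h1 := gM_lower n j e
  have h2 := gM_E e k
  have h3 : (k.factorial : ℝ) * (n : ℝ) ^ (e + 1) ≤ (k + e).factorial * (2 * k + e + 1) := by
    have a1 : k.factorial * k ^ e ≤ (k + e).factorial := Nat.factorial_mul_pow_le_factorial.trans' (by gcongr; omega)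
    have a2 : k.factorial * n ^ (e + 1) ≤ (k + e).factorial * (2 * k + e + 1) := by
      calc k.factorial * n ^ (e + 1) ≤ k.factorial * k ^ (e + 1) := by
            gcongr; omega
        _ = k.factorial * k ^ e * k := by ring
        _ ≤ _ := Nat.mul_le_mul a1 (by omega)
    exact_mod_cast a2
  have hf : (0 : ℝ) < k.factorial := by positivity
  have h4 : gM k e * (n : ℝ) ^ (e + 1) ≤ (gM 0 e * (e + 1).factorial) * gPi e k ^ 2 := by
    have := mul_le_mul_of_nonneg_left h3 (gM_nonneg k e)
    refine le_of_mul_le_mul_left ?_ hf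
    nlinarith
  calc gM n (e + 2 * j) * (n : ℝ) ^ (2 * j + e + 1)
      = ((n : ℝ) ^ (2 * j) * gM n (e + 2 * j)) * (n : ℝ) ^ (e + 1) := by ring
    _ ≤ gM k e * (n : ℝ) ^ (e + 1) := by gcongr
    _ ≤ _ := h4


/-- numerators of the derivatives with respect to `t = cos θ`. -/
noncomputable def Nseq (F : ℝ → ℝ) : ℕ → ℝ → ℝ
  | 0 => deriv F
  | i + 1 => fun θ => deriv (Nseq F i) θ * sin θ - (2 * (i : ℝ) + 1) * Nseq F i θ * cos θ

lemma analytic_sin_on (s : Set ℝ) : AnalyticOnNhd ℝ (fun θ => sin θ) s := fun _ _ => analyticAt_sin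
lemma analytic_cos_on (s : Set ℝ) : AnalyticOnNhd ℝ (fun θ => cos θ) s := fun _ _ => analyticAt_cos

lemma Nseq_analytic {F : ℝ → ℝ} {s : Set ℝ} (hF : AnalyticOnNhd ℝ F s) (i : ℕ) :
    AnalyticOnNhd ℝ (Nseq F i) s := by
  induction i with
  | zero => exact hF.deriv
  | succ i ih =>
    exact (ih.deriv.mul (analytic_sin_on s)).sub
      ((analyticOnNhd_const.mul ih).mul (analytic_cos_on s))

lemma ibp_all {F : ℝ → ℝ} (hF : AnalyticOnNhd ℝ F (Icc 0 π)) (e n j : ℕ) :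
    ∫ θ in (0:ℝ)..π, F θ * sin θ ^ (e + 1) * gq (n + j + 1) e θ =
    ∫ θ in (0:ℝ)..π, Nseq F j θ * sin θ ^ (e + 2) * gq n (e + 2 * (j + 1)) θ := by
  induction j generalizing n with
  | zero =>
    have h := ibp_step (N := F) (N' := deriv F) (e + 1) n e
      (fun θ hθ => (hF θ hθ).differentiableAt.hasDerivAt) hF.deriv.continuousOn
    rw [add_zero, h]
    congr 1
    ext θ
    simp only [Nseq]
    push_cast
    ring
  | succ j ih =>
    have hN := Nseq_analytic hF j
    rw [show n + (j + 1) + 1 = (n + 1) + j + 1 by ring, ih (n + 1)]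
    have h := ibp_step (N := Nseq F j) (N' := deriv (Nseq F j)) (e + 2) n (e + 2 * (j + 1))
      (fun θ hθ => (hN θ hθ).differentiableAt.hasDerivAt) hN.deriv.continuousOn
    rw [h]
    congr 1
    ext θ
    simp only [Nseq]
    push_cast
    ring_nf

lemma Nseq_order {F : ℝ → ℝ} {x : ℝ} (hF : AnalyticAt ℝ F x) (hs : sin x = 0)
    (h1 : deriv F x = 0) (j : ℕ) : Nseq F (j + 1) x = 0 ∧ deriv (Nseq F (j + 1)) x = 0 := by
  have hA : ∀ i, AnalyticAt ℝ (Nseq F i) x := fun i =>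
    Nseq_analytic (s := {x}) (by intro y hy; rw [mem_singleton_iff.mp hy]; exact hF) i x rfl
  have hD : ∀ i, deriv (Nseq F (i + 1)) x =
      deriv (deriv (Nseq F i)) x * sin x + deriv (Nseq F i) x * cos x
      - ((2 * (i : ℝ) + 1) * deriv (Nseq F i) x * cos x
        + (2 * (i : ℝ) + 1) * Nseq F i x * (-sin x)) := by
    intro i
    have a := ((hA i).deriv.differentiableAt.hasDerivAt.mul (hasDerivAt_sin x)).sub
      ((((hA i).differentiableAt.hasDerivAt).const_mul (2 * (i : ℝ) + 1)).mul (hasDerivAt_cos x))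
    exact a.deriv
  induction j with
  | zero =>
    constructor
    · simp [Nseq, hs, h1]
    · rw [hD 0]
      simp [Nseq, hs]
  | succ j ih =>
    constructor
    · rw [Nseq]; simp [hs, ih.1]
    · rw [hD (j + 1), ih.1, ih.2, hs]; simp

lemma quad_bound {N : ℝ → ℝ} (hN : AnalyticOnNhd ℝ N (Icc 0 π)) (h0 : N 0 = 0)
    (h1 : deriv N 0 = 0) : ∃ C, 0 ≤ C ∧ ∀ θ ∈ Icc (0:ℝ) π, |N θ| ≤ C * θ ^ 2 := by
  obtain ⟨C, hC⟩ := isCompact_Icc.exists_bound_of_continuousOn hN.deriv.deriv.continuousOn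
  have hC0 : 0 ≤ C := (norm_nonneg _).trans (hC 0 ⟨le_rfl, pi_pos.le⟩)
  have hb : ∀ θ ∈ Icc (0:ℝ) π, |deriv N θ| ≤ C * θ := by
    intro θ hθ
    have := norm_image_sub_le_of_norm_deriv_le_segment' (f := deriv N) (f' := deriv (deriv N))
      (a := 0) (b := π) (C := C)
      (fun x hx => (hN x hx).deriv.differentiableAt.hasDerivAt.hasDerivWithinAt)
      (fun x hx => hC x ⟨hx.1, hx.2.le⟩) θ hθ
    simpa [h1] using this
  refine ⟨C, hC0, ?_⟩
  intro θ hθ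
  have := norm_image_sub_le_of_norm_deriv_le_segment' (f := N) (f' := deriv N)
    (a := 0) (b := θ) (C := C * θ)
    (fun x hx => (hN x ⟨hx.1, hx.2.trans hθ.2⟩).differentiableAt.hasDerivAt.hasDerivWithinAt)
    (fun x hx => (hb x ⟨hx.1, hx.2.le.trans hθ.2⟩).trans (by
      have := hx.2.le; gcongr)) θ ⟨hθ.1, le_rfl⟩
  simpa [h0, sq, mul_assoc] using this

lemma sin_sq_bound {N : ℝ → ℝ} (hN : AnalyticOnNhd ℝ N (Icc 0 π)) (h0 : N 0 = 0)
    (h1 : deriv N 0 = 0) (h2 : N π = 0) (h3 : deriv N π = 0) :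
    ∃ C, 0 ≤ C ∧ ∀ θ ∈ Icc (0:ℝ) π, |N θ| ≤ C * sin θ ^ 2 := by
  obtain ⟨C1, hC1, hb1⟩ := quad_bound hN h0 h1
  have hN2 : AnalyticOnNhd ℝ (fun θ => N (π - θ)) (Icc 0 π) := by
    intro θ hθ
    have : AnalyticAt ℝ (fun θ : ℝ => π - θ) θ := analyticAt_const.sub analyticAt_id
    exact (hN (π - θ) ⟨by linarith [hθ.2], by linarith [hθ.1]⟩).fun_comp this
  obtain ⟨C2, hC2, hb2⟩ := quad_bound hN2 (by simpa using h2) (by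
    rw [deriv_comp_const_sub]; simp [h3])
  have key : ∀ x : ℝ, 0 ≤ x → x ≤ π / 2 → x ^ 2 ≤ (π / 2) ^ 2 * sin x ^ 2 := by
    intro x hx hx2
    have := mul_le_sin hx hx2
    rw [← mul_pow]
    have h : x ≤ π / 2 * sin x := by
      calc x = π / 2 * (2 / π * x) := by field_simp
        _ ≤ _ := by gcongr
    gcongr
  refine ⟨(C1 + C2) * (π / 2) ^ 2, by positivity, ?_⟩
  intro θ hθ
  rcases le_total θ (π / 2) with h | h
  · calc |N θ| ≤ C1 * θ ^ 2 := hb1 θ hθ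
      _ ≤ (C1 + C2) * ((π / 2) ^ 2 * sin θ ^ 2) := by
        have := key θ hθ.1 h
        gcongr; linarith
      _ = _ := by ring
  · have hb := hb2 (π - θ) ⟨by linarith [hθ.2], by linarith [hθ.1]⟩
    simp only [sub_sub_cancel] at hb
    have := key (π - θ) (by linarith [hθ.2]) (by linarith)
    rw [sin_pi_sub] at this
    calc |N θ| ≤ C2 * (π - θ) ^ 2 := hb
      _ ≤ (C1 + C2) * ((π / 2) ^ 2 * sin θ ^ 2) := by
        gcongr; linarith
      _ = _ := by ring

lemma sq_integral_le {f : ℝ → ℝ} (hf : ContinuousOn f (Icc 0 π)) :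
    (∫ θ in (0:ℝ)..π, f θ) ^ 2 ≤ π * ∫ θ in (0:ℝ)..π, f θ ^ 2 := by
  set I := ∫ θ in (0:ℝ)..π, f θ with hI
  have h : 0 ≤ ∫ θ in (0:ℝ)..π, (f θ - I / π) ^ 2 :=
    intervalIntegral.integral_nonneg pi_pos.le (fun θ _ => sq_nonneg _)
  have e1 : ∫ θ in (0:ℝ)..π, (f θ - I / π) ^ 2 =
      (∫ θ in (0:ℝ)..π, f θ ^ 2) - I ^ 2 / π := by
    have : (fun θ => (f θ - I / π) ^ 2) = fun θ => f θ ^ 2 - (2 * I / π * f θ - (I / π) ^ 2) := by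
      ext θ; ring
    have hf2 : ContinuousOn (fun θ => f θ ^ 2) (Icc 0 π) := hf.pow 2
    rw [this, intervalIntegral.integral_sub (ii hf2),
      intervalIntegral.integral_sub, intervalIntegral.integral_const_mul,
      intervalIntegral.integral_const, ← hI]
    · have := pi_pos.ne'
      simp
      field_simp
      ring
    · exact (ii hf).const_mul _
    · exact intervalIntegrable_const
    · exact ((ii hf).const_mul _).sub intervalIntegrable_const
  rw [e1] at h
  have hp := pi_pos
  have h2 : I ^ 2 / π ≤ ∫ θ in (0:ℝ)..π, f θ ^ 2 := by linarith
  rw [div_le_iff₀ hp] at h2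
  linarith

lemma lam_rem_bound {F : ℝ → ℝ} (hF : AnalyticOnNhd ℝ F (Icc 0 π))
    (h0 : deriv F 0 = 0) (h1 : deriv F π = 0) (e : ℕ) :
    ∃ C : ℝ, ∃ J : ℕ, ∀ n : ℕ, 1 ≤ n →
      (lam e (n + J) F) ^ 2 * (n : ℝ) ^ (2 * e + 7) ≤ C := by
  set j := (e + 3) / 2 with hj
  have hN := Nseq_analytic hF (j + 1)
  have a0 := Nseq_order (hF 0 ⟨le_rfl, pi_pos.le⟩) sin_zero h0 j
  have a1 := Nseq_order (hF π ⟨pi_pos.le, le_rfl⟩) sin_pi h1 j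
  obtain ⟨C, hC, hb⟩ := sin_sq_bound hN a0.1 a0.2 a1.1 a1.2
  refine ⟨C ^ 2 * π * (gM 0 e * (e + 1).factorial), j + 2, ?_⟩
  intro n hn
  have hI := ibp_all hF e n (j + 1)
  have hc := hN.continuousOn
  have hg := (gq_cont n (e + 2 * (j + 1 + 1)))
  have hcont : ContinuousOn (fun θ => Nseq F (j + 1) θ * sin θ ^ (e + 2)
    * gq n (e + 2 * (j + 1 + 1)) θ) (Icc 0 π) := by
    have := hg.continuousOn (s := Icc 0 π)
    fun_prop
  have b1 := sq_integral_le hcont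
  have b2 : ∫ θ in (0:ℝ)..π, (Nseq F (j + 1) θ * sin θ ^ (e + 2)
    * gq n (e + 2 * (j + 1 + 1)) θ) ^ 2 ≤ C ^ 2 * gM n (e + 2 * (j + 1 + 1)) := by
    rw [gM, ← intervalIntegral.integral_const_mul]
    apply intervalIntegral.integral_mono_on pi_pos.le (ii (hcont.pow 2))
    · exact Continuous.intervalIntegrable (by fun_prop) _ _
    intro θ hθ
    have hs := sin_nonneg_of_mem_Icc hθ
    have hs1 := sin_le_one θ
    have c1 : Nseq F (j + 1) θ ^ 2 ≤ (C * sin θ ^ 2) ^ 2 := by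
      rw [← sq_abs]; have := hb θ hθ; gcongr
    have c2 : sin θ ^ (2 * e + 8) ≤ sin θ ^ (e + 2 * (j + 1 + 1) + 1) :=
      pow_le_pow_of_le_one hs hs1 (by omega)
    calc (Nseq F (j + 1) θ * sin θ ^ (e + 2) * gq n (e + 2 * (j + 1 + 1)) θ) ^ 2
        = Nseq F (j + 1) θ ^ 2 * (sin θ ^ (2 * e + 4) * gq n (e + 2 * (j + 1 + 1)) θ ^ 2) := by ring
      _ ≤ (C * sin θ ^ 2) ^ 2 * (sin θ ^ (2 * e + 4) * gq n (e + 2 * (j + 1 + 1)) θ ^ 2) := by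
        gcongr
      _ = C ^ 2 * (gq n (e + 2 * (j + 1 + 1)) θ ^ 2 * sin θ ^ (2 * e + 8)) := by ring
      _ ≤ _ := by gcongr
  have b3 := gM_bound e n (j + 2)
  have hP := gPi_pos e (n + (j + 2))
  have hn1 : (1 : ℝ) ≤ n := by exact_mod_cast hn
  have b4 : (n : ℝ) ^ (2 * e + 7) ≤ (n : ℝ) ^ (2 * (j + 2) + e + 1) :=
    pow_le_pow_right₀ hn1 (by omega)
  have e1 : (lam e (n + (j + 2)) F) ^ 2 = (∫ θ in (0:ℝ)..π, Nseq F (j + 1) θ * sin θ ^ (e + 2)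
    * gq n (e + 2 * (j + 1 + 1)) θ) ^ 2 / gPi e (n + (j + 2)) ^ 2 := by
    rw [lam, show n + (j + 2) = n + (j + 1) + 1 by ring, hI, mul_pow, div_pow, ← pow_mul,
      mul_comm (n + (j + 1) + 1) 2, pow_mul]
    simp
    ring
  rw [e1, div_mul_eq_mul_div, div_le_iff₀ (by positivity)]
  have g0 := gM_nonneg n (e + 2 * (j + 2))
  calc _ ≤ (π * (C ^ 2 * gM n (e + 2 * (j + 2)))) * (n : ℝ) ^ (2 * (j + 2) + e + 1) := by
        apply mul_le_mul (b1.trans _) b4 (by positivity) (by positivity)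
        exact mul_le_mul_of_nonneg_left b2 pi_pos.le
    _ = C ^ 2 * π * (gM n (e + 2 * (j + 2)) * (n : ℝ) ^ (2 * (j + 2) + e + 1)) := by ring
    _ ≤ C ^ 2 * π * ((gM 0 e * (e + 1).factorial) * gPi e (n + (j + 2)) ^ 2) := by
      gcongr
    _ = _ := by ring

lemma lam_rem_tendsto {F : ℝ → ℝ} (hF : AnalyticOnNhd ℝ F (Icc 0 π))
    (h0 : deriv F 0 = 0) (h1 : deriv F π = 0) (e : ℕ) :
    Tendsto (fun k : ℕ => (k : ℝ) ^ (e + 3) * lam e k F) atTop (𝓝 0) := by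
  obtain ⟨C, J, hC⟩ := lam_rem_bound hF h0 h1 e
  rw [← tendsto_add_atTop_iff_nat J]
  have hC0 : 0 ≤ C := le_trans (by positivity) (hC 1 le_rfl)
  have hsq : Tendsto (fun n : ℕ => ((((n + J : ℕ) : ℝ)) ^ (e + 3) * lam e (n + J) F) ^ 2) atTop
      (𝓝 0) := by
    have hlim : Tendsto (fun n : ℕ => C * (1 + J : ℝ) ^ (2 * e + 6) * (n : ℝ)⁻¹) atTop (𝓝 0) := by
      simpa using (tendsto_inv_atTop_nhds_zero_nat (𝕜 := ℝ)).const_mul (C * (1 + J : ℝ) ^ (2 * e + 6))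
    refine tendsto_of_tendsto_of_tendsto_of_le_of_le' tendsto_const_nhds hlim
      (Eventually.of_forall fun n => sq_nonneg _) ?_
    filter_upwards [eventually_ge_atTop 1] with n hn
    have hn1 : (1 : ℝ) ≤ n := by exact_mod_cast hn
    have hb := hC n hn
    have a : ((n + J : ℕ) : ℝ) ≤ (1 + J) * n := by
      push_cast
      have : (0:ℝ) ≤ J := by positivity
      nlinarith
    rw [← div_eq_mul_inv, le_div_iff₀ (by linarith)]
    calc ((((n + J : ℕ) : ℝ)) ^ (e + 3) * lam e (n + J) F) ^ 2 * n
        = ((n + J : ℕ) : ℝ) ^ (2 * e + 6) * (lam e (n + J) F ^ 2 * n) := by ring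
      _ ≤ ((1 + J) * n : ℝ) ^ (2 * e + 6) * (lam e (n + J) F ^ 2 * n) := by gcongr
      _ = (1 + J : ℝ) ^ (2 * e + 6) * (lam e (n + J) F ^ 2 * n ^ (2 * e + 7)) := by
        rw [mul_pow]; ring
      _ ≤ (1 + J : ℝ) ^ (2 * e + 6) * C := by gcongr
      _ = _ := by ring
  have := (hsq.sqrt)
  simp only [sqrt_sq_eq_abs, sqrt_zero] at this
  exact (tendsto_zero_iff_abs_tendsto_zero _).mpr this

lemma lam_decomp {F : ℝ → ℝ} (hF : AnalyticOnNhd ℝ F (Icc 0 π)) (e : ℕ) :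
    ∃ R : ℕ → ℝ, Tendsto R atTop (𝓝 0) ∧ ∀ k : ℕ, (k : ℝ) ^ (e + 3) * lam e k F =
      (2 * (deriv F 0 - (-1) ^ k * deriv F π)) *
        ((k : ℝ) ^ (e + 3) * lam e k (fun θ => sin (θ / 2))) + R k := by
  set a := deriv F 0
  set b := deriv F π
  set G : ℝ → ℝ := fun θ => F θ - 2 * a * sin (θ / 2) + 2 * b * cos (θ / 2) with hG
  have hsA : ∀ θ, AnalyticAt ℝ (fun θ : ℝ => sin (θ / 2)) θ := fun θ => by
    have h2 : AnalyticAt ℝ (fun θ : ℝ => θ / 2) θ := by fun_prop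
    exact AnalyticAt.comp (g := sin) (f := fun θ : ℝ => θ / 2) analyticAt_sin h2
  have hcA : ∀ θ, AnalyticAt ℝ (fun θ : ℝ => cos (θ / 2)) θ := fun θ => by
    have h2 : AnalyticAt ℝ (fun θ : ℝ => θ / 2) θ := by fun_prop
    exact AnalyticAt.comp (g := cos) (f := fun θ : ℝ => θ / 2) analyticAt_cos h2
  have hGA : AnalyticOnNhd ℝ G (Icc 0 π) := fun θ hθ =>
    ((hF θ hθ).sub (analyticAt_const.mul (hsA θ))).add (analyticAt_const.mul (hcA θ))
  have hGd : ∀ θ ∈ Icc 0 π, deriv G θ = deriv F θ - 2 * a * (cos (θ / 2) / 2)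
      + 2 * b * (-sin (θ / 2) / 2) := fun θ hθ =>
    (((hF θ hθ).differentiableAt.hasDerivAt.sub ((sin_half_deriv θ).const_mul (2 * a))).add
      ((cos_half_deriv θ).const_mul (2 * b))).deriv
  have d0 : deriv G 0 = 0 := by
    rw [hGd 0 ⟨le_rfl, pi_pos.le⟩]; simp [a]; ring
  have d1 : deriv G π = 0 := by
    rw [hGd π ⟨pi_pos.le, le_rfl⟩]; simp [b]; ring
  refine ⟨fun k => (k : ℝ) ^ (e + 3) * lam e k G, lam_rem_tendsto hGA d0 d1 e, ?_⟩
  intro k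
  have hlin : lam e k F = lam e k G + 2 * a * lam e k (fun θ => sin (θ / 2))
      - 2 * b * lam e k (fun θ => cos (θ / 2)) := by
    unfold lam
    have hg := (gq_cont k e).continuousOn (s := Icc 0 π)
    have hGc := hGA.continuousOn
    have i1 : ContinuousOn (fun θ => G θ * sin θ ^ (e + 1) * gq k e θ) (Icc 0 π) := by fun_prop
    have i2 : ContinuousOn (fun θ => sin (θ / 2) * sin θ ^ (e + 1) * gq k e θ) (Icc 0 π) := by
      fun_prop
    have i3 : ContinuousOn (fun θ => cos (θ / 2) * sin θ ^ (e + 1) * gq k e θ) (Icc 0 π) := by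
      fun_prop
    have : (fun θ => F θ * sin θ ^ (e + 1) * gq k e θ) = fun θ =>
        (G θ * sin θ ^ (e + 1) * gq k e θ + 2 * a * (sin (θ / 2) * sin θ ^ (e + 1) * gq k e θ))
        - 2 * b * (cos (θ / 2) * sin θ ^ (e + 1) * gq k e θ) := by
      ext θ; simp only [hG]; ring
    rw [this, intervalIntegral.integral_sub (((ii i1).add ((ii i2).const_mul _)))
      ((ii i3).const_mul _), intervalIntegral.integral_add (ii i1) ((ii i2).const_mul _),
      intervalIntegral.integral_const_mul, intervalIntegral.integral_const_mul]
    ring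
  rw [hlin, lam_cos_half]
  ring


lemma iteratedDeriv_gp (i : ℕ) : ∀ m : ℕ, ∀ t ∈ Ioo (-1:ℝ) 1,
    iteratedDeriv i (fun s : ℝ => (1 - s ^ 2) ^ ((i : ℝ) + (m : ℝ) / 2)) t =
      (1 - t ^ 2) ^ ((m : ℝ) / 2) * (gp i m).eval t := by
  induction i with
  | zero => intro m t _; simp [gp]
  | succ i ih =>
    intro m t ht
    rw [iteratedDeriv_succ]
    have he : ((i + 1 : ℕ) : ℝ) + (m : ℝ) / 2 = (i : ℝ) + ((m + 2 : ℕ) : ℝ) / 2 := by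
      push_cast; ring
    rw [he]
    have hev : iteratedDeriv i (fun s : ℝ => (1 - s ^ 2) ^ ((i : ℝ) + ((m + 2 : ℕ) : ℝ) / 2)) =ᶠ[𝓝 t]
        fun t => (1 - t ^ 2) ^ (((m + 2 : ℕ) : ℝ) / 2) * (gp i (m + 2)).eval t := by
      filter_upwards [Ioo_mem_nhds ht.1 ht.2] with x hx using ih (m + 2) x hx
    rw [hev.deriv_eq]
    have hpos : 0 < 1 - t ^ 2 := by nlinarith [ht.1, ht.2]
    have hd : HasDerivAt (fun t : ℝ => 1 - t ^ 2) (-(2 * t)) t := by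
      have := ((hasDerivAt_pow 2 t).const_sub 1)
      simpa using this
    have h1 := (hd.rpow_const (p := ((m + 2 : ℕ) : ℝ) / 2) (Or.inl hpos.ne')).mul
      ((gp i (m + 2)).hasDerivAt t)
    have h2 := h1.deriv
    simp only [Pi.mul_def] at h2
    rw [h2]
    have e1 : ((m + 2 : ℕ) : ℝ) / 2 - 1 = (m : ℝ) / 2 := by push_cast; ring
    have e2 : (1 - t ^ 2) ^ (((m + 2 : ℕ) : ℝ) / 2) = (1 - t ^ 2) ^ ((m : ℝ) / 2) * (1 - t ^ 2) := by
      rw [← e1, rpow_sub_one hpos.ne']; field_simp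
    rw [e1, e2]
    simp [gp]
    ring

lemma gamma_gPi (e k : ℕ) : Real.Gamma ((k : ℝ) + ((e : ℝ) + 2) / 2) * 2 ^ k =
    Real.Gamma (((e : ℝ) + 2) / 2) * gPi e k := by
  induction k with
  | zero => simp [gPi]
  | succ k ih =>
    have h : ((k + 1 : ℕ) : ℝ) + ((e : ℝ) + 2) / 2 = ((k : ℝ) + ((e : ℝ) + 2) / 2) + 1 := by
      push_cast; ring
    rw [h, Real.Gamma_add_one (by positivity), gPi, Finset.prod_range_succ, ← gPi, pow_succ]
    linear_combination ((e : ℝ) + 2 + 2 * k) * ih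

lemma legendreCoeff_eq (e k : ℕ) (κ : ℝ → ℝ) (hκ : Continuous κ) :
    legendreCoeff (e + 3) k κ =
      (sphereSurface (e + 2) / sphereSurface (e + 3)) * lam e k (fun θ => κ (cos θ)) := by
  unfold legendreCoeff lam
  simp only [show e + 3 - 1 = e + 2 from rfl]
  congr 1
  have hG : Real.Gamma ((k : ℝ) + ((e : ℝ) + 2) / 2) ≠ 0 := (Real.Gamma_pos_of_pos (by positivity)).ne'
  have hG2 : Real.Gamma (((e : ℝ) + 2) / 2) ≠ 0 := (Real.Gamma_pos_of_pos (by positivity)).ne'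
  have hP := (gPi_pos e k).ne'
  set g : ℝ → ℝ := fun t => (-1) ^ k / gPi e k * (κ t * (1 - t ^ 2) ^ ((e : ℝ) / 2) * (gp k e).eval t)
    with hg
  have hgc : Continuous g := by
    have h1 : Continuous (fun t : ℝ => (1 - t ^ 2) ^ ((e : ℝ) / 2)) :=
      (by fun_prop : Continuous (fun t : ℝ => 1 - t ^ 2)).rpow_const
        (fun x => Or.inr (by positivity))
    have h2 := (gp k e).continuous
    fun_prop
  have e1 : ∫ t in (-1 : ℝ)..1, κ t * legendreP (e + 3) k t *
      (1 - t ^ 2) ^ ((((e + 3 : ℕ) : ℝ) - 3) / 2) = ∫ t in (-1 : ℝ)..1, g t := by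
    rw [intervalIntegral.integral_of_le (by norm_num), intervalIntegral.integral_of_le (by norm_num),
      MeasureTheory.integral_Ioc_eq_integral_Ioo, MeasureTheory.integral_Ioc_eq_integral_Ioo]
    apply MeasureTheory.setIntegral_congr_fun measurableSet_Ioo
    intro t ht
    have hpos : 0 < 1 - t ^ 2 := by nlinarith [ht.1, ht.2]
    simp only [legendreP, hg]
    have a1 : (((e + 3 : ℕ) : ℝ) - 3) / 2 = (e : ℝ) / 2 := by push_cast; ring
    have a2 : (3 - ((e + 3 : ℕ) : ℝ)) / 2 = -((e : ℝ) / 2) := by push_cast; ring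
    have a3 : (((e + 3 : ℕ) : ℝ) - 1) / 2 = ((e : ℝ) + 2) / 2 := by push_cast; ring
    rw [a1, a2, a3, iteratedDeriv_gp k e t ht, rpow_neg hpos.le]
    have hr : (1 - t ^ 2) ^ ((e : ℝ) / 2) ≠ 0 := (rpow_pos_of_pos hpos _).ne'
    have h2 := gamma_gPi e k
    have h3 : (-1 / 2 : ℝ) ^ k * (Real.Gamma (((e : ℝ) + 2) / 2) /
        Real.Gamma ((k : ℝ) + ((e : ℝ) + 2) / 2)) = (-1) ^ k / gPi e k := by
      rw [div_pow, div_mul_div_comm, div_eq_div_iff (by positivity) hP]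
      linear_combination (-(-1) ^ k) * h2
    rw [h3]
    field_simp
  rw [e1]
  have h := intervalIntegral.integral_comp_mul_deriv (a := 0) (b := π) (f := cos)
    (f' := fun θ => -sin θ) (g := g) (fun x _ => hasDerivAt_cos x) (by fun_prop) hgc
  rw [cos_zero, cos_pi] at h
  rw [intervalIntegral.integral_symm, ← h, ← intervalIntegral.integral_neg, ← intervalIntegral.integral_const_mul]
  apply intervalIntegral.integral_congr
  intro θ hθ
  rw [uIcc_of_le pi_pos.le] at hθ
  have hs := sin_nonneg_of_mem_Icc hθ
  have hs2 : (1 - cos θ ^ 2) ^ ((e : ℝ) / 2) = sin θ ^ e := by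
    rw [← sin_sq, ← rpow_natCast (sin θ) 2, ← rpow_mul hs, ← rpow_natCast]
    congr 1
    push_cast; ring
  simp only [hg, Function.comp, hs2, gq]
  ring

lemma sphereSurface_pos (p : ℕ) (hp : 0 < p) : 0 < sphereSurface p := by
  unfold sphereSurface
  have : (0:ℝ) < p := by exact_mod_cast hp
  have h := Real.Gamma_pos_of_pos (s := (p : ℝ) / 2) (by positivity)
  have := pi_pos
  positivity

lemma decay_of_analytic (e : ℕ) (κ F : ℝ → ℝ) (hκ : Continuous κ)
    (hF : AnalyticOnNhd ℝ F (Icc 0 π)) (hFκ : ∀ θ ∈ Icc 0 π, κ (cos θ) = F θ)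
    (h1 : deriv F 0 - deriv F π ≠ 0) (h2 : deriv F 0 + deriv F π ≠ 0) :
    ∃ Ce Co : ℝ, Ce ≠ 0 ∧ Co ≠ 0 ∧
      Tendsto (fun k : ℕ =>
          legendreCoeff (e + 3) k κ / (Ce * (k : ℝ) ^ (-((e + 3 : ℕ) : ℝ))))
        (atTop ⊓ 𝓟 {k | Even k}) (𝓝 1) ∧
      Tendsto (fun k : ℕ =>
          legendreCoeff (e + 3) k κ / (Co * (k : ℝ) ^ (-((e + 3 : ℕ) : ℝ))))
        (atTop ⊓ 𝓟 {k | Odd k}) (𝓝 1) := by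
  set S := sphereSurface (e + 2) / sphereSurface (e + 3) with hS
  have hS0 : S ≠ 0 := (div_pos (sphereSurface_pos _ (by omega)) (sphereSurface_pos _ (by omega))).ne'
  have hlam : ∀ k, lam e k (fun θ => κ (cos θ)) = lam e k F := by
    intro k
    unfold lam
    congr 1
    apply intervalIntegral.integral_congr
    intro θ hθ
    rw [uIcc_of_le pi_pos.le] at hθ
    simp only [hFκ θ hθ]
  obtain ⟨R, hR, hdec⟩ := lam_decomp hF e
  have hell := lam_sin_half_tendsto e
  have gen : ∀ (l : Filter ℕ) (c : ℝ), l ≤ atTop → c ≠ 0 →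
      (∀ᶠ k in l, deriv F 0 - (-1) ^ k * deriv F π = c) →
      Tendsto (fun k : ℕ => legendreCoeff (e + 3) k κ /
        ((S * (2 * c * ell e)) * (k : ℝ) ^ (-((e + 3 : ℕ) : ℝ)))) l (𝓝 1) := by
    intro l c hl hc hk
    have t1 : Tendsto (fun k : ℕ => (S * ((2 * c) * ((k : ℝ) ^ (e + 3) *
        lam e k (fun θ => sin (θ / 2))) + R k)) / (S * (2 * c * ell e))) l (𝓝 1) := by
      have := (((((hell.mono_left hl).const_mul (2 * c)).add (hR.mono_left hl)).const_mul S)).div_const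
        (S * (2 * c * ell e))
      rwa [add_zero, div_self (by have := ell_ne e; positivity)] at this
    refine t1.congr' ?_
    filter_upwards [hk, hl (eventually_gt_atTop 0)] with k hk hk0
    rw [legendreCoeff_eq e k κ hκ, hlam]
    have h := hdec k
    rw [hk] at h
    rw [← h]
    have hk1 : (0 : ℝ) < k := by exact_mod_cast hk0
    rw [rpow_neg hk1.le, rpow_natCast]
    have := ell_ne e
    field_simp
    rw [hS]; ring
  refine ⟨S * (2 * (deriv F 0 - deriv F π) * ell e), S * (2 * (deriv F 0 + deriv F π) * ell e),
    ?_, ?_, gen _ _ inf_le_left h1 ?_, gen _ _ inf_le_left h2 ?_⟩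
  · have := ell_ne e; positivity
  · have := ell_ne e; positivity
  · filter_upwards [mem_inf_of_right (mem_principal_self _)] with k (hk : Even k)
    rw [hk.neg_one_pow]; ring
  · filter_upwards [mem_inf_of_right (mem_principal_self _)] with k (hk : Odd k)
    rw [hk.neg_one_pow]; ring


/-- `κ₁` in the angle variable. -/
noncomputable def Kth (θ : ℝ) : ℝ := (sin θ + (π - θ) * cos θ) / π

lemma kappa1_cos {θ : ℝ} (hθ : θ ∈ Icc 0 π) : kappa1 (cos θ) = Kth θ := by
  have hs := sin_nonneg_of_mem_Icc hθ
  rw [kappa1, Kth, arccos_cos hθ.1 hθ.2, ← sin_sq, sqrt_sq hs]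
  ring

lemma Kth_hasDerivAt (θ : ℝ) : HasDerivAt Kth (-(π - θ) * sin θ / π) θ := by
  have h := ((hasDerivAt_sin θ).add
    (((hasDerivAt_id θ).const_sub π).mul (hasDerivAt_cos θ))).div_const π
  refine h.congr_deriv ?_
  simp only [id]
  ring

lemma Kth_analytic (θ : ℝ) : AnalyticAt ℝ Kth θ := by
  have h1 := analyticAt_sin (x := θ)
  have h2 := analyticAt_cos (x := θ)
  have h3 : AnalyticAt ℝ (fun θ : ℝ => π - θ) θ := analyticAt_const.sub analyticAt_id
  exact (h1.add (h3.mul h2)).div analyticAt_const pi_pos.ne'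

lemma Kth_zero : Kth 0 = 1 := by simp [Kth, pi_pos.ne']
lemma Kth_pi : Kth π = 0 := by simp [Kth]

lemma Kth_anti : StrictAntiOn Kth (Icc 0 π) := by
  apply strictAntiOn_of_deriv_neg (convex_Icc _ _)
  · exact fun θ _ => (Kth_hasDerivAt θ).continuousAt.continuousWithinAt
  · intro θ hθ
    rw [interior_Icc] at hθ
    rw [(Kth_hasDerivAt θ).deriv]
    have := sin_pos_of_mem_Ioo hθ
    have h2 : 0 < π - θ := by linarith [hθ.2]
    have : 0 < (π - θ) * sin θ / π := by positivity
    have h4 : -(π - θ) * sin θ / π = -((π - θ) * sin θ / π) := by ring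
    rw [h4]; linarith

lemma Kth_lt_one {θ : ℝ} (h0 : 0 < θ) (h : θ ≤ π) : Kth θ < 1 := by
  rw [← Kth_zero]
  exact Kth_anti ⟨le_rfl, pi_pos.le⟩ ⟨h0.le, h⟩ h0

lemma Kth_le_one {θ : ℝ} (hθ : θ ∈ Icc 0 π) : Kth θ ≤ 1 := by
  rw [← Kth_zero]
  exact Kth_anti.antitoneOn ⟨le_rfl, pi_pos.le⟩ hθ hθ.1

lemma Kth_nonneg {θ : ℝ} (hθ : θ ∈ Icc 0 π) : 0 ≤ Kth θ := by
  rw [← Kth_pi]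
  exact Kth_anti.antitoneOn hθ ⟨pi_pos.le, le_rfl⟩ hθ.2

lemma Kth_factor : ∃ g : ℝ → ℝ, AnalyticAt ℝ g 0 ∧ g 0 = 1 / 2 ∧
    ∀ᶠ θ in 𝓝 (0:ℝ), 1 - Kth θ = θ ^ 2 * g θ := by
  have hA : AnalyticAt ℝ (fun θ => 1 - Kth θ) 0 := analyticAt_const.sub (Kth_analytic 0)
  have hd1 : deriv (fun θ => 1 - Kth θ) = fun θ => (π - θ) * sin θ / π := by
    ext θ
    rw [((Kth_hasDerivAt θ).const_sub 1).deriv]; ring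
  have hord : ((2 : ℕ) : ℕ∞) ≤ analyticOrderAt (fun θ => 1 - Kth θ) 0 := by
    rw [natCast_le_analyticOrderAt_iff_iteratedDeriv_eq_zero hA]
    intro i hi
    interval_cases i
    · simp [Kth_zero]
    · rw [iteratedDeriv_one, hd1]; simp
  obtain ⟨g, hg, he⟩ := (natCast_le_analyticOrderAt hA).mp hord
  simp only [sub_zero, smul_eq_mul] at he
  refine ⟨g, hg, ?_, he⟩
  have he1 : ∀ᶠ θ in 𝓝 (0:ℝ), (π - θ) * sin θ / π = 2 * θ * g θ + θ ^ 2 * deriv g θ := by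
    filter_upwards [he.eventually_nhds, hg.eventually_analyticAt] with θ h1 h2
    have h3 : deriv (fun θ => 1 - Kth θ) θ = deriv (fun θ => θ ^ 2 * g θ) θ :=
      EventuallyEq.deriv_eq h1
    rw [hd1] at h3
    have h4 := ((hasDerivAt_pow 2 θ).mul h2.differentiableAt.hasDerivAt).deriv
    simp only [Pi.mul_def] at h4
    rw [h4] at h3
    simpa using h3
  have h5 : deriv (fun θ : ℝ => (π - θ) * sin θ / π) 0 =
      deriv (fun θ => 2 * θ * g θ + θ ^ 2 * deriv g θ) 0 := EventuallyEq.deriv_eq he1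
  have h6 : HasDerivAt (fun θ : ℝ => (π - θ) * sin θ / π) 1 0 := by
    have := ((((hasDerivAt_id (0:ℝ)).const_sub π).mul (hasDerivAt_sin 0))).div_const π
    refine this.congr_deriv ?_
    have := pi_pos.ne'
    simp [this]
  have h7 : HasDerivAt (fun θ => 2 * θ * g θ + θ ^ 2 * deriv g θ) (2 * g 0) 0 := by
    have := (((hasDerivAt_id (0:ℝ)).const_mul 2).mul hg.differentiableAt.hasDerivAt).add
      ((hasDerivAt_pow 2 (0:ℝ)).mul hg.deriv.differentiableAt.hasDerivAt)
    refine this.congr_deriv ?_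
    simp
  rw [h6.deriv, h7.deriv] at h5
  linarith

/-- signed square root of `(1-K)/2`. -/
noncomputable def Sth (θ : ℝ) : ℝ := θ * sqrt ((1 - Kth θ) / (2 * θ ^ 2))

lemma Sth_eq {θ : ℝ} (hθ : 0 < θ) : Sth θ = sqrt ((1 - Kth θ) / 2) := by
  rw [Sth]
  have : (1 - Kth θ) / (2 * θ ^ 2) = (1 - Kth θ) / 2 / θ ^ 2 := by field_simp
  rw [this, sqrt_div' _ (by positivity), sqrt_sq hθ.le]
  field_simp

lemma Sth_zero : Sth 0 = 0 := by simp [Sth]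

lemma Sth_eq' {θ : ℝ} (hθ : 0 ≤ θ) : Sth θ = sqrt ((1 - Kth θ) / 2) := by
  rcases hθ.eq_or_lt with h | h
  · rw [← h, Sth_zero, Kth_zero]; simp
  · exact Sth_eq h

lemma analyticAt_sqrt' {x : ℝ} (hx : x ≠ 0) : AnalyticAt ℝ (fun x => sqrt x) x :=
  (contDiffAt_sqrt hx).analyticAt

lemma Sth_at_zero : AnalyticAt ℝ Sth 0 ∧ HasDerivAt Sth (1 / 2) 0 := by
  obtain ⟨g, hg, hg0, he⟩ := Kth_factor
  have hev : (fun θ => θ * sqrt (g θ / 2)) =ᶠ[𝓝 0] Sth := by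
    filter_upwards [he] with θ h
    by_cases h0 : θ = 0
    · simp [h0, Sth]
    · rw [Sth, h]
      congr 2
      field_simp
  have ha : AnalyticAt ℝ (fun θ => sqrt (g θ / 2)) 0 := by
    have h1 : AnalyticAt ℝ (fun θ => g θ / 2) 0 := hg.div analyticAt_const (by norm_num)
    exact AnalyticAt.comp (g := fun x => sqrt x) (f := fun θ => g θ / 2)
      (analyticAt_sqrt' (by rw [hg0]; norm_num)) h1
  constructor
  · exact (analyticAt_id.mul ha).congr hev
  · have h := (hasDerivAt_id (0:ℝ)).mul ha.differentiableAt.hasDerivAt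
    refine (h.congr_of_eventuallyEq hev.symm).congr_deriv ?_
    have : sqrt (1 / 2 / 2) = 1 / 2 := by
      rw [show (1:ℝ) / 2 / 2 = (1 / 2) ^ 2 by norm_num, sqrt_sq (by norm_num)]
    simp only [hg0, this, id]; ring

lemma Sth_analytic {θ : ℝ} (hθ : θ ∈ Icc 0 π) : AnalyticAt ℝ Sth θ := by
  rcases hθ.1.eq_or_lt with h | h
  · rw [← h]; exact Sth_at_zero.1
  · have hK := Kth_lt_one h hθ.2
    have h1 : AnalyticAt ℝ (fun θ : ℝ => (1 - Kth θ) / (2 * θ ^ 2)) θ :=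
      (analyticAt_const.sub (Kth_analytic θ)).div (analyticAt_const.mul (analyticAt_id.pow 2))
        (by simp [h.ne'])
    have h2 : (1 - Kth θ) / (2 * θ ^ 2) ≠ 0 := by
      have : 0 < 1 - Kth θ := by linarith
      positivity
    exact analyticAt_id.mul (AnalyticAt.comp (g := fun x => sqrt x)
      (f := fun θ : ℝ => (1 - Kth θ) / (2 * θ ^ 2)) (analyticAt_sqrt' h2) h1)

lemma Sth_sq {θ : ℝ} (hθ : θ ∈ Icc 0 π) : Sth θ ^ 2 = (1 - Kth θ) / 2 := by
  rw [Sth_eq' hθ.1, sq_sqrt]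
  linarith [Kth_le_one hθ]

lemma Sth_nonneg {θ : ℝ} (hθ : θ ∈ Icc 0 π) : 0 ≤ Sth θ := by
  rw [Sth_eq' hθ.1]; exact sqrt_nonneg _

lemma Sth_lt {θ : ℝ} (hθ : θ ∈ Icc 0 π) : Sth θ < 1 := by
  have := Sth_sq hθ
  nlinarith [Kth_nonneg hθ, Sth_nonneg hθ]

/-- `arccos (κ₁ (cos θ))`, analytic on a neighbourhood of `[0,π]`. -/
noncomputable def Phi (θ : ℝ) : ℝ := 2 * arcsin (Sth θ)

lemma analyticAt_arcsin' {x : ℝ} (h1 : x ≠ -1) (h2 : x ≠ 1) : AnalyticAt ℝ arcsin x :=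
  (contDiffAt_arcsin h1 h2).analyticAt

lemma Phi_analytic {θ : ℝ} (hθ : θ ∈ Icc 0 π) : AnalyticAt ℝ Phi θ :=
  analyticAt_const.mul (AnalyticAt.comp (g := arcsin) (f := Sth)
    (analyticAt_arcsin' (by linarith [Sth_nonneg hθ]) (Sth_lt hθ).ne) (Sth_analytic hθ))

lemma Phi_cos {θ : ℝ} (hθ : θ ∈ Icc 0 π) : cos (Phi θ) = Kth θ := by
  rw [Phi, cos_two_mul, cos_sq', sin_arcsin (by linarith [Sth_nonneg hθ]) (Sth_lt hθ).le, Sth_sq hθ]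
  ring

lemma Phi_mem {θ : ℝ} (hθ : θ ∈ Icc 0 π) : Phi θ ∈ Icc 0 π := by
  have h1 := arcsin_nonneg.mpr (Sth_nonneg hθ)
  have h2 := arcsin_le_pi_div_two (Sth θ)
  constructor <;> unfold Phi <;> linarith

lemma Phi_zero : Phi 0 = 0 := by simp [Phi, Sth_zero]

lemma Phi_deriv_zero : HasDerivAt Phi 1 0 := by
  have h := (hasDerivAt_arcsin (x := Sth 0) (by rw [Sth_zero]; norm_num)
    (by rw [Sth_zero]; norm_num)).comp 0 Sth_at_zero.2
  refine (h.const_mul 2).congr_deriv ?_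
  simp [Sth_zero]

lemma Phi_deriv_pi : HasDerivAt Phi 0 π := by
  have hm : π ∈ Icc 0 π := ⟨pi_pos.le, le_rfl⟩
  have h1 : HasDerivAt (fun θ => (1 - Kth θ) / 2) 0 π := by
    refine (((Kth_hasDerivAt π).const_sub 1).div_const 2).congr_deriv ?_
    simp
  have h2 : HasDerivAt Sth 0 π := by
    have h3 := h1.sqrt (by rw [Kth_pi]; norm_num)
    have hev : Sth =ᶠ[𝓝 π] fun θ => sqrt ((1 - Kth θ) / 2) := by
      filter_upwards [lt_mem_nhds pi_pos] with θ hθ using Sth_eq hθ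
    refine (h3.congr_of_eventuallyEq hev).congr_deriv ?_
    simp
  have h := (hasDerivAt_arcsin (x := Sth π) (by linarith [Sth_nonneg hm])
    (Sth_lt hm).ne).comp π h2
  refine (h.const_mul 2).congr_deriv ?_
  simp

lemma PhiI_mem (n : ℕ) {θ : ℝ} (hθ : θ ∈ Icc 0 π) : Phi^[n] θ ∈ Icc 0 π := by
  induction n with
  | zero => simpa using hθ
  | succ n ih => rw [Function.iterate_succ_apply']; exact Phi_mem ih

lemma PhiI_analytic (n : ℕ) {θ : ℝ} (hθ : θ ∈ Icc 0 π) : AnalyticAt ℝ (Phi^[n]) θ := by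
  induction n with
  | zero => exact analyticAt_id
  | succ n ih =>
    rw [Function.iterate_succ']
    exact AnalyticAt.comp (Phi_analytic (PhiI_mem n hθ)) ih

lemma PhiI_cos (n : ℕ) {θ : ℝ} (hθ : θ ∈ Icc 0 π) : kappa1^[n] (cos θ) = cos (Phi^[n] θ) := by
  induction n with
  | zero => simp
  | succ n ih =>
    rw [Function.iterate_succ_apply', Function.iterate_succ_apply', ih, kappa1_cos (PhiI_mem n hθ),
      Phi_cos (PhiI_mem n hθ)]

lemma PhiI_zero (n : ℕ) : Phi^[n] 0 = 0 := by
  induction n with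
  | zero => rfl
  | succ n ih => rw [Function.iterate_succ_apply', ih, Phi_zero]

lemma PhiI_deriv_zero (n : ℕ) : HasDerivAt (Phi^[n]) 1 0 := by
  induction n with
  | zero => exact hasDerivAt_id 0
  | succ n ih =>
    rw [Function.iterate_succ']
    have h : HasDerivAt Phi 1 (Phi^[n] 0) := by rw [PhiI_zero]; exact Phi_deriv_zero
    simpa using h.comp 0 ih

lemma PhiI_deriv_pi (n : ℕ) : HasDerivAt (Phi^[n + 1]) 0 π := by
  rw [Function.iterate_succ]
  have h := (PhiI_analytic n (Phi_mem (θ := π) ⟨pi_pos.le, le_rfl⟩)).differentiableAt.hasDerivAt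
  simpa using h.comp π Phi_deriv_pi

/-- The `(n+2)`-layer NTK in the angle variable. -/
noncomputable def FN : ℕ → ℝ → ℝ
  | 0 => fun θ => cos θ * (1 - θ / π) + Kth θ
  | n + 1 => fun θ => FN n θ * (1 - Phi^[n + 1] θ / π) + cos (Phi^[n + 2] θ)

lemma FN_analytic (n : ℕ) {θ : ℝ} (hθ : θ ∈ Icc 0 π) : AnalyticAt ℝ (FN n) θ := by
  induction n with
  | zero =>
    exact (analyticAt_cos.mul (analyticAt_const.sub (analyticAt_id.div analyticAt_const
      pi_pos.ne'))).add (Kth_analytic θ)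
  | succ n ih =>
    exact (ih.mul (analyticAt_const.sub ((PhiI_analytic (n + 1) hθ).div analyticAt_const
      pi_pos.ne'))).add (AnalyticAt.comp (g := cos) (f := Phi^[n + 2]) analyticAt_cos
        (PhiI_analytic (n + 2) hθ))

lemma FN_eq (n : ℕ) {θ : ℝ} (hθ : θ ∈ Icc 0 π) : kappaNTK (n + 2) (cos θ) = FN n θ := by
  induction n with
  | zero =>
    simp only [kappaNTK, FN, kappa1_cos hθ, kappa0, arccos_cos hθ.1 hθ.2]
  | succ n ih =>
    have hm := PhiI_mem (n + 1) hθ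
    rw [show n + 1 + 2 = n + 3 by ring, kappaNTK, ih, PhiI_cos _ hθ, PhiI_cos _ hθ, kappa0,
      arccos_cos hm.1 hm.2]
    rfl

lemma kappa0_cont : Continuous kappa0 := by
  unfold kappa0
  have := continuous_arccos
  fun_prop
lemma kappa1_cont : Continuous kappa1 := by
  unfold kappa1
  have := continuous_arccos
  fun_prop

lemma kappaNTK_cont (n : ℕ) : Continuous (kappaNTK (n + 2)) := by
  induction n with
  | zero =>
    have : kappaNTK (0 + 2) = fun u => u * kappa0 u + kappa1 u := by ext u; simp [kappaNTK]
    rw [this]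
    exact (continuous_id.mul kappa0_cont).add kappa1_cont
  | succ n ih =>
    have : kappaNTK (n + 1 + 2) = fun u =>
      kappaNTK (n + 2) u * kappa0 (kappa1^[n + 1] u) + kappa1^[n + 2] u := by
      ext u; rw [show n + 1 + 2 = n + 3 by ring, kappaNTK]
    rw [this]
    exact (ih.mul (kappa0_cont.comp (kappa1_cont.iterate _))).add (kappa1_cont.iterate _)

lemma FN_zero (n : ℕ) : FN n 0 = n + 2 := by
  induction n with
  | zero => simp [FN, Kth_zero]; norm_num
  | succ n ih =>
    simp only [FN, PhiI_zero, ih]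
    push_cast
    simp
    ring

lemma FN_deriv_succ (n : ℕ) {θ p q : ℝ} (hθ : θ ∈ Icc 0 π) (hp : HasDerivAt (Phi^[n + 1]) p θ)
    (hq : HasDerivAt (Phi^[n + 2]) q θ) : deriv (FN (n + 1)) θ =
    deriv (FN n) θ * (1 - Phi^[n + 1] θ / π) + FN n θ * (-(p / π))
      + (-sin (Phi^[n + 2] θ)) * q := by
  have h := ((FN_analytic n hθ).differentiableAt.hasDerivAt.mul
    ((hp.div_const π).const_sub 1)).add hq.cos
  exact h.deriv

lemma FN0_deriv (θ : ℝ) : deriv (FN 0) θ = -sin θ * (1 - θ / π) + cos θ * (-(1 / π))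
    + (-(π - θ) * sin θ / π) := by
  have h := ((hasDerivAt_cos θ).mul (((hasDerivAt_id θ).div_const π).const_sub 1)).add
    (Kth_hasDerivAt θ)
  exact h.deriv

lemma FN_deriv_zero (n : ℕ) : deriv (FN n) 0 ≤ -(2 * n + 1) / π := by
  induction n with
  | zero => rw [FN0_deriv]; simp; rw [neg_div]; simp
  | succ n ih =>
    rw [FN_deriv_succ n ⟨le_rfl, pi_pos.le⟩ (PhiI_deriv_zero _) (PhiI_deriv_zero _), PhiI_zero,
      PhiI_zero, FN_zero]
    simp only [sin_zero, zero_div, sub_zero, mul_one, neg_zero, zero_mul, add_zero]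
    have h1 : -(2 * ((n + 1 : ℕ) : ℝ) + 1) / π = -(2 * n + 1) / π - 2 / π := by push_cast; ring
    have h2 : ((n : ℝ) + 2) * -(1 / π) = -(2 / π) - n / π := by ring
    rw [h1, h2]
    have : 0 ≤ (n : ℝ) / π := by have := pi_pos; positivity
    linarith

lemma FN_deriv_pi (n : ℕ) : |deriv (FN n) π| ≤ 1 / π := by
  have hm : π ∈ Icc 0 π := ⟨pi_pos.le, le_rfl⟩
  induction n with
  | zero => rw [FN0_deriv]; simp [abs_of_pos pi_pos]
  | succ n ih =>
    rw [FN_deriv_succ n hm (PhiI_deriv_pi _) (PhiI_deriv_pi _)]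
    have h := PhiI_mem (n + 1) hm
    have h1 : 0 ≤ Phi^[n + 1] π / π := div_nonneg h.1 pi_pos.le
    have h2 : Phi^[n + 1] π / π ≤ 1 := (div_le_one pi_pos).mpr h.2
    simp only [zero_div, neg_zero, mul_zero, add_zero, abs_mul]
    rw [abs_of_nonneg (by linarith : 0 ≤ 1 - Phi^[n + 1] π / π)]
    calc _ ≤ |deriv (FN n) π| * 1 := by gcongr; linarith
      _ ≤ _ := by simpa using ih

/-- Deep NTK decay: the Legendre coefficients of the `L`-layer NTK function decay as
`k^{-d}` along each parity. -/
theorem deep_ntk_decay (d L : ℕ) (hd : 3 ≤ d) (hL : 3 ≤ L) :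
    ∃ Ce Co : ℝ, Ce ≠ 0 ∧ Co ≠ 0 ∧
      Tendsto (fun k : ℕ =>
          legendreCoeff d k (kappaNTK L) / (Ce * (k : ℝ) ^ (-(d : ℝ))))
        (atTop ⊓ 𝓟 {k | Even k}) (𝓝 1) ∧
      Tendsto (fun k : ℕ =>
          legendreCoeff d k (kappaNTK L) / (Co * (k : ℝ) ^ (-(d : ℝ))))
        (atTop ⊓ 𝓟 {k | Odd k}) (𝓝 1) := by
  obtain ⟨e, rfl⟩ : ∃ e, d = e + 3 := ⟨d - 3, by omega⟩
  obtain ⟨n, rfl⟩ : ∃ n, L = (n + 1) + 2 := ⟨L - 3, by omega⟩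
  have h0 := FN_deriv_zero (n + 1)
  have h1 := abs_le.mp (FN_deriv_pi (n + 1))
  have hp : 0 < 1 / π := by have := pi_pos; positivity
  have hlt : deriv (FN (n + 1)) 0 < -(1 / π) := by
    refine h0.trans_lt ?_
    have e1 : -(2 * ((n + 1 : ℕ) : ℝ) + 1) / π = -(1 / π) - (2 * (n : ℝ) + 2) * (1 / π) := by
      push_cast; ring
    rw [e1]
    have : 0 < (2 * (n : ℝ) + 2) * (1 / π) := by positivity
    linarith
  exact decay_of_analytic e (kappaNTK (n + 1 + 2)) (FN (n + 1)) (kappaNTK_cont (n + 1))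
    (fun θ hθ => FN_analytic (n + 1) hθ) (fun θ hθ => FN_eq (n + 1) hθ)
    (by linarith [h1.1]) (by linarith [h1.2])
end

section
/- Fix integers d ≥ 3 and L ≥ 3, let κ_s^L := κ₀^{∘(L−1)} be the kernel function of an L-layer network with step activations, and set ν_L = 1/2^{L−1}. Then there exists a nonzero real constant C(d,L) such that μ_k(κ_s^L) · k^{d+2ν_L−1} → C(d,L) as k → ∞ (the same limit along even and along odd k); that is, μ_k(κ_s^L) ∼ C(d,L) · k^{−d−2ν_L+1}. -/
open Filter Asymptotics Real Set Topology

open Filter Asymptotics Real Set Topology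
namespace DSD

/-- principal complex square root -/
noncomputable def cs (z : ℂ) : ℂ := z ^ ((1:ℂ)/2)

lemma cs_sq (z : ℂ) : cs z ^ 2 = z := by
  unfold cs
  rw [one_div]
  exact_mod_cast Complex.cpow_nat_inv_pow z (n := 2) (by norm_num)

lemma cs_mul_self (z : ℂ) : cs z * cs z = z := by rw [← sq, cs_sq]

lemma cs_norm (z : ℂ) : ‖cs z‖ = √‖z‖ := by
  have := congrArg norm (cs_sq z)
  rw [norm_pow] at this
  rw [← this, Real.sqrt_sq (norm_nonneg _)]

lemma cs_re_nonneg (z : ℂ) : 0 ≤ (cs z).re := by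
  by_cases h : z = 0
  · simp [cs, h]
  unfold cs
  rw [Complex.cpow_def_of_ne_zero h, Complex.exp_re]
  apply mul_nonneg (Real.exp_pos _).le
  apply Real.cos_nonneg_of_mem_Icc
  have h1 : (Complex.log z * (1 / 2)).im = z.arg / 2 := by
    simp [Complex.mul_im, Complex.log_im]; ring
  rw [h1]
  have := Complex.neg_pi_lt_arg z
  have := Complex.arg_le_pi z
  constructor <;> linarith

lemma cs_cont_zero : ContinuousAt cs 0 := by
  rw [ContinuousAt]
  have h0 : cs 0 = 0 := by simp [cs]
  rw [h0, tendsto_zero_iff_norm_tendsto_zero]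
  simp_rw [cs_norm]
  have : Continuous fun z : ℂ => √‖z‖ := by fun_prop
  simpa using this.tendsto 0

lemma cs_diff {z : ℂ} (h : z ∈ Complex.slitPlane) : DifferentiableAt ℂ cs z := by
  unfold cs
  exact (differentiableAt_id.cpow (differentiableAt_const _) h)

lemma cs_cont {z : ℂ} (h : z ∈ Complex.slitPlane ∨ z = 0) : ContinuousAt cs z := by
  rcases h with h | h
  · exact (cs_diff h).continuousAt
  · rw [h]; exact cs_cont_zero

lemma cs_smul {r : ℝ} (hr : 0 ≤ r) (z : ℂ) : cs ((r:ℂ) * z) = (√r : ℝ) * cs z := by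
  rcases hr.eq_or_lt with h | h
  · rw [← h]; simp [cs]
  by_cases hz : z = 0
  · rw [hz]; simp [cs]
  have hr0 : (r:ℂ) ≠ 0 := by exact_mod_cast h.ne'
  unfold cs
  rw [Complex.cpow_def_of_ne_zero (mul_ne_zero hr0 hz), Complex.cpow_def_of_ne_zero hz,
    Complex.log_ofReal_mul h hz, add_mul, Complex.exp_add, Real.sqrt_eq_rpow,
    Complex.ofReal_cpow h.le, Complex.cpow_def_of_ne_zero hr0, Complex.ofReal_log h.le]
  push_cast
  rfl

/-- sqrt (1 - z^2) with cuts going down -/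
noncomputable def ss (z : ℂ) : ℂ := cs (Complex.I * (1 - z)) * cs (-Complex.I * (1 + z))
noncomputable def pp (z : ℂ) : ℂ := ss z - Complex.I * z
noncomputable def Phi (p : ℂ) : ℂ := 1 / 2 + (Complex.I / π) * Complex.log p
noncomputable def KK (z : ℂ) : ℂ := Phi (pp z)

def Om : Set ℂ := {z | 0 < z.im ∨ |z.re| < 1}
def Hc : Set ℂ := {z | 0 ≤ z.im}

lemma ss_sq (z : ℂ) : ss z ^ 2 = 1 - z ^ 2 := by
  unfold ss
  rw [mul_pow, cs_sq, cs_sq]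
  linear_combination (-(1 - z) * (1 + z)) * Complex.I_sq

lemma pp_mul (z : ℂ) : pp z * (ss z + Complex.I * z) = 1 := by
  unfold pp
  linear_combination ss_sq z - z ^ 2 * Complex.I_sq

lemma pp_ne (z : ℂ) : pp z ≠ 0 := left_ne_zero_of_mul (by rw [pp_mul z]; exact one_ne_zero)

lemma sq_re (a : ℂ) : (a ^ 2).re = a.re ^ 2 - a.im ^ 2 := by simp [sq]
lemma sq_im (a : ℂ) : (a ^ 2).im = 2 * a.re * a.im := by simp [sq]; ring

lemma ss_re_nonneg {z : ℂ} (hz : 0 ≤ z.im) : 0 ≤ (ss z).re := by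
  unfold ss
  set a := cs (Complex.I * (1 - z)) with ha
  set b := cs (-Complex.I * (1 + z)) with hb
  have h1 := congrArg Complex.re (cs_sq (Complex.I * (1 - z)))
  have h2 := congrArg Complex.re (cs_sq (-Complex.I * (1 + z)))
  have h3 : 0 ≤ a.re := cs_re_nonneg _
  have h4 : 0 ≤ b.re := cs_re_nonneg _
  rw [← ha, sq_re] at h1
  rw [← hb, sq_re] at h2
  simp at h1 h2
  have h5 : |a.im| ≤ a.re := abs_le_of_sq_le_sq (by linarith) h3
  have h6 : |b.im| ≤ b.re := abs_le_of_sq_le_sq (by linarith) h4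
  rw [Complex.mul_re]
  have := mul_le_mul h5 h6 (abs_nonneg _) h3
  rw [← abs_mul] at this
  have := le_abs_self (a.im * b.im)
  linarith

lemma ss_re_pos {z : ℂ} (hz : z ∈ Om) : 0 < (ss z).re := by
  unfold ss
  set a := cs (Complex.I * (1 - z)) with ha
  set b := cs (-Complex.I * (1 + z)) with hb
  have h1 := congrArg Complex.re (cs_sq (Complex.I * (1 - z)))
  have h2 := congrArg Complex.re (cs_sq (-Complex.I * (1 + z)))
  have h1i := congrArg Complex.im (cs_sq (Complex.I * (1 - z)))
  have h2i := congrArg Complex.im (cs_sq (-Complex.I * (1 + z)))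
  have h3 : 0 ≤ a.re := cs_re_nonneg _
  have h4 : 0 ≤ b.re := cs_re_nonneg _
  rw [← ha, sq_re] at h1
  rw [← hb, sq_re] at h2
  rw [← ha, sq_im] at h1i
  rw [← hb, sq_im] at h2i
  simp at h1 h2 h1i h2i
  rw [Complex.mul_re]
  rcases hz with hz | hz
  · have h5 : |a.im| < a.re := abs_lt_of_sq_lt_sq (by linarith) h3
    have h6 : |b.im| < b.re := abs_lt_of_sq_lt_sq (by linarith) h4
    have := mul_lt_mul'' h5 h6 (abs_nonneg _) (abs_nonneg _)
    rw [← abs_mul] at this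
    have := le_abs_self (a.im * b.im)
    linarith
  · rw [abs_lt] at hz
    have e1 : 0 < a.re * a.im := by nlinarith
    have e2 : b.re * b.im < 0 := by nlinarith
    have e3 : 0 < a.re := lt_of_le_of_ne h3 (fun h => by rw [← h] at e1; simp at e1)
    have e4 : 0 < b.re := lt_of_le_of_ne h4 (fun h => by rw [← h] at e2; simp at e2)
    have e5 : 0 < a.im := by by_contra h; push Not at h; nlinarith
    have e6 : b.im < 0 := by by_contra h; push Not at h; nlinarith
    nlinarith [mul_pos e3 e4, mul_pos e5 (neg_pos.2 e6)]

lemma pp_inv (z : ℂ) : (pp z)⁻¹ = ss z + Complex.I * z :=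
  inv_eq_of_mul_eq_one_right (pp_mul z)

lemma pp_re (z : ℂ) : (pp z).re * (1 + (Complex.normSq (pp z))⁻¹) = 2 * (ss z).re := by
  have h := congrArg Complex.re (pp_inv z)
  rw [Complex.inv_re] at h
  have h2 : (pp z).re = (ss z).re + z.im := by simp [pp]
  have h3 : (ss z + Complex.I * z).re = (ss z).re - z.im := by simp; ring
  rw [mul_add, ← div_eq_mul_inv, h, h3, mul_one]
  linarith

lemma pp_re' (z : ℂ) : (pp z).re * (1 - (Complex.normSq (pp z))⁻¹) = 2 * z.im := by
  have h := congrArg Complex.re (pp_inv z)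
  rw [Complex.inv_re] at h
  have h2 : (pp z).re = (ss z).re + z.im := by simp [pp]
  have h3 : (ss z + Complex.I * z).re = (ss z).re - z.im := by simp; ring
  rw [mul_sub, ← div_eq_mul_inv, h, h3, mul_one]
  linarith

lemma pp_nsq (z : ℂ) : 0 < (Complex.normSq (pp z))⁻¹ := inv_pos.2 (Complex.normSq_pos.2 (pp_ne z))

lemma pp_re_pos {z : ℂ} (hz : z ∈ Om) : 0 < (pp z).re := by
  have := pp_re z; have := ss_re_pos hz; have := pp_nsq z
  by_contra h; push Not at h; nlinarith

lemma pp_re_nonneg {z : ℂ} (hz : 0 ≤ z.im) : 0 ≤ (pp z).re := by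
  have := pp_re z; have := ss_re_nonneg hz; have := pp_nsq z
  by_contra h; push Not at h; nlinarith

lemma pp_slit {z : ℂ} (hz : 0 ≤ z.im ∨ z ∈ Om) : pp z ∈ Complex.slitPlane := by
  rw [Complex.mem_slitPlane_iff]
  rcases hz with hz | hz
  · rcases (pp_re_nonneg hz).lt_or_eq with h | h
    · exact Or.inl h
    · right; intro h2; exact pp_ne z (Complex.ext h.symm h2)
  · exact Or.inl (pp_re_pos hz)

lemma ss_cont {z : ℂ} (hz : 0 ≤ z.im) : ContinuousAt ss z := by
  unfold ss
  apply ContinuousAt.mul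
  · apply ContinuousAt.comp (g := cs)
    · apply cs_cont
      rw [Complex.mem_slitPlane_iff]
      by_cases h : z = 1
      · right; simp [h]
      · left
        simp
        rcases hz.lt_or_eq with h1 | h1
        · exact Or.inl h1
        · right; intro h2; apply h; apply Complex.ext <;> simp <;> linarith
    · fun_prop
  · apply ContinuousAt.comp (g := cs)
    · apply cs_cont
      rw [Complex.mem_slitPlane_iff]
      by_cases h : z = -1
      · right; simp [h]
      · left
        simp
        rcases hz.lt_or_eq with h1 | h1
        · exact Or.inl h1
        · right; intro h2; apply h; apply Complex.ext <;> simp <;> linarith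
    · fun_prop

lemma ss_diff {z : ℂ} (hz : z ∈ Om) : DifferentiableAt ℂ ss z := by
  unfold ss
  apply DifferentiableAt.mul
  · apply DifferentiableAt.comp (g := cs)
    · apply cs_diff
      rw [Complex.mem_slitPlane_iff]
      simp
      rcases hz with h | h
      · exact Or.inl h
      · right; rw [abs_lt] at h; linarith
    · fun_prop
  · apply DifferentiableAt.comp (g := cs)
    · apply cs_diff
      rw [Complex.mem_slitPlane_iff]
      simp
      rcases hz with h | h
      · exact Or.inl h
      · right; rw [abs_lt] at h; linarith
    · fun_prop

lemma pp_cont {z : ℂ} (hz : 0 ≤ z.im) : ContinuousAt pp z := by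
  have := ss_cont hz
  unfold pp
  fun_prop

lemma KK_cont {z : ℂ} (hz : 0 ≤ z.im) : ContinuousAt KK z := by
  have h2 := (pp_cont hz).clog (pp_slit (Or.inl hz))
  unfold KK Phi
  fun_prop

lemma KK_diff {z : ℂ} (hz : z ∈ Om) : DifferentiableAt ℂ KK z := by
  have h1 := ss_diff hz
  have h0 : DifferentiableAt ℂ pp z := by unfold pp; fun_prop
  have h2 := h0.clog (pp_slit (Or.inr hz))
  unfold KK Phi
  fun_prop

lemma KK_re (z : ℂ) : (KK z).re = 1 / 2 - (pp z).arg / π := by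
  have : KK z = 1/2 + ((1 / π : ℝ) : ℂ) * (Complex.I * Complex.log (pp z)) := by
    unfold KK Phi; push_cast; ring
  rw [this]
  simp [Complex.log_im]
  ring

lemma KK_im (z : ℂ) : (KK z).im = Real.log ‖pp z‖ / π := by
  have : KK z = 1/2 + ((1 / π : ℝ) : ℂ) * (Complex.I * Complex.log (pp z)) := by
    unfold KK Phi; push_cast; ring
  rw [this]
  simp [Complex.log_re]
  ring

lemma KK_Om {z : ℂ} (hz : z ∈ Om) : 0 < (KK z).re ∧ (KK z).re < 1 := by
  rw [KK_re]
  have h := Complex.abs_arg_lt_pi_div_two_iff.2 (Or.inl (pp_re_pos hz))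
  rw [abs_lt] at h
  have hp := Real.pi_pos
  constructor
  · have : (pp z).arg / π < 1/2 := by rw [div_lt_iff₀ hp]; linarith
    linarith
  · have : -(1/2) < (pp z).arg / π := by rw [lt_div_iff₀ hp]; linarith
    linarith

lemma KK_Om' {z : ℂ} (hz : z ∈ Om) : |(KK z).re| < 1 := by
  have := KK_Om hz
  rw [abs_lt]; constructor <;> linarith

lemma KK_mem_Om {z : ℂ} (hz : z ∈ Om) : KK z ∈ Om := Or.inr (KK_Om' hz)

lemma pp_norm_pos {z : ℂ} (hz : 0 < z.im) : 1 ≤ ‖pp z‖ := by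
  have h1 := pp_re' z
  have h2 := pp_re_pos (z := z) (Or.inl hz)
  have h3 : (Complex.normSq (pp z))⁻¹ ≤ 1 := by
    by_contra h; push Not at h; nlinarith
  have h4 := (inv_le_one₀ (Complex.normSq_pos.2 (pp_ne z))).1 h3
  rw [Complex.normSq_eq_norm_sq] at h4
  nlinarith [norm_nonneg (pp z)]

lemma pp_norm {z : ℂ} (hz : 0 ≤ z.im) : 1 ≤ ‖pp z‖ := by
  have h1 : Tendsto (fun e : ℝ => z + e * Complex.I) (𝓝[>] 0) (𝓝 z) := by
    have : Continuous (fun e : ℝ => z + e * Complex.I) := by fun_prop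
    have := this.tendsto 0
    simp at this
    exact this.mono_left nhdsWithin_le_nhds
  have h2 := ((pp_cont hz).tendsto.comp h1).norm
  refine ge_of_tendsto h2 ?_
  filter_upwards [self_mem_nhdsWithin] with e he
  apply pp_norm_pos
  simp
  have : 0 < e := he
  linarith

lemma KK_im_nonneg {z : ℂ} (hz : 0 ≤ z.im) : 0 ≤ (KK z).im := by
  rw [KK_im]
  exact div_nonneg (Real.log_nonneg (pp_norm hz)) Real.pi_pos.le

lemma ss_norm (z : ℂ) : ‖ss z‖ ≤ 1 + ‖z‖ := by
  have h := congrArg norm (ss_sq z)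
  rw [norm_pow] at h
  have h2 : ‖1 - z ^ 2‖ ≤ 1 + ‖z‖ ^ 2 := by
    refine (norm_sub_le _ _).trans ?_
    simp
  nlinarith [norm_nonneg z, norm_nonneg (ss z)]

lemma KK_norm {z : ℂ} (hz : 0 ≤ z.im) : ‖KK z‖ ≤ 2 + ‖z‖ := by
  have h1 : ‖pp z‖ ≤ 1 + 2 * ‖z‖ := by
    unfold pp
    refine (norm_sub_le _ _).trans ?_
    have := ss_norm z
    simp; linarith
  have h2 : Real.log ‖pp z‖ ≤ 2 * ‖z‖ := by
    have := Real.log_le_sub_one_of_pos (norm_pos_iff.2 (pp_ne z))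
    linarith
  have h3 := Complex.norm_le_abs_re_add_abs_im (KK z)
  have h4 := KK_im_nonneg hz
  rw [abs_of_nonneg h4] at h3
  have hp := Real.pi_gt_three
  have h5 : (KK z).im ≤ ‖z‖ := by
    rw [KK_im, div_le_iff₀ Real.pi_pos]
    nlinarith [norm_nonneg z]
  have h6 : |(KK z).re| ≤ 2 := by
    rw [KK_re]
    have a1 := Complex.neg_pi_lt_arg (pp z)
    have a2 := Complex.arg_le_pi (pp z)
    have : |(pp z).arg / π| ≤ 1 := by
      rw [abs_div, abs_of_pos Real.pi_pos, div_le_one Real.pi_pos, abs_le]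
      constructor <;> linarith
    rw [abs_le] at this ⊢
    constructor <;> linarith
  linarith

lemma eq_of_sq {x y : ℂ} (h : x ^ 2 = y ^ 2) (hx : 0 < x.re) (hy : 0 ≤ y.re) : x = y := by
  rcases sq_eq_sq_iff_eq_or_eq_neg.1 h with h | h
  · exact h
  · rw [h] at hx; simp at hx; linarith

lemma ss_real {x : ℝ} (hx : |x| ≤ 1) : ss x = (√(1 - x ^ 2) : ℝ) := by
  have hx2 : 0 ≤ 1 - x ^ 2 := by
    have := abs_le.1 hx; nlinarith
  have h1 : ss x ^ 2 = ((√(1 - x ^ 2) : ℝ) : ℂ) ^ 2 := by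
    rw [ss_sq]
    norm_cast
    rw [Real.sq_sqrt hx2]
  rcases hx2.lt_or_eq with h | h
  · symm
    apply eq_of_sq h1.symm
    · rw [Complex.ofReal_re]; exact Real.sqrt_pos.2 h
    · exact ss_re_nonneg (by simp)
  · rw [← h] at h1 ⊢
    simpa using h1

lemma KK_real {x : ℝ} (hx : |x| ≤ 1) : KK x = (1 - Real.arccos x / π : ℝ) := by
  have hx' := abs_le.1 hx
  have h1 : pp x = Complex.exp (-(Real.arcsin x : ℝ) * Complex.I) := by
    unfold pp
    rw [ss_real hx, Complex.exp_mul_I, ← Complex.ofReal_neg, ← Complex.ofReal_cos, ← Complex.ofReal_sin,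
      Real.cos_neg, Real.sin_neg, Real.sin_arcsin hx'.1 hx'.2, Real.cos_arcsin]
    push_cast; ring
  unfold KK Phi
  rw [h1, Complex.log_exp]
  · rw [Real.arccos_eq_pi_div_two_sub_arcsin]
    push_cast
    have : (π:ℂ) ≠ 0 := by exact_mod_cast Real.pi_ne_zero
    field_simp
    linear_combination (-2 * (Real.arcsin x : ℂ)) * Complex.I_sq
  · have := Real.arcsin_le_pi_div_two x
    have := Real.pi_pos
    simp
    linarith
  · have := Real.neg_pi_div_two_le_arcsin x
    have := Real.pi_pos
    simp
    linarith

lemma KK_conj {z : ℂ} (hz : |z.re| < 1) : KK (starRingEnd ℂ z) = starRingEnd ℂ (KK z) := by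
  have hO : z ∈ Om := Or.inr hz
  have hO' : starRingEnd ℂ z ∈ Om := Or.inr (by simpa using hz)
  have h1 : ss (starRingEnd ℂ z) = starRingEnd ℂ (ss z) := by
    apply eq_of_sq
    · rw [← map_pow, ss_sq, ss_sq]; simp
    · exact ss_re_pos hO'
    · simpa using (ss_re_pos hO).le
  have h2 : pp (starRingEnd ℂ z) = starRingEnd ℂ ((pp z)⁻¹) := by
    rw [pp_inv]; unfold pp; rw [h1]; simp [sub_eq_add_neg]
  have hs := pp_slit (Or.inr hO)
  have harg := (Complex.mem_slitPlane_iff_arg.1 hs).1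
  unfold KK Phi
  rw [h2, Complex.log_conj, Complex.log_inv _ harg]
  · have h22 : starRingEnd ℂ (2:ℂ) = 2 := Complex.conj_ofNat 2
    simp [h22]
    ring
  · rw [Complex.arg_inv, if_neg harg]
    intro h
    exact absurd (neg_eq_iff_eq_neg.1 h) (Complex.neg_pi_lt_arg _).ne'

end DSD

open Filter Asymptotics Real Set Topology
namespace DSD

lemma Phi_expand {p0 : ℂ} (h : p0 ∈ Complex.slitPlane) : ∃ D : ℂ → ℂ, ContinuousAt D p0 ∧
    D p0 = (Complex.I / π) * p0⁻¹ ∧ ∀ p, Phi p = Phi p0 + (p - p0) * D p := by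
  have hd : HasDerivAt Phi ((Complex.I / π) * p0⁻¹) p0 := by
    have := ((Complex.hasDerivAt_log h).const_mul (Complex.I / π)).const_add (1/2)
    exact this
  refine ⟨dslope Phi p0, ?_, ?_, ?_⟩
  · exact continuousAt_dslope_same.2 hd.differentiableAt
  · rw [dslope_same, hd.deriv]
  · intro p
    have := sub_smul_dslope Phi p0 p
    rw [smul_eq_mul] at this
    rw [this]; ring

lemma Phi_negI : Phi (-Complex.I) = 1 := by
  unfold Phi
  rw [Complex.log_neg_I]
  have : (π:ℂ) ≠ 0 := by exact_mod_cast Real.pi_ne_zero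
  field_simp
  linear_combination (-1) * Complex.I_sq

lemma Phi_I : Phi (Complex.I) = 0 := by
  unfold Phi
  rw [Complex.log_I]
  have : (π:ℂ) ≠ 0 := by exact_mod_cast Real.pi_ne_zero
  field_simp
  linear_combination Complex.I_sq

lemma KK_right : ∃ R : ℂ → ℂ, Tendsto R (𝓝 0) (𝓝 (-cs (-Complex.I * 2) / π)) ∧
    ∀ w, KK (1 + w) = 1 + cs (-Complex.I * w) * R w := by
  obtain ⟨D, hD, hD0, hDe⟩ := Phi_expand (p0 := -Complex.I) (by simp [Complex.mem_slitPlane_iff])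
  refine ⟨fun w => (cs (-Complex.I * w) + cs (-Complex.I * (1 + (1 + w)))) * D (pp (1 + w)), ?_, ?_⟩
  · have h1 : ContinuousAt (fun w : ℂ => cs (-Complex.I * w)) 0 := by
      apply ContinuousAt.comp (g := cs)
      · exact cs_cont (by simp)
      · fun_prop
    have h2 : ContinuousAt (fun w : ℂ => cs (-Complex.I * (1 + (1 + w)))) 0 := by
      apply ContinuousAt.comp (g := cs)
      · apply cs_cont; left; norm_num [Complex.mem_slitPlane_iff]
      · fun_prop
    have hp : pp (1 + 0) = -Complex.I := by
      simp [pp, ss, cs]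
    have h3 : ContinuousAt (fun w : ℂ => D (pp (1 + w))) 0 := by
      apply ContinuousAt.comp (g := D)
      · rw [hp]; exact hD
      · apply ContinuousAt.comp (g := pp)
        · exact pp_cont (by simp)
        · fun_prop
    have h4 := ((h1.add h2).mul h3).tendsto
    have e0 : -cs (-Complex.I * 2) / π =
        (cs (-Complex.I * 0) + cs (-Complex.I * (1 + (1 + 0)))) * D (pp (1 + 0)) := by
      rw [hp, hD0]
      have : cs (-Complex.I * 0) = 0 := by simp [cs]
      rw [this]
      have e : (1 + (1 + 0) : ℂ) = 2 := by norm_num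
      rw [e, inv_neg, Complex.inv_I]
      linear_combination (-(cs (-Complex.I * 2) / π)) * Complex.I_sq
    rw [e0]
    exact h4
  · intro w
    show Phi (pp (1 + w)) = _
    rw [hDe, Phi_negI]
    have : pp (1 + w) - -Complex.I = cs (-Complex.I * w) * (cs (-Complex.I * w) + cs (-Complex.I * (1 + (1 + w)))) := by
      rw [mul_add, cs_mul_self]
      unfold pp ss
      have : Complex.I * (1 - (1 + w)) = -Complex.I * w := by ring
      rw [this]; ring
    rw [this]; ring

lemma KK_left : ∃ R : ℂ → ℂ, ContinuousAt R 0 ∧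
    ∀ w, KK (-(1 + w)) = cs (Complex.I * w) * R w := by
  obtain ⟨D, hD, hD0, hDe⟩ := Phi_expand (p0 := Complex.I) (by simp [Complex.mem_slitPlane_iff])
  refine ⟨fun w => (cs (Complex.I * w) + cs (Complex.I * (1 + (1 + w)))) * D (pp (-(1 + w))), ?_, ?_⟩
  · have h1 : ContinuousAt (fun w : ℂ => cs (Complex.I * w)) 0 := by
      apply ContinuousAt.comp (g := cs)
      · exact cs_cont (by simp)
      · fun_prop
    have h2 : ContinuousAt (fun w : ℂ => cs (Complex.I * (1 + (1 + w)))) 0 := by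
      apply ContinuousAt.comp (g := cs)
      · apply cs_cont; left; norm_num [Complex.mem_slitPlane_iff]
      · fun_prop
    have hp : pp (-(1 + 0)) = Complex.I := by
      simp [pp, ss, cs]
    have h3 : ContinuousAt (fun w : ℂ => D (pp (-(1 + w)))) 0 := by
      apply ContinuousAt.comp (g := D)
      · rw [hp]; exact hD
      · apply ContinuousAt.comp (g := pp)
        · exact pp_cont (by simp)
        · fun_prop
    exact ((h1.add h2).mul h3)
  · intro w
    show Phi (pp (-(1 + w))) = _
    rw [hDe, Phi_I]
    have : pp (-(1 + w)) - Complex.I = cs (Complex.I * w) * (cs (Complex.I * w) + cs (Complex.I * (1 + (1 + w)))) := by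
      rw [mul_add, cs_mul_self]
      unfold pp ss
      have h1 : -Complex.I * (1 + -(1 + w)) = Complex.I * w := by ring
      have h2 : Complex.I * (1 - -(1 + w)) = Complex.I * (1 + (1 + w)) := by ring
      rw [h1, h2]; ring
    rw [this]; ring

/-- iterates -/
lemma it_Hc (m : ℕ) {z : ℂ} (hz : 0 ≤ z.im) : 0 ≤ (KK^[m] z).im := by
  induction m with
  | zero => simpa
  | succ m ih => rw [Function.iterate_succ_apply']; exact KK_im_nonneg ih

lemma it_Om (m : ℕ) {z : ℂ} (hz : z ∈ Om) : KK^[m] z ∈ Om := by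
  induction m with
  | zero => simpa
  | succ m ih => rw [Function.iterate_succ_apply']; exact KK_mem_Om ih

lemma it_cont (m : ℕ) {z : ℂ} (hz : 0 ≤ z.im) : ContinuousAt (KK^[m]) z := by
  induction m with
  | zero => exact continuousAt_id
  | succ m ih =>
    rw [Function.iterate_succ']
    exact ContinuousAt.comp (KK_cont (it_Hc m hz)) ih

lemma it_diff (m : ℕ) {z : ℂ} (hz : z ∈ Om) : DifferentiableAt ℂ (KK^[m]) z := by
  induction m with
  | zero => exact differentiableAt_id
  | succ m ih =>
    rw [Function.iterate_succ']
    exact DifferentiableAt.comp _ (KK_diff (it_Om m hz)) ih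

lemma it_norm (m : ℕ) {z : ℂ} (hz : 0 ≤ z.im) : ‖KK^[m] z‖ ≤ 2 * m + ‖z‖ := by
  induction m with
  | zero => simp
  | succ m ih =>
    rw [Function.iterate_succ_apply']
    have := KK_norm (it_Hc m hz)
    push_cast; linarith

lemma it_conj (m : ℕ) {z : ℂ} (hz : |z.re| < 1) :
    KK^[m] (starRingEnd ℂ z) = starRingEnd ℂ (KK^[m] z) ∧ |(KK^[m] z).re| < 1 := by
  induction m with
  | zero => simpa
  | succ m ih =>
    rw [Function.iterate_succ_apply', Function.iterate_succ_apply', ih.1]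
    exact ⟨KK_conj ih.2, KK_Om' (Or.inr ih.2)⟩

lemma kap_range {x : ℝ} : |1 - Real.arccos x / π| ≤ 1 := by
  have h1 := Real.arccos_nonneg x
  have h2 := Real.arccos_le_pi x
  have h3 : Real.arccos x / π ≤ 1 := (div_le_one Real.pi_pos).2 h2
  have h4 : 0 ≤ Real.arccos x / π := div_nonneg h1 Real.pi_pos.le
  rw [abs_le]; constructor <;> linarith

lemma it_real (m : ℕ) {x : ℝ} (hx : |x| ≤ 1) :
    KK^[m] x = (((fun u : ℝ => 1 - Real.arccos u / π)^[m] x : ℝ) : ℂ) ∧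
     |(fun u : ℝ => 1 - Real.arccos u / π)^[m] x| ≤ 1 := by
  induction m with
  | zero => simpa
  | succ m ih =>
    rw [Function.iterate_succ_apply', Function.iterate_succ_apply', ih.1]
    exact ⟨KK_real ih.2, kap_range⟩

lemma cs_negI2 : ∃ r : ℝ, 0 < r ∧ cs (-Complex.I * 2) = r * (1 - Complex.I) := by
  have h2 := congrArg Complex.im (cs_sq (-Complex.I * 2))
  have h1 := congrArg Complex.re (cs_sq (-Complex.I * 2))
  have h3 := cs_re_nonneg (-Complex.I * 2)
  rw [sq_re] at h1
  rw [sq_im] at h2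
  set q := cs (-Complex.I * 2)
  simp at h1 h2
  have h4 : 0 < q.re := lt_of_le_of_ne h3 (fun h => by rw [← h] at h2; norm_num at h2)
  refine ⟨q.re, h4, ?_⟩
  have h5 : q.im = -q.re := by nlinarith
  apply Complex.ext <;> simp [h5]

lemma it_right (m : ℕ) : ∃ C : ℂ, 0 ≤ C.im ∧ C ∈ Complex.slitPlane ∧ (1 ≤ m → 0 < C.im) ∧
    Tendsto (fun u : ℝ => (KK^[m] (Real.exp u : ℝ) - 1) / ((u ^ ((1/2:ℝ)^m) : ℝ) : ℂ)) (𝓝[>] 0) (𝓝 C) := by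
  induction m with
  | zero =>
    refine ⟨1, by simp, by simp, by simp, ?_⟩
    have h := (Real.hasDerivAt_exp 0).tendsto_slope_zero_right
    have h2 := (Complex.continuous_ofReal.tendsto _).comp h
    rw [Real.exp_zero, Complex.ofReal_one] at h2
    refine h2.congr' ?_
    filter_upwards [self_mem_nhdsWithin] with u hu
    simp
    ring
  | succ m ih =>
    obtain ⟨C, hC1, hC2, -, hC⟩ := ih
    obtain ⟨R, hR, hRe⟩ := KK_right
    obtain ⟨r, hr, hr2⟩ := cs_negI2
    set q := cs (-Complex.I * C) with hq
    have hqe : q ^ 2 = -Complex.I * C := cs_sq _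
    have h1 := congrArg Complex.re hqe
    have h2 := congrArg Complex.im hqe
    rw [sq_re] at h1
    rw [sq_im] at h2
    simp at h1 h2
    have h3 : 0 ≤ q.re := cs_re_nonneg _
    have hlt : q.im < q.re := by
      by_contra h
      push Not at h
      have h5 : C.im = 0 := by nlinarith
      rcases Complex.mem_slitPlane_iff.1 hC2 with h6 | h6
      · nlinarith
      · exact h6 h5
    have him : 0 < (q * (-cs (-Complex.I * 2) / π)).im := by
      have : q * (-cs (-Complex.I * 2) / π) = ((r / π : ℝ) : ℂ) * (q * (-(1 - Complex.I))) := by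
        rw [hr2]; push_cast; ring
      rw [this, Complex.im_ofReal_mul]
      apply mul_pos (div_pos hr Real.pi_pos)
      simp; linarith
    refine ⟨q * (-cs (-Complex.I * 2) / π), him.le, ?_, fun _ => him, ?_⟩
    · exact Complex.mem_slitPlane_iff.2 (Or.inr him.ne')
    · have hc : Tendsto (fun u : ℝ => cs (-Complex.I * ((KK^[m] (Real.exp u : ℝ) - 1) / ((u ^ ((1/2:ℝ)^m) : ℝ) : ℂ))))
          (𝓝[>] 0) (𝓝 q) := by
        have : ContinuousAt (fun z => cs (-Complex.I * z)) C := by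
          apply ContinuousAt.comp (g := cs)
          · apply cs_cont; left
            rw [Complex.mem_slitPlane_iff]
            simp
            rcases hC1.lt_or_eq with h | h
            · exact Or.inl h
            · right
              rcases Complex.mem_slitPlane_iff.1 hC2 with h6 | h6
              · exact h6.ne'
              · exact absurd h.symm h6
          · fun_prop
        exact this.tendsto.comp hC
      have hw : Tendsto (fun u : ℝ => KK^[m] (Real.exp u : ℝ) - 1) (𝓝[>] 0) (𝓝 0) := by
        have h1 : ContinuousAt (fun u : ℝ => KK^[m] (Real.exp u : ℝ) - 1) 0 := by
          have : ContinuousAt (fun u : ℝ => KK^[m] (Real.exp u : ℝ)) 0 := by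
            apply ContinuousAt.comp (g := KK^[m])
            · exact it_cont m (by simp)
            · fun_prop
          fun_prop
        have h2 : KK^[m] (Real.exp 0 : ℝ) - 1 = 0 := by
          rw [Real.exp_zero, (it_real m (by simp)).1]
          have : (fun u : ℝ => 1 - Real.arccos u / π)^[m] 1 = 1 :=
            Function.iterate_fixed (by simp) m
          rw [this]; simp
        have := h1.tendsto
        rw [h2] at this
        exact this.mono_left nhdsWithin_le_nhds
      refine (hc.mul (hR.comp hw)).congr' ?_
      filter_upwards [self_mem_nhdsWithin] with u hu
      have hu : 0 < u := hu
      have hpos : 0 < u ^ ((1/2:ℝ)^m) := Real.rpow_pos_of_pos hu _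
      have hsq : √(u ^ ((1/2:ℝ)^m)) = u ^ ((1/2:ℝ)^(m+1)) := by
        rw [Real.sqrt_eq_rpow, ← Real.rpow_mul hu.le, pow_succ]
      rw [Function.iterate_succ_apply']
      set w := KK^[m] (Real.exp u : ℝ) - 1 with hw
      have e1 : KK^[m] (Real.exp u : ℝ) = 1 + w := by rw [hw]; ring
      rw [e1, hRe]
      have e2 : -Complex.I * w = ((u ^ ((1/2:ℝ)^m) : ℝ) : ℂ) * (-Complex.I * (w / ((u ^ ((1/2:ℝ)^m) : ℝ) : ℂ))) := by
        have : ((u ^ ((1/2:ℝ)^m) : ℝ) : ℂ) ≠ 0 := by exact_mod_cast hpos.ne'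
        field_simp
      rw [e2, cs_smul hpos.le, hsq]
      have : ((u ^ ((1/2:ℝ)^(m+1)) : ℝ) : ℂ) ≠ 0 := by
        exact_mod_cast (Real.rpow_pos_of_pos hu _).ne'
      simp only [Function.comp]
      field_simp
      ring

lemma it_left (m : ℕ) {nu : ℝ} (hnu : nu < 1/2) :
    Tendsto (fun u : ℝ => (KK^[m+1] (-(Real.exp u : ℝ))).im / u ^ nu) (𝓝[>] 0) (𝓝 0) := by
  obtain ⟨R, hR, hRe⟩ := KK_left
  have h0 : KK^[m] 0 = (((fun u : ℝ => 1 - Real.arccos u / π)^[m] 0 : ℝ) : ℂ) := by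
    have := (it_real m (x := 0) (by simp)).1
    simpa using this
  have hd : DifferentiableAt ℂ (KK^[m]) 0 := it_diff m (Or.inr (by simp))
  have hD := continuousAt_dslope_same.2 hd
  have hi : ∀ y, (KK^[m] y).im = (y * dslope (KK^[m]) 0 y).im := by
    intro y
    have := sub_smul_dslope (KK^[m]) 0 y
    rw [smul_eq_mul, sub_zero] at this
    rw [this, Complex.sub_im, h0, Complex.ofReal_im, sub_zero]
  have hexp : Tendsto (fun u : ℝ => (((Real.exp u - 1 : ℝ)) : ℂ)) (𝓝[>] 0) (𝓝 0) := by
    have : Continuous (fun u : ℝ => (((Real.exp u - 1 : ℝ)) : ℂ)) := by fun_prop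
    have := this.tendsto 0
    simp only [Real.exp_zero, sub_self, Complex.ofReal_zero] at this
    exact this.mono_left nhdsWithin_le_nhds
  have hy : Tendsto (fun u : ℝ => KK (-(Real.exp u : ℝ))) (𝓝[>] 0) (𝓝 0) := by
    have h1 : ContinuousAt (fun u : ℝ => KK (-(Real.exp u : ℝ))) 0 := by
      apply ContinuousAt.comp (g := KK)
      · exact KK_cont (by simp)
      · fun_prop
    have := h1.tendsto
    have h2 : KK (-(Real.exp 0 : ℝ)) = 0 := by
      have := KK_real (x := -1) (by simp)
      rw [Real.exp_zero]
      simpa [Real.pi_ne_zero] using this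
    rw [h2] at this
    exact this.mono_left nhdsWithin_le_nhds
  have hslope : Tendsto (fun u : ℝ => (Real.exp u - 1) / u) (𝓝[>] 0) (𝓝 1) := by
    have h := (Real.hasDerivAt_exp 0).tendsto_slope_zero_right
    rw [Real.exp_zero] at h
    refine h.congr fun u => ?_
    simp; ring
  have hpw : Tendsto (fun u : ℝ => u ^ (1/2 - nu)) (𝓝[>] 0) (𝓝 0) := by
    have : ContinuousAt (fun u : ℝ => u ^ (1/2 - nu)) 0 :=
      Real.continuousAt_rpow_const _ _ (Or.inr (by linarith))
    have := this.tendsto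
    simp only [Real.zero_rpow (show 1/2 - nu ≠ 0 by linarith)] at this
    exact this.mono_left nhdsWithin_le_nhds
  rw [tendsto_zero_iff_norm_tendsto_zero]
  have hmaj := ((hpw.mul (hslope.sqrt)).mul ((hR.tendsto.comp hexp).norm)).mul ((hD.tendsto.comp hy).norm)
  rw [zero_mul, zero_mul, zero_mul] at hmaj
  refine squeeze_zero' (Eventually.of_forall fun u => norm_nonneg _) ?_ hmaj
  filter_upwards [self_mem_nhdsWithin] with u hu
  have hu : 0 < u := hu
  have hE : 0 ≤ Real.exp u - 1 := by have := Real.add_one_le_exp u; linarith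
  rw [Function.iterate_succ_apply, hi, norm_div, Real.norm_of_nonneg (Real.rpow_nonneg hu.le _)]
  have h1 : ‖KK (-(Real.exp u : ℝ))‖ = √(Real.exp u - 1) * ‖R ((Real.exp u - 1 : ℝ))‖ := by
    have : (-(Real.exp u : ℝ) : ℂ) = -(1 + (Real.exp u - 1 : ℝ)) := by push_cast; ring
    rw [this, hRe, norm_mul, cs_norm, norm_mul, Complex.norm_I, one_mul, Complex.norm_real,
      Real.norm_of_nonneg hE]
  have h2 := Complex.abs_im_le_norm (KK (-(Real.exp u : ℝ)) * dslope (KK^[m]) 0 (KK (-(Real.exp u : ℝ))))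
  rw [norm_mul, h1] at h2
  rw [div_le_iff₀ (Real.rpow_pos_of_pos hu _), Real.norm_eq_abs]
  refine h2.trans (le_of_eq ?_)
  have h3 : √(Real.exp u - 1) = u ^ (1/2 - nu) * √((Real.exp u - 1)/u) * u ^ nu := by
    rw [Real.rpow_sub hu, Real.sqrt_div hE, ← Real.sqrt_eq_rpow]
    have a1 := (Real.sqrt_pos.2 hu).ne'
    have a2 := (Real.rpow_pos_of_pos hu nu).ne'
    field_simp
  rw [h3]
  simp only [Function.comp]
  ring

end DSD

open Filter Asymptotics Real Set Topology
namespace DSD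

lemma coeff_circle (f : ℂ → ℂ) (hf : DifferentiableOn ℂ f (Metric.ball 0 1)) :
    ∃ a : ℕ → ℂ, (∀ z ∈ Metric.ball (0:ℂ) 1, HasSum (fun n => a n * z ^ n) (f z)) ∧
      ∀ n, a n = (2 * π : ℂ)⁻¹ * ∫ θ in (0:ℝ)..(2 * π),
        f (Complex.exp ((-Real.log 2 : ℝ) + θ * Complex.I)) *
          Complex.exp (-n * ((-Real.log 2 : ℝ) + θ * Complex.I)) := by
  refine ⟨fun n => ((n.factorial : ℂ))⁻¹ * iteratedDeriv n f 0, ?_, ?_⟩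
  · intro z hz
    have := Complex.hasSum_taylorSeries_on_ball hf hz
    refine this.congr_fun ?_ |> fun h => h
    intro n
    simp
    ring
  · intro n
    have h1 : HasFPowerSeriesOnBall f (cauchyPowerSeries f 0 ((1/2 : NNReal) : ℝ)) 0 (1/2 : NNReal) := by
      apply DifferentiableOn.hasFPowerSeriesOnBall
      · apply hf.mono
        apply Metric.closedBall_subset_ball
        norm_num
      · norm_num
    have h2 := h1.factorial_smul 1 n
    rw [cauchyPowerSeries_apply] at h2
    have h3 : iteratedDeriv n f 0 = (n.factorial : ℂ) * ((2 * ↑Real.pi * Complex.I)⁻¹ •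
       ∮ (z : ℂ) in C(0, ((1/2 : NNReal) : ℝ)), (1 / (z - 0)) ^ n • (z - 0)⁻¹ • f z) := by
      rw [iteratedDeriv_eq_iteratedFDeriv, ← h2, nsmul_eq_mul]
    have hn : (n.factorial : ℂ) ≠ 0 := by exact_mod_cast n.factorial_ne_zero
    simp only []
    rw [h3, ← mul_assoc, inv_mul_cancel₀ hn, one_mul, circleIntegral, smul_eq_mul, mul_inv, mul_assoc,
      ← intervalIntegral.integral_const_mul]
    congr 1
    apply intervalIntegral.integral_congr
    intro θ _
    simp only [deriv_circleMap, smul_eq_mul, sub_zero]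
    have hc : circleMap 0 ((1/2 : NNReal) : ℝ) θ = Complex.exp ((-Real.log 2 : ℝ) + θ * Complex.I) := by
      rw [circleMap, Complex.exp_add, ← Complex.ofReal_exp, Real.exp_neg, Real.exp_log (by norm_num)]
      simp
    rw [hc]
    have he : Complex.exp (-n * ((-Real.log 2 : ℝ) + θ * Complex.I)) =
        (1 / Complex.exp ((-Real.log 2 : ℝ) + θ * Complex.I)) ^ n := by
      rw [one_div, inv_pow, ← Complex.exp_nat_mul, ← Complex.exp_neg]
      congr 1; ring
    rw [he]
    have h0 := Complex.exp_ne_zero ((-Real.log 2 : ℝ) + θ * Complex.I)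
    have hI := Complex.I_ne_zero
    set E := Complex.exp ((-Real.log 2 : ℝ) + θ * Complex.I)
    field_simp

variable {f : ℂ → ℂ} {M : ℝ}

/-- the pulled-back integrand -/
noncomputable def GG (f : ℂ → ℂ) (n : ℕ) (w : ℂ) : ℂ := f (Complex.exp w) * Complex.exp (-n * w)

lemma exp_im_nonneg {w : ℂ} (h0 : 0 ≤ w.im) (h1 : w.im ≤ π) : 0 ≤ (Complex.exp w).im := by
  rw [Complex.exp_im]
  exact mul_nonneg (Real.exp_pos _).le (Real.sin_nonneg_of_nonneg_of_le_pi h0 h1)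

lemma exp_im_pos {w : ℂ} (h0 : 0 < w.im) (h1 : w.im < π) : 0 < (Complex.exp w).im := by
  rw [Complex.exp_im]
  exact mul_pos (Real.exp_pos _) (Real.sin_pos_of_pos_of_lt_pi h0 h1)

lemma GG_cont (hc : ∀ z : ℂ, 0 ≤ z.im → ContinuousAt f z) (n : ℕ) {w : ℂ} (h0 : 0 ≤ w.im) (h1 : w.im ≤ π) :
    ContinuousAt (GG f n) w := by
  unfold GG
  apply ContinuousAt.mul
  · apply ContinuousAt.comp (g := f)
    · exact hc _ (exp_im_nonneg h0 h1)
    · fun_prop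
  · fun_prop

lemma rect_id (hc : ∀ z : ℂ, 0 ≤ z.im → ContinuousAt f z)
    (hd : ∀ z : ℂ, 0 < z.im → DifferentiableAt ℂ f z) (n : ℕ) {l U : ℝ} (hlU : l ≤ U) :
    (∫ y in (0:ℝ)..π, GG f n (l + y * Complex.I)).re =
      (∫ x in l..U, (GG f n x).im) - (∫ x in l..U, (GG f n (x + π * Complex.I)).im) +
      (∫ y in (0:ℝ)..π, GG f n (U + y * Complex.I)).re := by
  have h := Complex.integral_boundary_rect_eq_zero_of_continuousOn_of_differentiableOn (GG f n)
    (l : ℂ) (U + π * Complex.I) ?_ ?_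
  · simp only [Complex.ofReal_re, Complex.ofReal_im, Complex.add_re, Complex.mul_re, Complex.I_re, mul_zero,
      Complex.I_im, mul_one, sub_self, add_zero, zero_mul, Complex.add_im, Complex.mul_im, zero_add,
      smul_eq_mul, Complex.ofReal_zero] at h
    have e1 : (∫ x in l..U, (GG f n x).im) = (∫ x in l..U, GG f n x).im := by
      have hi : IntervalIntegrable (fun x : ℝ => GG f n x) MeasureTheory.volume l U := by
        apply ContinuousOn.intervalIntegrable
        intro x _
        apply ContinuousAt.continuousWithinAt
        apply ContinuousAt.comp (g := GG f n)
        · exact GG_cont hc n (by simp) (by simpa using Real.pi_pos.le)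
        · fun_prop
      exact Complex.imCLM.intervalIntegral_comp_comm hi
    have e2 : (∫ x in l..U, (GG f n (x + π * Complex.I)).im) = (∫ x in l..U, GG f n (x + π * Complex.I)).im := by
      have hi : IntervalIntegrable (fun x : ℝ => GG f n (x + π * Complex.I)) MeasureTheory.volume l U := by
        apply ContinuousOn.intervalIntegrable
        intro x _
        apply ContinuousAt.continuousWithinAt
        apply ContinuousAt.comp (g := GG f n)
        · exact GG_cont hc n (by simpa using Real.pi_pos.le) (by simp)
        · fun_prop
      exact Complex.imCLM.intervalIntegral_comp_comm hi
    rw [e1, e2]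
    have := congrArg Complex.im h
    simp at this
    linarith
  · intro w hw
    rw [Complex.mem_reProdIm] at hw
    simp [uIcc_of_le Real.pi_pos.le] at hw
    exact (GG_cont hc n hw.2.1 hw.2.2).continuousWithinAt
  · intro w hw
    rw [Complex.mem_reProdIm] at hw
    simp [Real.pi_pos.le] at hw
    apply DifferentiableAt.differentiableWithinAt
    unfold GG
    apply DifferentiableAt.mul
    · apply DifferentiableAt.comp (g := f)
      · exact hd _ (exp_im_pos hw.2.1 hw.2.2)
      · fun_prop
    · fun_prop

lemma GG_bound (hM : ∀ z : ℂ, 0 ≤ z.im → ‖f z‖ ≤ M + ‖z‖) (n : ℕ) {w : ℂ} (h0 : 0 ≤ w.im) (h1 : w.im ≤ π) :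
    ‖GG f n w‖ ≤ (M + Real.exp w.re) * Real.exp (-(n * w.re)) := by
  unfold GG
  rw [norm_mul, Complex.norm_exp]
  have := hM _ (exp_im_nonneg h0 h1)
  rw [Complex.norm_exp] at this
  have e : (-(n:ℂ) * w).re = -(n * w.re) := by simp
  rw [e]
  gcongr

lemma edge_tendsto (hM : ∀ z : ℂ, 0 ≤ z.im → ‖f z‖ ≤ M + ‖z‖) {n : ℕ} (hn : 2 ≤ n) :
    Tendsto (fun U : ℝ => (∫ y in (0:ℝ)..π, GG f n (U + y * Complex.I)).re) atTop (𝓝 0) := by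
  have hb : ∀ U : ℝ, ‖(∫ y in (0:ℝ)..π, GG f n (U + y * Complex.I)).re‖ ≤
      ((M + Real.exp U) * Real.exp (-(n * U))) * |π - 0| := by
    intro U
    refine (Complex.abs_re_le_norm _).trans ?_
    apply intervalIntegral.norm_integral_le_of_norm_le_const
    intro y hy
    rw [uIoc_of_le Real.pi_pos.le] at hy
    have := GG_bound hM n (w := U + y * Complex.I) (by simpa using hy.1.le) (by simpa using hy.2)
    simpa using this
  refine squeeze_zero_norm hb ?_
  have hn0 : (0:ℝ) < n := by positivity
  have hn1 : (0:ℝ) < (n:ℝ) - 1 := by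
    have : (2:ℝ) ≤ n := by exact_mod_cast hn
    linarith
  have t1 : Tendsto (fun U : ℝ => Real.exp (-(n * U))) atTop (𝓝 0) :=
    Real.tendsto_exp_neg_atTop_nhds_zero.comp (tendsto_id.const_mul_atTop hn0)
  have t2 : Tendsto (fun U : ℝ => Real.exp (-(((n:ℝ) - 1) * U))) atTop (𝓝 0) :=
    Real.tendsto_exp_neg_atTop_nhds_zero.comp (tendsto_id.const_mul_atTop hn1)
  have t3 := ((t1.const_mul M).add t2).mul_const |π - 0|
  rw [mul_zero, add_zero, zero_mul] at t3
  refine t3.congr fun U => ?_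
  rw [add_mul M, ← Real.exp_add]
  congr 4
  ring

lemma integrable_aux {g : ℝ → ℝ} (hM0 : 0 ≤ M) (hg : Continuous g) (hb : ∀ x, 0 ≤ x → |g x| ≤ M + Real.exp x) {n : ℕ} (hn : 2 ≤ n) :
    MeasureTheory.IntegrableOn (fun x => g x * Real.exp (-(n * x))) (Ioi 0) := by
  have h1 : MeasureTheory.IntegrableOn (fun x : ℝ => (M + 1) * Real.exp (-x)) (Ioi 0) :=
    (integrableOn_exp_neg_Ioi 0).const_mul _
  refine MeasureTheory.Integrable.mono' h1 ?_ ?_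
  · apply Continuous.aestronglyMeasurable; fun_prop
  · refine (MeasureTheory.ae_restrict_iff' measurableSet_Ioi).2 (Eventually.of_forall fun x hx => ?_)
    have hx : 0 < x := hx
    rw [norm_mul, Real.norm_eq_abs, Real.norm_of_nonneg (Real.exp_pos _).le]
    have h2 := hb x hx.le
    have h3 : Real.exp (-(n * x)) ≤ Real.exp (-(2 * x)) := by
      apply Real.exp_le_exp.2
      have : (2:ℝ) ≤ n := by exact_mod_cast hn
      nlinarith
    have h4 : M + Real.exp x ≤ (M + 1) * Real.exp x := by
      have := Real.add_one_le_exp x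
      nlinarith
    calc |g x| * Real.exp (-(n * x)) ≤ ((M + 1) * Real.exp x) * Real.exp (-(2 * x)) := by
          gcongr
          exact h2.trans h4
      _ = (M + 1) * Real.exp (-x) := by
          rw [mul_assoc, ← Real.exp_add]; congr 2; ring

lemma coeff_formula (hM0 : 0 ≤ M) (hc : ∀ z : ℂ, 0 ≤ z.im → ContinuousAt f z)
    (hd : ∀ z : ℂ, (0 < z.im ∨ |z.re| < 1) → DifferentiableAt ℂ f z)
    (hconj : ∀ z : ℂ, |z.re| < 1 → f (starRingEnd ℂ z) = starRingEnd ℂ (f z))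
    (hreal : ∀ x : ℝ, |x| ≤ 1 → (f x).im = 0)
    (hM : ∀ z : ℂ, 0 ≤ z.im → ‖f z‖ ≤ M + ‖z‖) :
    ∃ a : ℕ → ℝ, (∀ t : ℝ, |t| < 1 → HasSum (fun n => a n * t ^ n) (f t).re) ∧
      ∀ n, 2 ≤ n → π * a n = (∫ x in Ioi (0:ℝ), (f (Real.exp x : ℝ)).im * Real.exp (-(n * x))) -
        (-1) ^ n * ∫ x in Ioi (0:ℝ), (f (-(Real.exp x : ℝ))).im * Real.exp (-(n * x)) := by
  obtain ⟨a, ha, hac⟩ := coeff_circle f (fun z hz => (hd z (Or.inr (by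
    rw [mem_ball_zero_iff] at hz
    exact (Complex.abs_re_le_norm z).trans_lt hz))).differentiableWithinAt)
  refine ⟨fun n => (a n).re, ?_, ?_⟩
  · intro t ht
    have h1 := Complex.hasSum_re (ha t (by rw [mem_ball_zero_iff]; simpa using ht))
    refine h1.congr_fun ?_ |> fun h => h
    intro n
    rw [← Complex.ofReal_pow, Complex.re_mul_ofReal]
  · intro n hn
    set l : ℝ := -Real.log 2 with hl
    have hl0 : l < 0 := by rw [hl]; have := Real.log_pos (x := 2) (by norm_num); linarith
    have hsmall : ∀ θ : ℝ, |(Complex.exp (l + θ * Complex.I)).re| < 1 := by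
      intro θ
      refine (Complex.abs_re_le_norm _).trans_lt ?_
      rw [Complex.norm_exp]
      simpa using hl0
    have hGc : Continuous (fun θ : ℝ => GG f n (l + θ * Complex.I)) := by
      rw [continuous_iff_continuousAt]
      intro θ
      unfold GG
      apply ContinuousAt.mul
      · apply ContinuousAt.comp (g := f)
        · exact (hd _ (Or.inr (hsmall θ))).continuousAt
        · fun_prop
      · fun_prop
    have hsym : ∀ θ : ℝ, (GG f n (l + (2 * π - θ : ℝ) * Complex.I)).re = (GG f n (l + θ * Complex.I)).re := by
      intro θ
      have : GG f n (l + (2 * π - θ : ℝ) * Complex.I) = starRingEnd ℂ (GG f n (l + θ * Complex.I)) := by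
        unfold GG
        have e1 : Complex.exp (l + (2 * π - θ : ℝ) * Complex.I) = starRingEnd ℂ (Complex.exp (l + θ * Complex.I)) := by
          rw [← Complex.exp_conj]
          simp
          rw [Complex.exp_eq_exp_iff_exists_int]
          exact ⟨1, by push_cast; ring⟩
        have e2 : ∀ w, Complex.exp (-n * w) = ((Complex.exp w) ^ n)⁻¹ := by
          intro w
          rw [← Complex.exp_nat_mul, ← Complex.exp_neg]; congr 1; ring
        rw [e2, e2, e1, hconj _ (hsmall θ)]
        simp
      rw [this, Complex.conj_re]
    have hI : π * (a n).re = (∫ y in (0:ℝ)..π, GG f n (l + y * Complex.I)).re := by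
      have hre : ∀ p q : ℝ, (∫ y in p..q, GG f n (l + y * Complex.I)).re = ∫ y in p..q, (GG f n (l + y * Complex.I)).re := by
        intro p q
        symm
        exact Complex.reCLM.intervalIntegral_comp_comm (hGc.intervalIntegrable _ _)
      have h1 : (a n).re = (2 * π)⁻¹ * ∫ θ in (0:ℝ)..(2*π), (GG f n (l + θ * Complex.I)).re := by
        rw [← hre, hac n]
        have : (2 * π : ℂ)⁻¹ = (((2 * π)⁻¹ : ℝ) : ℂ) := by push_cast; rfl
        rw [this, Complex.re_ofReal_mul]
        rfl
      have hrc : Continuous (fun θ : ℝ => (GG f n (l + θ * Complex.I)).re) := Complex.continuous_re.comp hGc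
      have h2 : (∫ θ in π..(2*π), (GG f n (l + θ * Complex.I)).re) = ∫ θ in (0:ℝ)..π, (GG f n (l + θ * Complex.I)).re := by
        have := intervalIntegral.integral_comp_sub_left (a := 0) (b := π) (fun θ : ℝ => (GG f n (l + θ * Complex.I)).re) (2 * π)
        simp only [hsym] at this
        rw [this]
        congr 1 <;> ring
      rw [h1, ← intervalIntegral.integral_add_adjacent_intervals (hrc.intervalIntegrable 0 π) (hrc.intervalIntegrable π (2*π)),
        h2, hre]
      have key : ∀ J : ℝ, π * ((2*π)⁻¹*(J+J)) = J := by
        intro J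
        have := Real.pi_ne_zero
        field_simp
        ring
      exact key _
    have hg1 : Continuous (fun x : ℝ => (f (Real.exp x : ℝ)).im) := by
      apply Complex.continuous_im.comp
      rw [continuous_iff_continuousAt]
      intro x
      apply ContinuousAt.comp (g := f)
      · exact hc _ (by simp)
      · fun_prop
    have hg2 : Continuous (fun x : ℝ => (f (-(Real.exp x : ℝ))).im) := by
      apply Complex.continuous_im.comp
      rw [continuous_iff_continuousAt]
      intro x
      apply ContinuousAt.comp (g := f)
      · exact hc _ (by simp)
      · fun_prop
    have hb1 : ∀ x : ℝ, 0 ≤ x → |(f (Real.exp x : ℝ)).im| ≤ M + Real.exp x := by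
      intro x _
      have := hM (Real.exp x : ℝ) (by simp)
      refine (Complex.abs_im_le_norm _).trans (this.trans_eq ?_)
      rw [Complex.norm_real, Real.norm_of_nonneg (Real.exp_pos _).le]
    have hb2 : ∀ x : ℝ, 0 ≤ x → |(f (-(Real.exp x : ℝ))).im| ≤ M + Real.exp x := by
      intro x _
      have := hM (-(Real.exp x : ℝ)) (by simp)
      refine (Complex.abs_im_le_norm _).trans (this.trans_eq ?_)
      rw [norm_neg, Complex.norm_real, Real.norm_of_nonneg (Real.exp_pos _).le]
    have hG1 : ∀ x : ℝ, (GG f n x).im = (f (Real.exp x : ℝ)).im * Real.exp (-(n * x)) := by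
      intro x
      unfold GG
      have : Complex.exp (-n * x) = (Real.exp (-(n * x)) : ℝ) := by push_cast; congr 1; ring
      rw [this, Complex.im_mul_ofReal, Complex.ofReal_exp]
    have hG2 : ∀ x : ℝ, (GG f n (x + π * Complex.I)).im = (-1) ^ n * ((f (-(Real.exp x : ℝ))).im * Real.exp (-(n * x))) := by
      intro x
      unfold GG
      have h1 : Complex.exp (-n * (x + π * Complex.I)) = (((-1) ^ n * Real.exp (-(n * x)) : ℝ) : ℂ) := by
        have : (-n * (x + π * Complex.I) : ℂ) = -(n * x) + -(n * (π * Complex.I)) := by ring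
        rw [this, Complex.exp_add, Complex.exp_neg ((n:ℂ) * (π * Complex.I)), Complex.exp_nat_mul, Complex.exp_pi_mul_I]
        push_cast
        rw [← inv_pow, inv_neg, inv_one]; ring
      have h2 : Complex.exp (x + π * Complex.I) = -(Real.exp x : ℝ) := by
        rw [Complex.exp_add, Complex.exp_pi_mul_I]; push_cast; ring
      rw [h1, h2, Complex.im_mul_ofReal]
      ring
    have hz1 : ∀ x : ℝ, x ≤ 0 → (f (Real.exp x : ℝ)).im = 0 := by
      intro x hx
      apply hreal
      rw [abs_of_pos (Real.exp_pos _)]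
      exact Real.exp_le_one_iff.2 hx
    have hz2 : ∀ x : ℝ, x ≤ 0 → (f (-(Real.exp x : ℝ))).im = 0 := by
      intro x hx
      have := hreal (-(Real.exp x)) (by
        rw [abs_neg, abs_of_pos (Real.exp_pos _)]
        exact Real.exp_le_one_iff.2 hx)
      simpa using this
    have cut : ∀ (g : ℝ → ℝ), Continuous g → (∀ x ≤ 0, g x = 0) → ∀ U : ℝ,
        ∫ x in l..U, g x * Real.exp (-(n * x)) = ∫ x in (0:ℝ)..U, g x * Real.exp (-(n * x)) := by
      intro g hg hg0 U
      have hi : ∀ p q, IntervalIntegrable (fun x => g x * Real.exp (-(n * x))) MeasureTheory.volume p q :=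
        fun p q => (by fun_prop : Continuous (fun x => g x * Real.exp (-(n * x)))).intervalIntegrable _ _
      rw [← intervalIntegral.integral_add_adjacent_intervals (hi l 0) (hi 0 U)]
      have : ∫ x in l..0, g x * Real.exp (-(n * x)) = ∫ x in l..0, (0:ℝ) := by
        apply intervalIntegral.integral_congr
        intro x hx
        rw [uIcc_of_le hl0.le] at hx
        simp [hg0 x hx.2]
      rw [this]; simp
    have hlim1 := MeasureTheory.intervalIntegral_tendsto_integral_Ioi 0
      (integrable_aux hM0 hg1 hb1 hn) tendsto_id
    have hlim2 := MeasureTheory.intervalIntegral_tendsto_integral_Ioi 0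
      (integrable_aux hM0 hg2 hb2 hn) tendsto_id
    have hlim := (hlim1.sub (hlim2.const_mul ((-1)^n))).add (edge_tendsto hM hn)
    rw [add_zero] at hlim
    rw [hI]
    refine tendsto_nhds_unique (tendsto_const_nhds.congr' ?_) hlim
    filter_upwards [eventually_ge_atTop l] with U hU
    rw [rect_id hc (fun z hz => hd z (Or.inl hz)) n hU]
    simp only [hG1, hG2, id]
    rw [intervalIntegral.integral_const_mul, cut _ hg1 hz1, cut _ hg2 hz2]

end DSD

open Filter Asymptotics Real Set Topology
namespace DSD

lemma abel_bound {g : ℝ → ℝ} {M nu c : ℝ} (hM0 : 0 ≤ M) (hnu : 0 < nu)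
    (hb : ∀ x, 0 ≤ x → |g x| ≤ M + Real.exp x)
    (hlim : Tendsto (fun u => g u / u ^ nu) (𝓝[>] 0) (𝓝 c)) :
    ∃ A : ℝ, 0 ≤ A ∧ ∀ u, 0 < u → |g u| ≤ A * u ^ nu * Real.exp u := by
  have h1 : ∀ᶠ u in 𝓝[>] (0:ℝ), |g u / u ^ nu| < |c| + 1 :=
    hlim.abs.eventually_lt_const (by linarith)
  rw [eventually_nhdsWithin_iff, Metric.eventually_nhds_iff] at h1
  obtain ⟨δ, hδ, h1⟩ := h1
  have hA : 0 ≤ (M + 1) / δ ^ nu := by positivity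
  refine ⟨(|c| + 1) + (M + 1) / δ ^ nu, by positivity, fun u hu => ?_⟩
  have hup : 0 < u ^ nu := Real.rpow_pos_of_pos hu _
  have he : 1 ≤ Real.exp u := Real.one_le_exp hu.le
  rcases lt_or_ge u δ with h | h
  · have h2 := h1 (y := u) (by rw [Real.dist_eq, sub_zero, abs_of_pos hu]; exact h) hu
    rw [abs_div, abs_of_pos hup, div_lt_iff₀ hup] at h2
    calc |g u| ≤ (|c| + 1) * u ^ nu := h2.le
      _ ≤ ((|c| + 1) + (M + 1) / δ ^ nu) * u ^ nu := mul_le_mul_of_nonneg_right (by linarith) hup.le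
      _ ≤ _ := le_mul_of_one_le_right (by positivity) he
  · have hd : δ ^ nu ≤ u ^ nu := Real.rpow_le_rpow hδ.le h hnu.le
    have hdp : 0 < δ ^ nu := Real.rpow_pos_of_pos hδ _
    calc |g u| ≤ M + Real.exp u := hb u hu.le
      _ ≤ (M + 1) * Real.exp u := by nlinarith
      _ = (M + 1) / δ ^ nu * δ ^ nu * Real.exp u := by field_simp
      _ ≤ (M + 1) / δ ^ nu * u ^ nu * Real.exp u := by gcongr
      _ ≤ _ := by
        gcongr
        have := abs_nonneg c
        linarith

lemma abel {g : ℝ → ℝ} {M nu c : ℝ} (hM0 : 0 ≤ M) (hnu : 0 < nu) (hg : Continuous g)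
    (hb : ∀ x, 0 ≤ x → |g x| ≤ M + Real.exp x)
    (hlim : Tendsto (fun u => g u / u ^ nu) (𝓝[>] 0) (𝓝 c)) :
    Tendsto (fun n : ℕ => (n:ℝ) ^ (1 + nu) * ∫ x in Ioi (0:ℝ), g x * Real.exp (-(n * x))) atTop
      (𝓝 (c * Real.Gamma (1 + nu))) := by
  obtain ⟨A, hA, hAb⟩ := abel_bound hM0 hnu hb hlim
  have e1 : ∀ᶠ n : ℕ in atTop, (∫ v in Ioi (0:ℝ), (n:ℝ) ^ nu * g (v / n) * Real.exp (-v)) =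
      (n:ℝ) ^ (1 + nu) * ∫ x in Ioi (0:ℝ), g x * Real.exp (-(n * x)) := by
    filter_upwards [eventually_ge_atTop 1] with n hn
    have hn0 : (0:ℝ) < n := by positivity
    have h := MeasureTheory.integral_comp_mul_left_Ioi (fun v => g (v / n) * Real.exp (-v)) 0 hn0
    simp only [mul_zero, smul_eq_mul] at h
    have h2 : ∀ x : ℝ, (n:ℝ) * x / n = x := fun x => by field_simp
    simp only [h2] at h
    simp only [mul_assoc]
    rw [MeasureTheory.integral_const_mul, h, Real.rpow_add hn0, Real.rpow_one]
    field_simp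
  refine Tendsto.congr' e1 ?_
  have e2 : c * Real.Gamma (1 + nu) = ∫ v in Ioi (0:ℝ), c * (Real.exp (-v) * v ^ nu) := by
    rw [MeasureTheory.integral_const_mul, Real.Gamma_eq_integral (by linarith)]
    simp
  rw [e2]
  refine MeasureTheory.tendsto_integral_filter_of_dominated_convergence
    (fun v => A * (v ^ nu * Real.exp (-(1/2) * v))) ?_ ?_ ?_ ?_
  · refine Eventually.of_forall fun n => Continuous.aestronglyMeasurable ?_
    fun_prop
  · filter_upwards [eventually_ge_atTop 2] with n hn
    have hn2 : (2:ℝ) ≤ n := by exact_mod_cast hn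
    have hn0 : (0:ℝ) < n := by positivity
    refine (MeasureTheory.ae_restrict_iff' measurableSet_Ioi).2 (Eventually.of_forall fun v hv => ?_)
    have hv : 0 < v := hv
    have h3 := hAb (v / n) (by positivity)
    have hnp : 0 < (n:ℝ) ^ nu := Real.rpow_pos_of_pos hn0 _
    rw [norm_mul, norm_mul, Real.norm_of_nonneg hnp.le, Real.norm_eq_abs, Real.norm_of_nonneg (Real.exp_pos _).le]
    rw [Real.div_rpow hv.le hn0.le] at h3
    calc (n:ℝ) ^ nu * |g (v / n)| * Real.exp (-v) ≤
        (n:ℝ) ^ nu * (A * (v ^ nu / n ^ nu) * Real.exp (v / n)) * Real.exp (-v) := by gcongr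
      _ = A * (v ^ nu * (Real.exp (v / n) * Real.exp (-v))) := by field_simp
      _ ≤ A * (v ^ nu * Real.exp (-(1/2) * v)) := by
        rw [← Real.exp_add]
        gcongr
        have : v / n ≤ v / 2 := by gcongr
        linarith
  · have h4 := integrableOn_rpow_mul_exp_neg_mul_rpow (s := nu) (p := 1) (b := 1/2) (by linarith) (by norm_num) (by norm_num)
    simp only [Real.rpow_one] at h4
    exact h4.const_mul A
  · refine (MeasureTheory.ae_restrict_iff' measurableSet_Ioi).2 (Eventually.of_forall fun v hv => ?_)
    have hv : 0 < v := hv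
    have t1 : Tendsto (fun n : ℕ => v / (n:ℝ)) atTop (𝓝[>] 0) := by
      rw [tendsto_nhdsWithin_iff]
      refine ⟨tendsto_const_div_atTop_nhds_zero_nat v, ?_⟩
      filter_upwards [eventually_ge_atTop 1] with n hn
      have hn0 : (0:ℝ) < n := by positivity
      exact div_pos hv hn0
    have t2 := (hlim.comp t1).mul_const (Real.exp (-v) * v ^ nu)
    refine t2.congr' ?_
    filter_upwards [eventually_ge_atTop 1] with n hn
    have hn0 : (0:ℝ) < n := by positivity
    have hnp : 0 < (n:ℝ) ^ nu := Real.rpow_pos_of_pos hn0 _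
    have hvp : 0 < v ^ nu := Real.rpow_pos_of_pos hv _
    simp only [Function.comp]
    rw [Real.div_rpow hv.le hn0.le]
    field_simp

/-- binomial coefficients of `(1-t)^nu` -/
noncomputable def bb (nu : ℝ) (n : ℕ) : ℝ := (∏ j ∈ Finset.range n, ((j:ℝ) - nu)) / n.factorial

lemma bb_succ (nu : ℝ) (n : ℕ) : bb nu (n+1) * (n + 1) = bb nu n * (n - nu) := by
  unfold bb
  rw [Finset.prod_range_succ, Nat.factorial_succ]
  have : (n.factorial : ℝ) ≠ 0 := by exact_mod_cast n.factorial_ne_zero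
  push_cast
  field_simp

lemma bb_neg {nu : ℝ} (h0 : 0 < nu) (h1 : nu < 1) {n : ℕ} (hn : 1 ≤ n) : bb nu n < 0 := by
  induction n, hn using Nat.le_induction with
  | base => simp [bb]; exact h0
  | succ n hn ih =>
    have h2 := bb_succ nu n
    have hn1 : (1:ℝ) ≤ n := by exact_mod_cast hn
    by_contra hcon
    push Not at hcon
    nlinarith [mul_nonneg hcon (by linarith : (0:ℝ) ≤ n + 1)]

lemma choose_bb (nu : ℝ) (n : ℕ) : Ring.choose nu n * (-1) ^ n = bb nu n := by
  induction n with
  | zero => simp [bb]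
  | succ n ih =>
    have h2 := bb_succ nu n
    have h3 : Ring.choose nu (n+1) * (n + 1) = Ring.choose nu n * (nu - n) := by
      rw [Ring.choose_eq_smul, Ring.choose_eq_smul, descPochhammer_succ_right, Polynomial.smeval_mul]
      simp [Nat.factorial_succ, Polynomial.smeval_sub, Polynomial.smeval_natCast]
      have : (n.factorial : ℝ) ≠ 0 := by exact_mod_cast n.factorial_ne_zero
      field_simp
    have hn1 : (0:ℝ) < n + 1 := by positivity
    have : (Ring.choose nu (n+1) * (-1) ^ (n+1)) * (n+1) = bb nu (n+1) * (n+1) := by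
      rw [h2, ← ih, pow_succ]
      linear_combination (-(-1)^n) * h3
    exact mul_right_cancel₀ hn1.ne' this

lemma bb_hasSum (nu : ℝ) {t : ℝ} (ht : |t| < 1) : HasSum (fun n => bb nu n * t ^ n) ((1 - t) ^ nu) := by
  have h := (Real.one_add_rpow_hasFPowerSeriesOnBall_zero (a := nu)).hasSum (y := -t) (by
    simpa [enorm_eq_nnnorm, ← NNReal.coe_lt_one] using ht)
  simp only [binomialSeries_apply, List.ofFn_const, List.prod_replicate, smul_eq_mul, zero_add] at h
  rw [sub_eq_add_neg]
  refine h.congr_fun ?_ |> fun h => h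
  intro n
  rw [← choose_bb, neg_pow]; ring

lemma bb_tendsto {nu : ℝ} (h0 : 0 < nu) (h1 : nu < 1) :
    Tendsto (fun n : ℕ => bb nu n * (n:ℝ) ^ (1 + nu)) atTop (𝓝 (Real.Gamma (-nu))⁻¹) := by
  have hG : Real.Gamma (-nu) ≠ 0 := Real.Gamma_ne_zero fun m hm => by
    rw [neg_inj] at hm
    rcases Nat.eq_zero_or_pos m with rfl | hmp
    · simp at hm; linarith
    · have : (1:ℝ) ≤ m := by exact_mod_cast hmp
      linarith
  have h := (Real.GammaSeq_tendsto_Gamma (-nu)).inv₀ hG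
  have h2 : Tendsto (fun n : ℕ => (n:ℝ) / (n - nu)) atTop (𝓝 1) := by
    have := tendsto_natCast_div_add_atTop (𝕜 := ℝ) (-nu)
    simpa [sub_eq_add_neg] using this
  have h3 := h.mul h2
  rw [mul_one] at h3
  refine h3.congr' ?_
  filter_upwards [eventually_ge_atTop 1] with n hn
  have hn1 : (1:ℝ) ≤ n := by exact_mod_cast hn
  have hn0 : (0:ℝ) < n := by positivity
  have hp : (n:ℝ) - nu ≠ 0 := by linarith
  rw [Real.GammaSeq, Finset.prod_range_succ, bb, Real.rpow_neg hn0.le, Real.rpow_add hn0, Real.rpow_one]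
  have hf : (n.factorial : ℝ) ≠ 0 := by exact_mod_cast n.factorial_ne_zero
  have hpr : ∀ j : ℕ, -nu + (j:ℝ) = j - nu := fun j => by ring
  simp only [hpr]
  have hnp : 0 < (n:ℝ) ^ nu := Real.rpow_pos_of_pos hn0 _
  field_simp

lemma gamma_ratio (s : ℝ) (hs : 0 < s) :
    Tendsto (fun k : ℕ => (k.factorial : ℝ) * (k:ℝ) ^ s / Real.Gamma (k + 1 + s)) atTop (𝓝 1) := by
  have hG := (Real.Gamma_pos_of_pos hs).ne'
  have h := (Real.GammaSeq_tendsto_Gamma s).div_const (Real.Gamma s)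
  rw [div_self hG] at h
  refine h.congr fun k => ?_
  have hp : ∀ n : ℕ, (∏ j ∈ Finset.range n, (s + j)) * Real.Gamma s = Real.Gamma (n + s) := by
    intro n
    induction n with
    | zero => simp
    | succ n ih =>
      rw [Finset.prod_range_succ, mul_right_comm, ih, mul_comm, show s + (n:ℝ) = n + s by ring,
        ← Real.Gamma_add_one (by positivity)]
      congr 1; push_cast; ring
  have := hp (k+1)
  push_cast at this
  rw [Real.GammaSeq, div_div, this]
  ring

end DSD

open Filter Asymptotics Real Set Topology
namespace DSD

open Polynomial in
/-- polynomial factors of the iterated derivatives of `(1-t^2)^e` -/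
noncomputable def qq (e : ℝ) : ℕ → Polynomial ℝ
  | 0 => 1
  | j + 1 => (1 - X ^ 2) * derivative (qq e j) - C (2 * (e - j)) * X * qq e j

/-- the `j`-th derivative of `(1-t^2)^e` -/
noncomputable def DD (e : ℝ) (j : ℕ) (t : ℝ) : ℝ := (1 - t ^ 2) ^ (e - j) * (qq e j).eval t

lemma one_sub_sq_pos {t : ℝ} (ht : t ∈ Ioo (-1:ℝ) 1) : 0 < 1 - t ^ 2 := by
  nlinarith [ht.1, ht.2]

lemma DD_hasDerivAt (e : ℝ) (j : ℕ) {t : ℝ} (ht : t ∈ Ioo (-1:ℝ) 1) :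
    HasDerivAt (DD e j) (DD e (j+1) t) t := by
  have hp := one_sub_sq_pos ht
  have h1 : HasDerivAt (fun s : ℝ => 1 - s ^ 2) (-(2 * t)) t := by
    simpa using ((hasDerivAt_id t).pow 2).const_sub 1
  have h2 := h1.rpow_const (p := e - j) (Or.inl hp.ne')
  have h3 := h2.mul ((qq e j).hasDerivAt t)
  convert! h3 using 1
  unfold DD
  simp only [qq, Polynomial.eval_sub, Polynomial.eval_mul, Polynomial.eval_one, Polynomial.eval_pow,
    Polynomial.eval_X, Polynomial.eval_C]
  have e1 : (1 - t^2) ^ (e - j) = (1 - t^2) ^ (e - j - 1) * (1 - t^2) := by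
    rw [← Real.rpow_add_one hp.ne']; congr 1; ring
  have e2 : e - ((j+1 : ℕ) : ℝ) = e - j - 1 := by push_cast; ring
  rw [e1, e2]
  ring

lemma iter_DD (e : ℝ) (j : ℕ) {t : ℝ} (ht : t ∈ Ioo (-1:ℝ) 1) :
    iteratedDeriv j (fun s : ℝ => (1 - s ^ 2) ^ e) t = DD e j t := by
  induction j generalizing t with
  | zero => simp [DD, qq]
  | succ j ih =>
    rw [iteratedDeriv_succ]
    have : iteratedDeriv j (fun s : ℝ => (1 - s ^ 2) ^ e) =ᶠ[𝓝 t] DD e j := by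
      filter_upwards [isOpen_Ioo.mem_nhds ht] with s hs using ih hs
    rw [this.deriv_eq]
    exact (DD_hasDerivAt e j ht).deriv

lemma DD_continuous {e : ℝ} {j : ℕ} (h : (j:ℝ) ≤ e) : Continuous (DD e j) := by
  unfold DD
  have h1 : Continuous (fun t : ℝ => (1 - t ^ 2) ^ (e - j)) :=
    Continuous.rpow_const (by fun_prop) fun t => Or.inr (by linarith)
  have h2 : Continuous (fun t : ℝ => (qq e j).eval t) := (qq e j).continuous
  exact h1.mul h2

/-- comparison: on the open interval -/
lemma fD_eq {a : ℝ} {f g : ℝ → ℝ} {i j : ℕ} {t : ℝ} (ht : t ∈ Ioo (-1:ℝ) 1)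
    (hfg : f t * (1 - t) ^ i = g t) :
    f t * DD ((i + j : ℕ) + a) j t = g t * (1 - t) ^ a * (1 + t) ^ (a + i) * (qq ((i + j : ℕ) + a) j).eval t := by
  have h1 : 0 < 1 - t := by linarith [ht.2]
  have h2 : 0 < 1 + t := by linarith [ht.1]
  unfold DD
  have e1 : ((i + j : ℕ) : ℝ) + a - j = a + i := by push_cast; ring
  rw [e1, show 1 - t ^ 2 = (1 - t) * (1 + t) by ring, Real.mul_rpow h1.le h2.le, Real.rpow_add h1,
    Real.rpow_natCast, ← hfg]
  ring

lemma cont_aux {a b : ℝ} (ha : 0 ≤ a) (hb : 0 ≤ b) {g : ℝ → ℝ} (hg : ContinuousOn g (Icc (-1) 1)) (q : Polynomial ℝ) :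
    ContinuousOn (fun t => g t * (1 - t) ^ a * (1 + t) ^ b * q.eval t) (Icc (-1) 1) := by
  have h1 : Continuous (fun t : ℝ => (1 - t) ^ a) :=
    Continuous.rpow_const (by fun_prop) fun t => Or.inr ha
  have h2 : Continuous (fun t : ℝ => (1 + t) ^ b) :=
    Continuous.rpow_const (by fun_prop) fun t => Or.inr hb
  exact ((hg.mul h1.continuousOn).mul h2.continuousOn).mul q.continuous.continuousOn

lemma int_aux {a : ℝ} (ha : 0 ≤ a) {f g : ℝ → ℝ} {i j : ℕ} (hg : ContinuousOn g (Icc (-1) 1))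
    (hfg : ∀ t ∈ Ioo (-1:ℝ) 1, f t * (1 - t) ^ i = g t) :
    IntervalIntegrable (fun t => f t * DD ((i + j : ℕ) + a) j t) MeasureTheory.volume (-1) 1 := by
  have hc := cont_aux ha (by positivity : 0 ≤ a + i) hg (qq ((i + j : ℕ) + a) j)
  have h1 := ContinuousOn.intervalIntegrable_of_Icc (by norm_num : (-1:ℝ) ≤ 1) hc
    (μ := MeasureTheory.volume)
  rw [intervalIntegrable_iff_integrableOn_Ioo_of_le (by norm_num)] at h1 ⊢
  refine h1.congr_fun (fun t ht => ?_) measurableSet_Ioo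
  exact (fD_eq ht (hfg t ht)).symm

lemma ibp_step {a : ℝ} (ha : 0 ≤ a) {f f' g g' : ℝ → ℝ} {i j : ℕ}
    (hg : ContinuousOn g (Icc (-1) 1)) (hg' : ContinuousOn g' (Icc (-1) 1))
    (hfg : ∀ t ∈ Ioo (-1:ℝ) 1, f t * (1 - t) ^ i = g t)
    (hfg' : ∀ t ∈ Ioo (-1:ℝ) 1, f' t * (1 - t) ^ (i+1) = g' t)
    (hd : ∀ t ∈ Ioo (-1:ℝ) 1, HasDerivAt f (f' t) t) :
    ∫ t in (-1:ℝ)..1, f t * DD ((i + (j+1) : ℕ) + a) (j+1) t =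
      - ∫ t in (-1:ℝ)..1, f' t * DD ((i + (j+1) : ℕ) + a) j t := by
  have I1 := int_aux (j := j+1) ha hg hfg
  have I2 := int_aux (j := j) ha hg' hfg'
  rw [show i + 1 + j = i + (j+1) by ring] at I2
  set e : ℝ := (i + (j+1) : ℕ) + a with he
  have hc := cont_aux (by linarith : 0 ≤ a + 1) (by positivity : 0 ≤ a + 1 + i) hg (qq e j)
  have heq : ∀ t ∈ Ioo (-1:ℝ) 1, f t * DD e j t = g t * (1 - t) ^ (a+1) * (1 + t) ^ (a + 1 + i) * (qq e j).eval t := by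
    intro t ht
    have := fD_eq (a := a + 1) (j := j) ht (hfg t ht)
    rw [show ((i + j : ℕ) : ℝ) + (a + 1) = e by rw [he]; push_cast; ring] at this
    exact this
  have key := intervalIntegral.integral_eq_sub_of_hasDerivAt_of_le (by norm_num : (-1:ℝ) ≤ 1) hc
    (f' := fun t => f' t * DD e j t + f t * DD e (j+1) t) (fun t ht => by
      refine ((hd t ht).mul (DD_hasDerivAt e j ht)).congr_of_eventuallyEq ?_
      filter_upwards [isOpen_Ioo.mem_nhds ht] with s hs using (heq s hs).symm) (I2.add I1)
  rw [intervalIntegral.integral_add I2 I1] at key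
  have z1 : (1 - (1:ℝ)) ^ (a + 1) = 0 := by rw [sub_self, Real.zero_rpow (by linarith)]
  have z2 : (1 + (-1:ℝ)) ^ (a + 1 + i) = 0 := by rw [add_neg_cancel, Real.zero_rpow (by positivity)]
  rw [z1, z2] at key
  simp only [mul_zero, zero_mul, sub_zero] at key
  linarith

lemma ibp {a : ℝ} (ha : 0 ≤ a) (f g : ℕ → ℝ → ℝ)
    (hg : ∀ i, ContinuousOn (g i) (Icc (-1) 1))
    (hfg : ∀ i, ∀ t ∈ Ioo (-1:ℝ) 1, f i t * (1 - t) ^ i = g i t)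
    (hd : ∀ i, ∀ t ∈ Ioo (-1:ℝ) 1, HasDerivAt (f i) (f (i+1) t) t) (j i : ℕ) :
    ∫ t in (-1:ℝ)..1, f i t * DD ((i + j : ℕ) + a) j t =
      (-1) ^ j * ∫ t in (-1:ℝ)..1, f (i + j) t * (1 - t ^ 2) ^ ((i + j : ℕ) + a) := by
  induction j generalizing i with
  | zero => simp [DD, qq]
  | succ j ih =>
    rw [ibp_step ha (hg i) (hg (i+1)) (hfg i) (hfg (i+1)) (hd i)]
    have := ih (i+1)
    rw [show i + 1 + j = i + (j+1) by ring] at this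
    rw [this, pow_succ]
    ring

lemma moment_nonneg (m : ℕ) (e : ℝ) : 0 ≤ ∫ t in (-1:ℝ)..1, t ^ m * (1 - t ^ 2) ^ e := by
  rcases Nat.even_or_odd m with h | h
  · apply intervalIntegral.integral_nonneg (by norm_num)
    intro t ht
    have : 0 ≤ 1 - t ^ 2 := by nlinarith [ht.1, ht.2]
    exact mul_nonneg (h.pow_nonneg t) (Real.rpow_nonneg this _)
  · have h1 := intervalIntegral.integral_comp_neg (a := -1) (b := 1) (fun t : ℝ => t ^ m * (1 - t ^ 2) ^ e)
    simp only [h.neg_pow, neg_mul, even_two.neg_pow, intervalIntegral.integral_neg, neg_neg] at h1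
    linarith

/-- normalising constant -/
noncomputable def cc (a : ℝ) (k : ℕ) : ℝ := (-1/2) ^ k * (Real.Gamma (a+1) / Real.Gamma (k + (a + 1)))

/-- moments -/
noncomputable def mom (a : ℝ) (k n : ℕ) : ℝ := cc a k * ∫ t in (-1:ℝ)..1, t ^ n * DD (k + a) k t

lemma mom_eq {a : ℝ} (ha : 0 ≤ a) (k n : ℕ) :
    mom a k n = (1/2) ^ k * (Real.Gamma (a+1) / Real.Gamma (k + (a + 1))) *
      (n.descFactorial k * ∫ t in (-1:ℝ)..1, t ^ (n - k) * (1 - t ^ 2) ^ (k + a)) := by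
  have h := ibp ha (fun i t => n.descFactorial i * t ^ (n - i))
    (fun i t => n.descFactorial i * t ^ (n - i) * (1 - t) ^ i) (fun i => by fun_prop)
    (fun i t _ => rfl) (fun i t _ => by
      have h1 := (hasDerivAt_pow (n - i) t).const_mul (n.descFactorial i : ℝ)
      refine h1.congr_deriv ?_
      rw [Nat.descFactorial_succ]
      push_cast
      rw [show n - (i+1) = n - i - 1 by omega]
      ring) k 0
  simp only [Nat.descFactorial_zero, Nat.cast_one, one_mul, Nat.sub_zero, zero_add, mul_assoc,
    intervalIntegral.integral_const_mul] at h
  rw [mom, h, cc, show (-1/2 : ℝ) = (-1) * (1/2) by ring, mul_pow]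
  have : ((-1:ℝ)^k) * (-1)^k = 1 := by rw [← mul_pow]; norm_num
  linear_combination ((1/2:ℝ) ^ k * (Real.Gamma (a+1) / Real.Gamma (k + (a + 1))) *
      (n.descFactorial k * ∫ t in (-1:ℝ)..1, t ^ (n - k) * (1 - t ^ 2) ^ (k + a))) * this

lemma mom_nonneg {a : ℝ} (ha : 0 ≤ a) (k n : ℕ) : 0 ≤ mom a k n := by
  rw [mom_eq ha]
  have h1 := Real.Gamma_pos_of_pos (by linarith : 0 < a + 1)
  have h2 := Real.Gamma_pos_of_pos (by positivity : 0 < (k:ℝ) + (a + 1))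
  have h3 := moment_nonneg (n - k) ((k:ℝ) + a)
  positivity

lemma mom_zero {a : ℝ} (ha : 0 ≤ a) {k n : ℕ} (h : n < k) : mom a k n = 0 := by
  rw [mom_eq ha, Nat.descFactorial_eq_zero_iff_lt.2 h]; simp

lemma beta_int {p r : ℝ} (hp : 0 ≤ p) (hr : 0 ≤ r) :
    ∫ t in (-1:ℝ)..1, (1 - t) ^ p * (1 + t) ^ r =
      2 ^ (p + r + 1) * (Real.Gamma (p + 1) * Real.Gamma (r + 1) / Real.Gamma (p + r + 2)) := by
  have h1 := intervalIntegral.integral_comp_sub_left (a := -1) (b := 1) (fun x : ℝ => x ^ p * (2 - x) ^ r) 1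
  have h2 : ∀ t : ℝ, 2 - (1 - t) = 1 + t := fun t => by ring
  simp only [h2] at h1
  rw [h1, show (1:ℝ) - 1 = 0 by ring, show (1:ℝ) - -1 = 2 by ring]
  have h3 := Complex.betaIntegral_scaled ((p + 1 : ℝ) : ℂ) ((r + 1 : ℝ) : ℂ) (a := 2) (by norm_num)
  rw [Complex.betaIntegral_eq_Gamma_mul_div _ _ (by simp; linarith) (by simp; linarith),
    ← Complex.ofReal_add, Complex.Gamma_ofReal, Complex.Gamma_ofReal, Complex.Gamma_ofReal] at h3
  have h4 : ∫ x in (0:ℝ)..2, (x : ℂ) ^ (((p + 1 : ℝ) : ℂ) - 1) * (((2:ℝ) : ℂ) - x) ^ (((r + 1 : ℝ) : ℂ) - 1) =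
      ((∫ x in (0:ℝ)..2, x ^ p * (2 - x) ^ r : ℝ) : ℂ) := by
    rw [← intervalIntegral.integral_ofReal]
    apply intervalIntegral.integral_congr
    intro x hx
    rw [uIcc_of_le (by norm_num)] at hx
    simp only []
    rw [Complex.ofReal_mul, Complex.ofReal_cpow hx.1, Complex.ofReal_cpow (by linarith [hx.2])]
    push_cast
    congr 2 <;> ring
  rw [h4] at h3
  have h5 : ((2:ℝ):ℂ) ^ (((p + 1 + (r + 1) : ℝ) : ℂ) - 1) = ((2 ^ (p + r + 1) : ℝ) : ℂ) := by
    rw [Complex.ofReal_cpow (by norm_num)]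
    push_cast
    congr 1; ring
  rw [h5] at h3
  rw [show p + 1 + (r + 1) = p + r + 2 by ring] at h3
  exact_mod_cast h3

/-- coefficient of `(1-t)^nu` -/
noncomputable def gcoef (a nu : ℝ) (k : ℕ) : ℝ := cc a k * ∫ t in (-1:ℝ)..1, (1 - t) ^ nu * DD (k + a) k t

lemma gcoef_eq {a nu : ℝ} (ha : 0 ≤ a) (hnu : 0 < nu) (k : ℕ) :
    gcoef a nu k = bb nu k * k.factorial * (2 ^ (nu + 2 * a + 1) * Real.Gamma (a + 1) * Real.Gamma (nu + a + 1)) /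
      Real.Gamma (k + 1 + (nu + 2 * a + 1)) := by
  have h := ibp ha (fun i t => (∏ j ∈ Finset.range i, ((j:ℝ) - nu)) * (1 - t) ^ (nu - i))
    (fun i t => (∏ j ∈ Finset.range i, ((j:ℝ) - nu)) * (1 - t) ^ nu)
    (fun i => by
      have : Continuous (fun t : ℝ => (1 - t) ^ nu) :=
        Continuous.rpow_const (by fun_prop) fun t => Or.inr hnu.le
      exact (continuous_const.mul this).continuousOn)
    (fun i t ht => by
      have h1 : 0 < 1 - t := by linarith [ht.2]
      rw [mul_assoc, ← Real.rpow_natCast, ← Real.rpow_add h1]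
      congr 2; ring)
    (fun i t ht => by
      have h1 : 0 < 1 - t := by linarith [ht.2]
      have h2 : HasDerivAt (fun s : ℝ => 1 - s) (-1) t := by simpa using (hasDerivAt_id t).const_sub 1
      have h3 := (h2.rpow_const (p := nu - i) (Or.inl h1.ne')).const_mul (∏ j ∈ Finset.range i, ((j:ℝ) - nu))
      refine h3.congr_deriv ?_
      rw [Finset.prod_range_succ, show nu - ((i+1:ℕ):ℝ) = nu - i - 1 by push_cast; ring]
      ring) k 0
  simp only [Finset.range_zero, Finset.prod_empty, CharP.cast_eq_zero, sub_zero, one_mul, zero_add, mul_assoc,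
    intervalIntegral.integral_const_mul] at h
  have e1 : ∫ t in (-1:ℝ)..1, (1 - t) ^ (nu - k) * (1 - t ^ 2) ^ (k + a) =
      ∫ t in (-1:ℝ)..1, (1 - t) ^ (nu + a) * (1 + t) ^ (k + a) := by
    rw [intervalIntegral.integral_of_le (by norm_num), intervalIntegral.integral_of_le (by norm_num),
      MeasureTheory.integral_Ioc_eq_integral_Ioo, MeasureTheory.integral_Ioc_eq_integral_Ioo]
    apply MeasureTheory.setIntegral_congr_fun measurableSet_Ioo
    intro t ht
    have h1 : 0 < 1 - t := by linarith [ht.2]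
    have h2 : 0 < 1 + t := by linarith [ht.1]
    simp only []
    rw [show 1 - t ^ 2 = (1 - t) * (1 + t) by ring, Real.mul_rpow h1.le h2.le, ← mul_assoc, ← Real.rpow_add h1]
    congr 2; ring
  rw [e1, beta_int (by linarith) (by positivity)] at h
  rw [gcoef, h, cc, bb, show (-1/2 : ℝ) = (-1) * (1/2) by ring, mul_pow]
  have hs : ((-1:ℝ)^k) * (-1)^k = 1 := by rw [← mul_pow]; norm_num
  have e2 : (2:ℝ) ^ (nu + a + (k + a) + 1) = 2 ^ (nu + 2 * a + 1) * 2 ^ k := by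
    rw [← Real.rpow_natCast, ← Real.rpow_add (by norm_num)]; congr 1; ring
  have h3 : ((1:ℝ)/2)^k * 2^k = 1 := by rw [← mul_pow]; norm_num
  have hf : (k.factorial : ℝ) ≠ 0 := by exact_mod_cast k.factorial_ne_zero
  have hG := (Real.Gamma_pos_of_pos (by positivity : 0 < (k:ℝ) + (a + 1))).ne'
  have hG2 := (Real.Gamma_pos_of_pos (by positivity : 0 < (k:ℝ) + 1 + (nu + 2 * a + 1))).ne'
  rw [e2, show nu + a + (k + a) + 2 = (k:ℝ) + 1 + (nu + 2 * a + 1) by ring, show (k:ℝ) + a + 1 = k + (a+1) by ring]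
  field_simp
  linear_combination (∏ j ∈ Finset.range k, ((j:ℝ) - nu)) * (((1:ℝ)/2)^k * 2^k * hs + h3)

lemma gcoef_tendsto {a nu : ℝ} (ha : 0 ≤ a) (h0 : 0 < nu) (h1 : nu < 1) :
    ∃ C : ℝ, C ≠ 0 ∧ Tendsto (fun k : ℕ => gcoef a nu k * (k:ℝ) ^ (2 * nu + 2 * a + 2)) atTop (𝓝 C) := by
  have hG : Real.Gamma (-nu) ≠ 0 := Real.Gamma_ne_zero fun m hm => by
    rw [neg_inj] at hm
    rcases Nat.eq_zero_or_pos m with rfl | hmp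
    · simp at hm; linarith
    · have : (1:ℝ) ≤ m := by exact_mod_cast hmp
      linarith
  have hG1 := (Real.Gamma_pos_of_pos (by linarith : 0 < a + 1))
  have hG2 := (Real.Gamma_pos_of_pos (by linarith : 0 < nu + a + 1))
  have hK : (0:ℝ) < (2 ^ (nu + 2 * a + 1) * Real.Gamma (a + 1) * Real.Gamma (nu + a + 1)) := by positivity
  refine ⟨(Real.Gamma (-nu))⁻¹ * 1 * (2 ^ (nu + 2 * a + 1) * Real.Gamma (a + 1) * Real.Gamma (nu + a + 1)),
    mul_ne_zero (by simpa using hG) hK.ne', ?_⟩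
  refine (((bb_tendsto h0 h1).mul (gamma_ratio (nu + 2 * a + 1) (by linarith))).mul_const _).congr' ?_
  filter_upwards [eventually_ge_atTop 1] with k hk
  have hk0 : (0:ℝ) < k := by positivity
  have e1 : (k:ℝ) ^ (2 * nu + 2 * a + 2) = (k:ℝ) ^ (1 + nu) * (k:ℝ) ^ (nu + 2 * a + 1) := by
    rw [← Real.rpow_add hk0]; congr 1; ring
  rw [gcoef_eq ha h0, e1]
  ring

end DSD

namespace DSD

lemma series_coef {a : ℝ} (ha : 0 ≤ a) (k : ℕ) {u : ℕ → ℝ} {f : ℝ → ℝ} (hu : Summable (fun n => |u n|))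
    (hf : ∀ t : ℝ, |t| < 1 → HasSum (fun n => u n * t ^ n) (f t)) :
    HasSum (fun n => u n * mom a k n) (cc a k * ∫ t in (-1:ℝ)..1, f t * DD (k + a) k t) := by
  have hDc : Continuous (DD (k + a) k) := DD_continuous (by linarith)
  obtain ⟨B, hB⟩ := isCompact_Icc.exists_bound_of_continuousOn (s := Icc (-1:ℝ) 1) hDc.continuousOn
  have h1 : HasSum (fun n => ∫ t in (-1:ℝ)..1, u n * t ^ n * DD (k + a) k t)
      (∫ t in (-1:ℝ)..1, f t * DD (k + a) k t) := by
    refine intervalIntegral.hasSum_integral_of_dominated_convergence (fun n _ => |u n| * B) ?_ ?_ ?_ ?_ ?_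
    · intro n
      apply Continuous.aestronglyMeasurable
      fun_prop
    · intro n
      refine Eventually.of_forall fun t ht => ?_
      rw [uIoc_of_le (by norm_num)] at ht
      rw [norm_mul, norm_mul, Real.norm_eq_abs, norm_pow, Real.norm_eq_abs t]
      have h2 := hB t ⟨ht.1.le, ht.2⟩
      have h3 : |t| ^ n ≤ 1 := pow_le_one₀ (abs_nonneg _) (abs_le.2 ⟨ht.1.le, ht.2⟩)
      calc |u n| * |t| ^ n * ‖DD (k + a) k t‖ ≤ |u n| * 1 * B := by gcongr
        _ = |u n| * B := by ring
    · exact Eventually.of_forall fun t _ => hu.mul_right B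
    · exact intervalIntegrable_const
    · have : ∀ᵐ t : ℝ ∂MeasureTheory.volume, t ≠ 1 := by
        simp [MeasureTheory.ae_iff]
      filter_upwards [this] with t ht1 ht
      rw [uIoc_of_le (by norm_num)] at ht
      exact (hf t (abs_lt.2 ⟨ht.1, lt_of_le_of_ne ht.2 ht1⟩)).mul_right _
  refine (h1.mul_left (cc a k)).congr_fun ?_ |> fun h => h
  intro n
  simp only [mul_assoc, intervalIntegral.integral_const_mul, mom]
  ring

lemma summable_of_decay {u : ℕ → ℝ} {nu c : ℝ} (hnu : 0 < nu)
    (h : Tendsto (fun n : ℕ => u n * (n:ℝ) ^ (1 + nu)) atTop (𝓝 c)) : Summable (fun n => |u n|) := by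
  have h1 : Summable (fun n : ℕ => (n:ℝ) ^ (-(1 + nu))) := Real.summable_nat_rpow.2 (by linarith)
  refine (summable_of_isBigO_nat h1 (f := u) ?_).abs
  have h2 := (h.isBigO_one ℝ).mul (isBigO_refl (fun n : ℕ => (n:ℝ) ^ (-(1 + nu))) atTop)
  refine h2.congr' ?_ ?_
  · filter_upwards [eventually_ge_atTop 1] with n hn
    have hn0 : (0:ℝ) < n := by positivity
    rw [mul_assoc, ← Real.rpow_add hn0]; simp
  · exact Eventually.of_forall fun n => by simp

lemma compare {a nu c : ℝ} (ha : 0 ≤ a) (h0 : 0 < nu) (h1 : nu < 1) (hc : c ≠ 0) {u : ℕ → ℝ} {f : ℝ → ℝ}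
    (hu : Tendsto (fun n : ℕ => u n * (n:ℝ) ^ (1 + nu)) atTop (𝓝 c))
    (hf : ∀ t : ℝ, |t| < 1 → HasSum (fun n => u n * t ^ n) (f t)) :
    ∃ C : ℝ, C ≠ 0 ∧ Tendsto (fun k : ℕ => (cc a k * ∫ t in (-1:ℝ)..1, f t * DD (k + a) k t) *
      (k:ℝ) ^ (2 * nu + 2 * a + 2)) atTop (𝓝 C) := by
  have hb := bb_tendsto h0 h1
  have hG : Real.Gamma (-nu) ≠ 0 := Real.Gamma_ne_zero fun m hm => by
    rw [neg_inj] at hm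
    rcases Nat.eq_zero_or_pos m with rfl | hmp
    · simp at hm; linarith
    · have : (1:ℝ) ≤ m := by exact_mod_cast hmp
      linarith
  have hsu := summable_of_decay h0 hu
  have hsb := summable_of_decay h0 hb
  obtain ⟨C, hC, hCt⟩ := gcoef_tendsto ha h0 h1
  set A : ℝ := c / (Real.Gamma (-nu))⁻¹ with hA
  have hA0 : A ≠ 0 := div_ne_zero hc (by simpa using hG)
  have hrat : Tendsto (fun n => u n / bb nu n) atTop (𝓝 A) := by
    refine (hu.div hb (by simpa using hG)).congr' ?_
    filter_upwards [eventually_ge_atTop 1] with n hn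
    have hn0 : (0:ℝ) < n := by positivity
    have := Real.rpow_pos_of_pos hn0 (1 + nu)
    exact mul_div_mul_right _ _ this.ne'
  refine ⟨A * C, mul_ne_zero hA0 hC, ?_⟩
  have hlo : (fun k : ℕ => (cc a k * ∫ t in (-1:ℝ)..1, f t * DD (k + a) k t) - A * gcoef a nu k) =o[atTop]
      (fun k => gcoef a nu k) := by
    rw [isLittleO_iff]
    intro ε hε
    have hev : ∀ᶠ n in atTop, |u n / bb nu n - A| < ε := by
      have := (Metric.tendsto_nhds.1 hrat) ε hε
      simpa [Real.dist_eq] using this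
    obtain ⟨N, hN⟩ := eventually_atTop.1 hev
    filter_upwards [eventually_ge_atTop (max N 1)] with k hk
    have hkN := (le_max_left N 1).trans hk
    have hk1 := (le_max_right N 1).trans hk
    have s1 := series_coef ha k hsu hf
    have s2 : HasSum (fun n => bb nu n * mom a k n) (gcoef a nu k) :=
      series_coef ha k hsb (fun t ht => bb_hasSum nu ht)
    have hle : ∀ n, ‖u n * mom a k n - A * (bb nu n * mom a k n)‖ ≤ -ε * (bb nu n * mom a k n) := by
      intro n
      rcases lt_or_ge n k with h | h
      · simp [mom_zero ha h]
      · have hm := mom_nonneg ha k n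
        have hbn := bb_neg h0 h1 (hk1.trans h)
        have h3 := hN n (hkN.trans h)
        have h4 : u n * mom a k n - A * (bb nu n * mom a k n) = (u n / bb nu n - A) * (bb nu n * mom a k n) := by
          have := hbn.ne
          field_simp
        rw [h4, norm_mul, norm_mul, Real.norm_eq_abs, Real.norm_of_nonpos hbn.le, Real.norm_of_nonneg hm]
        have : 0 ≤ -bb nu n * mom a k n := mul_nonneg (by linarith) hm
        nlinarith
    have hd := s1.sub (s2.mul_left A)
    have he := s2.mul_left (-ε)
    have h5 : ‖(cc a k * ∫ t in (-1:ℝ)..1, f t * DD (k + a) k t) - A * gcoef a nu k‖ ≤ -ε * gcoef a nu k :=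
      hd.norm_le_of_bounded he hle
    refine h5.trans ?_
    rw [Real.norm_eq_abs]
    nlinarith [neg_abs_le (gcoef a nu k)]
  have hlo2 := hlo.mul_isBigO (isBigO_refl (fun k : ℕ => (k:ℝ) ^ (2 * nu + 2 * a + 2)) atTop)
  have hlo3 := (isLittleO_one_iff ℝ).1 (hlo2.trans_isBigO (hCt.isBigO_one ℝ))
  have := hlo3.add (hCt.const_mul A)
  rw [zero_add] at this
  refine this.congr fun k => ?_
  ring

/-- the power series of the iterated kernel -/
lemma kernel_series (m : ℕ) (hm : 2 ≤ m) : ∃ (u : ℕ → ℝ) (c : ℝ), c ≠ 0 ∧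
    (∀ t : ℝ, |t| < 1 → HasSum (fun n => u n * t ^ n) ((fun x : ℝ => 1 - Real.arccos x / π)^[m] t)) ∧
    Tendsto (fun n : ℕ => u n * (n:ℝ) ^ (1 + (1/2:ℝ)^m)) atTop (𝓝 c) := by
  have hM0 : (0:ℝ) ≤ 2 * m := by positivity
  have hnu0 : (0:ℝ) < (1/2)^m := by positivity
  have hnu2 : ((1:ℝ)/2)^m < 1/2 := by
    calc ((1:ℝ)/2)^m ≤ (1/2)^2 := pow_le_pow_of_le_one (by norm_num) (by norm_num) hm
      _ < 1/2 := by norm_num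
  obtain ⟨u, hu, hform⟩ := coeff_formula (f := KK^[m]) (M := 2 * m) hM0 (fun z hz => it_cont m hz)
    (fun z hz => it_diff m hz) (fun z hz => (it_conj m hz).1)
    (fun x hx => by rw [(it_real m hx).1]; exact Complex.ofReal_im _) (fun z hz => it_norm m hz)
  obtain ⟨C, _, _, hC, hCt⟩ := it_right m
  have hCim := hC (by omega)
  have hg1 : Continuous (fun x : ℝ => (KK^[m] (Real.exp x : ℝ)).im) := by
    apply Complex.continuous_im.comp
    rw [continuous_iff_continuousAt]
    intro x
    apply ContinuousAt.comp (g := KK^[m])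
    · exact it_cont m (by simp)
    · fun_prop
  have hg2 : Continuous (fun x : ℝ => (KK^[m] (-(Real.exp x : ℝ))).im) := by
    apply Complex.continuous_im.comp
    rw [continuous_iff_continuousAt]
    intro x
    apply ContinuousAt.comp (g := KK^[m])
    · exact it_cont m (by simp)
    · fun_prop
  have hb1 : ∀ x : ℝ, 0 ≤ x → |(KK^[m] (Real.exp x : ℝ)).im| ≤ 2 * m + Real.exp x := by
    intro x _
    have := it_norm m (z := (Real.exp x : ℝ)) (by simp)
    refine (Complex.abs_im_le_norm _).trans (this.trans_eq ?_)
    rw [Complex.norm_real, Real.norm_of_nonneg (Real.exp_pos _).le]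
  have hb2 : ∀ x : ℝ, 0 ≤ x → |(KK^[m] (-(Real.exp x : ℝ))).im| ≤ 2 * m + Real.exp x := by
    intro x _
    have := it_norm m (z := -(Real.exp x : ℝ)) (by simp)
    refine (Complex.abs_im_le_norm _).trans (this.trans_eq ?_)
    rw [norm_neg, Complex.norm_real, Real.norm_of_nonneg (Real.exp_pos _).le]
  have l1 : Tendsto (fun x : ℝ => (KK^[m] (Real.exp x : ℝ)).im / x ^ ((1/2:ℝ)^m)) (𝓝[>] 0) (𝓝 C.im) := by
    refine ((Complex.continuous_im.tendsto C).comp hCt).congr fun x => ?_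
    simp only [Function.comp]
    rw [Complex.div_ofReal_im]; simp
  have l2 : Tendsto (fun x : ℝ => (KK^[m] (-(Real.exp x : ℝ))).im / x ^ ((1/2:ℝ)^m)) (𝓝[>] 0) (𝓝 0) := by
    have := it_left (m - 1) hnu2
    rwa [show m - 1 + 1 = m by omega] at this
  have A1 := abel hM0 hnu0 hg1 hb1 l1
  have A2 := abel hM0 hnu0 hg2 hb2 l2
  rw [zero_mul] at A2
  have A3 : Tendsto (fun n : ℕ => (-1:ℝ)^n * ((n:ℝ) ^ (1 + (1/2:ℝ)^m) *
      ∫ x in Ioi (0:ℝ), (KK^[m] (-(Real.exp x : ℝ))).im * Real.exp (-(n * x)))) atTop (𝓝 0) := by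
    apply squeeze_zero_norm _ (tendsto_zero_iff_norm_tendsto_zero.1 A2)
    intro n
    rw [norm_mul, norm_pow, norm_neg, norm_one, one_pow, one_mul]
  have hGp := Real.Gamma_pos_of_pos (by linarith : (0:ℝ) < 1 + (1/2:ℝ)^m)
  refine ⟨u, π⁻¹ * (C.im * Real.Gamma (1 + (1/2:ℝ)^m) - 0), ?_, ?_, ?_⟩
  · rw [sub_zero]
    have := Real.pi_pos
    positivity
  · intro t ht
    have := hu t ht
    rwa [(it_real m ht.le).1, Complex.ofReal_re] at this
  · refine ((A1.sub A3).const_mul π⁻¹).congr' ?_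
    filter_upwards [eventually_ge_atTop 2] with n hn
    have h5 := hform n hn
    have hpi := Real.pi_ne_zero
    have h6 : u n = π⁻¹ * (π * u n) := by rw [← mul_assoc, inv_mul_cancel₀ hpi, one_mul]
    rw [h6, h5]
    ring

lemma legendreCoeff_eq (d k : ℕ) (f : ℝ → ℝ) :
    legendreCoeff d k f = (sphereSurface (d - 1) / sphereSurface d) *
      (cc (((d:ℝ) - 3) / 2) k * ∫ t in (-1:ℝ)..1, f t * DD (k + ((d:ℝ) - 3) / 2) k t) := by
  unfold legendreCoeff
  congr 1
  rw [← intervalIntegral.integral_const_mul, intervalIntegral.integral_of_le (by norm_num),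
    intervalIntegral.integral_of_le (by norm_num),
    MeasureTheory.integral_Ioc_eq_integral_Ioo, MeasureTheory.integral_Ioc_eq_integral_Ioo]
  apply MeasureTheory.setIntegral_congr_fun measurableSet_Ioo
  intro t ht
  simp only []
  have hp := one_sub_sq_pos ht
  rw [legendreP, iter_DD _ _ ht, cc]
  have h1 : (1 - t ^ 2) ^ ((3 - (d:ℝ)) / 2) * (1 - t ^ 2) ^ (((d:ℝ) - 3) / 2) = 1 := by
    rw [← Real.rpow_add hp, show (3 - (d:ℝ)) / 2 + ((d:ℝ) - 3) / 2 = 0 by ring, Real.rpow_zero]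
  rw [show ((d:ℝ) - 3) / 2 + 1 = ((d:ℝ) - 1) / 2 by ring]
  set W := DD (k + ((d:ℝ) - 3) / 2) k t
  linear_combination (f t * ((-1 / 2 : ℝ) ^ k * (Real.Gamma (((d : ℝ) - 1) / 2) / Real.Gamma ((k : ℝ) + ((d : ℝ) - 1) / 2))) * W) * h1

lemma sphereSurface_ne {p : ℕ} (hp : 1 ≤ p) : sphereSurface p ≠ 0 := by
  unfold sphereSurface
  have h1 : (0:ℝ) < p := by positivity
  have h2 := Real.Gamma_pos_of_pos (by positivity : (0:ℝ) < (p:ℝ)/2)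
  have := Real.pi_pos
  positivity

end DSD

/-- Decay of the Legendre coefficients of the deep step-activation kernel
`κ_s^L = κ₀^{∘(L-1)}`: with `ν_L = 1/2^{L-1}`, we have `μ_k ∼ C(d,L) k^{-d-2ν_L+1}`
(with the same limit along even and odd `k`). -/
theorem deep_step_decay (d L : ℕ) (hd : 3 ≤ d) (hL : 3 ≤ L) :
    ∃ C : ℝ, C ≠ 0 ∧
      Tendsto (fun k : ℕ =>
          legendreCoeff d k (kappa0^[L - 1]) *
            (k : ℝ) ^ ((d : ℝ) + 2 * ((1 : ℝ) / 2 ^ ((L : ℝ) - 1)) - 1))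
        atTop (𝓝 C) := by
  obtain ⟨u, c, hc, hsum, hlim⟩ := DSD.kernel_series (L - 1) (by omega)
  have hd3 : (3:ℝ) ≤ d := by exact_mod_cast hd
  have ha : (0:ℝ) ≤ ((d:ℝ) - 3) / 2 := by linarith
  have hnu0 : (0:ℝ) < (1/2)^(L-1) := by positivity
  have hnu1 : ((1:ℝ)/2)^(L-1) < 1 := pow_lt_one₀ (by norm_num) (by norm_num) (by omega)
  obtain ⟨C, hC, hCt⟩ := DSD.compare ha hnu0 hnu1 hc hlim hsum
  have hS : sphereSurface (d - 1) / sphereSurface d ≠ 0 :=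
    div_ne_zero (DSD.sphereSurface_ne (by omega)) (DSD.sphereSurface_ne (by omega))
  refine ⟨(sphereSurface (d - 1) / sphereSurface d) * C, mul_ne_zero hS hC, ?_⟩
  refine (hCt.const_mul _).congr fun k => ?_
  have hexp : (1:ℝ) / 2 ^ ((L:ℝ) - 1) = (1/2)^(L-1) := by
    rw [show (L:ℝ) - 1 = ((L - 1 : ℕ) : ℝ) by rw [Nat.cast_sub (by omega)]; simp, Real.rpow_natCast,
      one_div, one_div, inv_pow]
  rw [hexp, DSD.legendreCoeff_eq, mul_assoc (sphereSurface (d - 1) / sphereSurface d)]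
  congr 2
  congr 1
  ring
end
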